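/- arXiv:1106.6262 — 2 statements merged into one kernel-verified Lean document; each statement's English description precedes it below -/
import Mathlib

section
/- There is a largest q ∈ (0,1) such that every complex zero of the entire function u ↦ Ψ(q,u) is real (equivalently, Ψ(q,·) belongs to the Laguerre–Pólya class L-P+); denote it by q̃. Then the limit m_∞ = lim_{i→∞} m_i exists and equals 1/q̃. -/
open Polynomial Filter

/-- A real polynomial is hyperbolic if all of its complex roots are real. -/
def Hyperbolic (P : Polynomial ℝ) : Prop :=
  ∀ z : ℂ, Polynomial.aeval z P = 0 → z.im = 0

/-- The `i`-th section `a_0 + a_1 x + ... + a_i x^i` of the coefficient sequence `a`. -/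
noncomputable def sect (a : ℕ → ℝ) (i : ℕ) : Polynomial ℝ :=
  ∑ j ∈ Finset.range (i + 1), Polynomial.C (a j) * Polynomial.X ^ j

/-- A polynomial `a_0 + ... + a_n x^n` with all coefficients positive is section-hyperbolic
if each of its sections of degree `1,...,n` is hyperbolic. -/
def SectionHyperbolic (a : ℕ → ℝ) (n : ℕ) : Prop :=
  (∀ i ≤ n, 0 < a i) ∧ ∀ i, 1 ≤ i → i ≤ n → Hyperbolic (sect a i)

/-- `m_i`: the infimum of `a_i^2/(a_{i-1} a_{i+1})` over all section-hyperbolic polynomials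
of degree `i+1`. -/
noncomputable def mSeq (i : ℕ) : ℝ :=
  sInf {r : ℝ | ∃ a : ℕ → ℝ, SectionHyperbolic a (i + 1) ∧
    r = a i ^ 2 / (a (i - 1) * a (i + 1))}

/-- The partial theta function `Ψ(q,u) = Σ_{j≥0} q^{j(j+1)/2} u^j`, for real `q` and
complex `u`. -/
noncomputable def PsiC (q : ℝ) (u : ℂ) : ℂ :=
  ∑' j : ℕ, (q : ℂ) ^ (j * (j + 1) / 2) * u ^ j

/-- The partial theta function `Σ (-1)^j q^(j(j-1)/2) z^j`, with alternating signs. -/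
noncomputable def altTheta {𝕜 : Type*} [RCLike 𝕜] (q : ℝ) (z : 𝕜) : 𝕜 :=
  ∑' j : ℕ, ((-1) ^ j * q ^ (j * (j - 1) / 2)) • z ^ j

lemma triangle_succ (j : ℕ) : (j + 1) * (j + 1 - 1) / 2 = j * (j - 1) / 2 + j := by
  have h := Nat.triangle_succ j
  simpa using h

lemma summable_theta {q : ℝ} (hq0 : 0 ≤ q) (hq1 : q < 1) (r : ℝ) :
    Summable fun j : ℕ => q ^ (j * (j - 1) / 2) * r ^ j := by
  have ht : Tendsto (fun j : ℕ => q ^ j * |r|) atTop (nhds 0) := by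
    simpa using (tendsto_pow_atTop_nhds_zero_of_lt_one hq0 hq1).mul_const |r|
  refine summable_of_ratio_norm_eventually_le (r := 1 / 2) (by norm_num) ?_
  filter_upwards [ht.eventually_le_const (show (0 : ℝ) < 1 / 2 by norm_num)] with j hj
  rw [triangle_succ, pow_add, pow_succ]
  simp only [norm_mul, norm_pow, Real.norm_eq_abs, abs_of_nonneg hq0]
  have : 0 ≤ q ^ (j * (j - 1) / 2) * |r| ^ j := by positivity
  nlinarith

lemma hasSum_altTheta {𝕜 : Type*} [RCLike 𝕜] {q : ℝ} (hq0 : 0 ≤ q) (hq1 : q < 1) (z : 𝕜) :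
    HasSum (fun j : ℕ => ((-1) ^ j * q ^ (j * (j - 1) / 2)) • z ^ j) (altTheta q z) := by
  refine Summable.hasSum (Summable.of_norm ?_)
  refine (summable_theta hq0 hq1 ‖z‖).congr fun j => ?_
  simp [norm_smul, abs_of_nonneg hq0]

lemma altTheta_eq {𝕜 : Type*} [RCLike 𝕜] {q : ℝ} (hq0 : 0 ≤ q) (hq1 : q < 1) (z : 𝕜) :
    altTheta q z = 1 - z * altTheta q ((q : 𝕜) * z) := by
  have h1 := (hasSum_nat_add_iff' 1).mpr (hasSum_altTheta hq0 hq1 z)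
  have h2 := (hasSum_altTheta hq0 hq1 ((q : 𝕜) * z)).mul_left (-z)
  have h3 := h1.unique (h2.congr_fun ?_)
  · simp at h3
    linear_combination h3
  · intro j
    rw [triangle_succ]
    simp only [RCLike.real_smul_eq_coe_mul]
    push_cast
    ring

lemma altTheta_zero {𝕜 : Type*} [RCLike 𝕜] {q : ℝ} (hq0 : 0 ≤ q) (hq1 : q < 1) :
    altTheta q (0 : 𝕜) = 1 := by
  rw [altTheta_eq hq0 hq1]; simp

lemma altTheta_ofReal {q : ℝ} (x : ℝ) : ((altTheta q x : ℝ) : ℂ) = altTheta q (x : ℂ) := by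
  simp [altTheta, Complex.ofReal_tsum]

/-- A real series with alternating signs and antitone summable terms lies between consecutive
partial sums. -/
lemma alternating_bounds {f : ℕ → ℝ} {l : ℝ} (hf : Antitone f)
    (hl : HasSum (fun j => (-1) ^ j * f j) l) (k : ℕ) :
    ∑ i ∈ Finset.range (2 * k), (-1) ^ i * f i ≤ l ∧
      l ≤ ∑ i ∈ Finset.range (2 * k + 1), (-1) ^ i * f i :=
  ⟨hf.alternating_series_le_tendsto hl.tendsto_sum_nat k,
    hf.tendsto_le_alternating_series hl.tendsto_sum_nat k⟩

lemma pow_triangle_nonneg {q : ℝ} (hq0 : 0 ≤ q) (j : ℕ) : 0 ≤ q ^ (j * (j - 1) / 2) :=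
  pow_nonneg hq0 _

lemma altTheta_bounds {q x : ℝ} (hq0 : 0 ≤ q) (hq1 : q < 1) (hx0 : 0 ≤ x) (hx1 : x ≤ 1) (k : ℕ) :
    ∑ i ∈ Finset.range (2 * k), (-1) ^ i * (q ^ (i * (i - 1) / 2) * x ^ i) ≤ altTheta q x ∧
      altTheta q x ≤
        ∑ i ∈ Finset.range (2 * k + 1), (-1) ^ i * (q ^ (i * (i - 1) / 2) * x ^ i) := by
  refine alternating_bounds (antitone_nat_of_succ_le fun j => ?_) ?_ k
  · rw [triangle_succ, pow_add, pow_succ]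
    have h1 : q ^ j * x ≤ 1 := mul_le_one₀ (pow_le_one₀ hq0 hq1.le) hx0 hx1
    have h2 : 0 ≤ q ^ (j * (j - 1) / 2) * x ^ j := by positivity
    nlinarith
  · refine (hasSum_altTheta hq0 hq1 x).congr_fun fun j => ?_
    simp [mul_assoc]

lemma altTheta_ge_one_sub {q x : ℝ} (hq0 : 0 ≤ q) (hq1 : q < 1) (hx0 : 0 ≤ x) (hx1 : x ≤ 1) :
    1 - x ≤ altTheta q x := by
  have := (altTheta_bounds hq0 hq1 hx0 hx1 1).1
  norm_num [Finset.sum_range_succ] at this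
  linarith

lemma altTheta_ge_cubic {q x : ℝ} (hq0 : 0 ≤ q) (hq1 : q < 1) (hx0 : 0 ≤ x) (hx1 : x ≤ 1) :
    1 - x + q * x ^ 2 - q ^ 3 * x ^ 3 ≤ altTheta q x := by
  have := (altTheta_bounds hq0 hq1 hx0 hx1 2).1
  norm_num [Finset.sum_range_succ] at this
  linarith

lemma altTheta_le_one {q x : ℝ} (hq0 : 0 ≤ q) (hq1 : q < 1) (hx0 : 0 ≤ x) (hx1 : x ≤ 1) :
    altTheta q x ≤ 1 := by
  have := (altTheta_bounds hq0 hq1 hx0 hx1 0).2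
  norm_num [Finset.sum_range_succ] at this
  linarith

lemma altTheta_le_quartic {q x : ℝ} (hq0 : 0 ≤ q) (hq1 : q < 1) (hx0 : 0 ≤ x) (hx1 : x ≤ 1) :
    altTheta q x ≤ 1 - x + q * x ^ 2 - q ^ 3 * x ^ 3 + q ^ 6 * x ^ 4 := by
  have := (altTheta_bounds hq0 hq1 hx0 hx1 2).2
  norm_num [Finset.sum_range_succ] at this
  linarith

lemma altTheta_nonneg {q x : ℝ} (hq0 : 0 ≤ q) (hq1 : q < 1) (hx0 : 0 ≤ x) (hx1 : x ≤ 1) :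
    0 ≤ altTheta q x :=
  (sub_nonneg.2 hx1).trans (altTheta_ge_one_sub hq0 hq1 hx0 hx1)

lemma pow_sub_pow_succ_le {u v : ℝ} (hv : 0 ≤ v) (hvu : v ≤ u) (hu : u ≤ 1) (j : ℕ) :
    u ^ (j + 2) - v ^ (j + 2) ≤ 2 * (u ^ (j + 1) - v ^ (j + 1)) := by
  have h1 : v ^ (j + 1) ≤ u ^ (j + 1) := pow_le_pow_left₀ hv hvu _
  have h2 : v ^ j * (u - v) ≤ u ^ (j + 1) - v ^ (j + 1) := by
    have : v ^ j * u ≤ u ^ j * u :=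
      mul_le_mul_of_nonneg_right (pow_le_pow_left₀ hv hvu _) (hv.trans hvu)
    rw [pow_succ, pow_succ]; linarith
  have h3 : v ^ (j + 1) * (u - v) ≤ v ^ j * (u - v) :=
    mul_le_mul_of_nonneg_right (pow_le_pow_of_le_one hv (hvu.trans hu) (Nat.le_succ j))
      (sub_nonneg.2 hvu)
  have h4 : (u ^ (j + 1) - v ^ (j + 1)) * u ≤ u ^ (j + 1) - v ^ (j + 1) :=
    mul_le_of_le_one_right (sub_nonneg.2 h1) hu
  have : u ^ (j + 2) - v ^ (j + 2) = (u ^ (j + 1) - v ^ (j + 1)) * u + v ^ (j + 1) * (u - v) := by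
    ring
  linarith

lemma altTheta_sub_bounds {q u v : ℝ} (hq0 : 0 ≤ q) (hq1 : q ≤ 1 / 3) (hv : 0 ≤ v) (hvu : v ≤ u)
    (hu : u ≤ 1) (k : ℕ) :
    ∑ i ∈ Finset.range (2 * k), (-1) ^ i *
        (q ^ ((i + 1) * (i + 1 - 1) / 2) * (u ^ (i + 1) - v ^ (i + 1))) ≤
        altTheta q v - altTheta q u ∧
      altTheta q v - altTheta q u ≤ ∑ i ∈ Finset.range (2 * k + 1), (-1) ^ i *
        (q ^ ((i + 1) * (i + 1 - 1) / 2) * (u ^ (i + 1) - v ^ (i + 1))) := by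
  have hq : q < 1 := by linarith
  refine alternating_bounds (antitone_nat_of_succ_le fun j => ?_) ?_ k
  · have h1 := pow_sub_pow_succ_le hv hvu hu j
    have h2 : 0 ≤ u ^ (j + 1) - v ^ (j + 1) := sub_nonneg.2 (pow_le_pow_left₀ hv hvu _)
    have h3 : q ^ (j + 1) ≤ 1 / 3 := (pow_le_of_le_one hq0 hq.le (by simp)).trans hq1
    rw [triangle_succ (j + 1), pow_add]
    have h4 := pow_triangle_nonneg hq0 (j + 1)
    have h5 : q ^ (j + 1) * (u ^ (j + 1 + 1) - v ^ (j + 1 + 1)) ≤ u ^ (j + 1) - v ^ (j + 1) :=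
      calc q ^ (j + 1) * (u ^ (j + 1 + 1) - v ^ (j + 1 + 1))
          ≤ q ^ (j + 1) * (2 * (u ^ (j + 1) - v ^ (j + 1))) :=
            mul_le_mul_of_nonneg_left h1 (pow_nonneg hq0 _)
        _ ≤ 1 / 3 * (2 * (u ^ (j + 1) - v ^ (j + 1))) :=
            mul_le_mul_of_nonneg_right h3 (by linarith)
        _ ≤ _ := by linarith
    rw [mul_assoc]
    exact mul_le_mul_of_nonneg_left h5 h4
  · have h := (hasSum_altTheta hq0 hq v).sub (hasSum_altTheta hq0 hq u)
    have h' := (hasSum_nat_add_iff' 1).mpr h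
    simp only [Finset.range_one, Finset.sum_singleton, pow_zero, sub_self, sub_zero] at h'
    refine h'.congr_fun fun j => ?_
    simp only [smul_eq_mul, pow_succ (-1 : ℝ) j]
    ring

lemma altTheta_antitone {q u v : ℝ} (hq0 : 0 ≤ q) (hq1 : q ≤ 1 / 3) (hv : 0 ≤ v) (hvu : v ≤ u)
    (hu : u ≤ 1) : altTheta q u ≤ altTheta q v := by
  have := (altTheta_sub_bounds hq0 hq1 hv hvu hu 0).1
  simp at this
  linarith

lemma altTheta_sub_le {q u v : ℝ} (hq0 : 0 ≤ q) (hq1 : q ≤ 1 / 3) (hv : 0 ≤ v) (hvu : v ≤ u)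
    (hu : u ≤ 1) : altTheta q v - altTheta q u ≤ u - v := by
  have := (altTheta_sub_bounds hq0 hq1 hv hvu hu 0).2
  norm_num [Finset.sum_range_succ] at this
  linarith

lemma altTheta_sub_le_cubic {q u v : ℝ} (hq0 : 0 ≤ q) (hq1 : q ≤ 1 / 3) (hv : 0 ≤ v) (hvu : v ≤ u)
    (hu : u ≤ 1) : altTheta q v - altTheta q u ≤
      (u - v) - q * (u ^ 2 - v ^ 2) + q ^ 3 * (u ^ 3 - v ^ 3) := by
  have := (altTheta_sub_bounds hq0 hq1 hv hvu hu 1).2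
  norm_num [Finset.sum_range_succ] at this
  linarith

lemma pow_sub_pow_antitone {p q : ℝ} (hp : 0 ≤ p) (hpq : p ≤ q) (hq : q ≤ 1 / 3) {m n : ℕ}
    (hm : 1 ≤ m) (hmn : m ≤ n) : q ^ n - p ^ n ≤ q ^ m - p ^ m := by
  induction n, hmn using Nat.le_induction with
  | base => exact le_rfl
  | succ n hn ih =>
    obtain ⟨k, rfl⟩ : ∃ k, n = k + 1 := ⟨n - 1, by omega⟩
    refine le_trans ?_ ih
    have h1 : p ^ (k + 1) ≤ q ^ (k + 1) := pow_le_pow_left₀ hp hpq _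
    have h2 : p ^ k * (q - p) ≤ q ^ (k + 1) - p ^ (k + 1) := by
      have : p ^ k * q ≤ q ^ k * q :=
        mul_le_mul_of_nonneg_right (pow_le_pow_left₀ hp hpq _) (hp.trans hpq)
      rw [pow_succ, pow_succ]; linarith
    have h3 : p * (p ^ k * (q - p)) ≤ 1 / 3 * (q ^ (k + 1) - p ^ (k + 1)) :=
      mul_le_mul (hpq.trans hq) h2 (mul_nonneg (pow_nonneg hp _) (sub_nonneg.2 hpq)) (by norm_num)
    have h4 : (q ^ (k + 1) - p ^ (k + 1)) * q ≤ (q ^ (k + 1) - p ^ (k + 1)) * (1 / 3) :=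
      mul_le_mul_of_nonneg_left hq (sub_nonneg.2 h1)
    have : q ^ (k + 1 + 1) - p ^ (k + 1 + 1) =
      (q ^ (k + 1) - p ^ (k + 1)) * q + p * (p ^ k * (q - p)) := by ring
    linarith

lemma altTheta_mono_param {p q x : ℝ} (hp : 0 ≤ p) (hpq : p ≤ q) (hq : q ≤ 1 / 3) (hx0 : 0 ≤ x)
    (hx1 : x ≤ 1) :
    0 ≤ altTheta q x - altTheta p x ∧ altTheta q x - altTheta p x ≤ (q - p) * x ^ 2 := by
  have hq1 : q < 1 := by linarith
  have hp1 : p < 1 := by linarith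
  have hq0 : 0 ≤ q := hp.trans hpq
  have h := (hasSum_altTheta hq0 hq1 x).sub (hasSum_altTheta hp hp1 x)
  have h' := (hasSum_nat_add_iff' 2).mpr h
  norm_num [Finset.sum_range_succ] at h'
  have hA : Antitone fun j : ℕ => (q ^ ((j + 2) * (j + 1) / 2) - p ^ ((j + 2) * (j + 1) / 2)) *
      x ^ (j + 2) := by
    refine antitone_nat_of_succ_le fun j => ?_
    have ht : (j + 1 + 2) * (j + 1 + 1) / 2 = (j + 2) * (j + 1) / 2 + (j + 2) :=
      triangle_succ (j + 2)
    have h1 : 1 ≤ (j + 2) * (j + 1) / 2 := by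
      rw [Nat.le_div_iff_mul_le (by norm_num)]; nlinarith
    refine mul_le_mul (pow_sub_pow_antitone hp hpq hq h1 (by omega))
      (pow_le_pow_of_le_one hx0 hx1 (by omega)) (pow_nonneg hx0 _)
      (sub_nonneg.2 (pow_le_pow_left₀ hp hpq _))
  have hb := alternating_bounds hA (h'.congr_fun fun j => by
    simp [pow_add]; ring) 0
  norm_num [Finset.sum_range_succ] at hb
  exact ⟨by linarith [hb.1], by linarith [hb.2]⟩

lemma altTheta_lipschitz {p q x y : ℝ} (hp0 : 0 ≤ p) (hp : p ≤ 1 / 3) (hq0 : 0 ≤ q)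
    (hq : q ≤ 1 / 3) (hx0 : 0 ≤ x) (hx1 : x ≤ 1) (hy0 : 0 ≤ y) (hy1 : y ≤ 1) :
    |altTheta p x - altTheta q y| ≤ |p - q| + |x - y| := by
  have h1 : |altTheta p x - altTheta q x| ≤ |p - q| := by
    have hx2 : x ^ 2 ≤ 1 := pow_le_one₀ hx0 hx1
    rcases le_total p q with h | h
    · have := altTheta_mono_param hp0 h hq hx0 hx1
      rw [abs_sub_comm, abs_sub_comm p q, abs_of_nonneg this.1, abs_of_nonneg (by linarith)]
      nlinarith
    · have := altTheta_mono_param hq0 h hp hx0 hx1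
      rw [abs_of_nonneg this.1, abs_of_nonneg (by linarith)]
      nlinarith
  have h2 : |altTheta q x - altTheta q y| ≤ |x - y| := by
    rcases le_total x y with h | h
    · rw [abs_of_nonneg (by linarith [altTheta_antitone hq0 hq hx0 h hy1]), abs_sub_comm,
        abs_of_nonneg (by linarith)]
      exact altTheta_sub_le hq0 hq hx0 h hy1
    · rw [abs_sub_comm, abs_of_nonneg (by linarith [altTheta_antitone hq0 hq hy0 h hx1]),
        abs_of_nonneg (by linarith)]
      exact altTheta_sub_le hq0 hq hy0 h hx1
  calc _ ≤ |altTheta p x - altTheta q x| + |altTheta q x - altTheta q y| := abs_sub_le _ _ _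
    _ ≤ _ := add_le_add h1 h2

lemma quintic_upper_pos {y : ℝ} (hy0 : 0 ≤ y) (hy1 : y ≤ 1) :
    y * (1 - y + (3093 / 10000) * y ^ 2 - (3093 / 10000) ^ 3 * y ^ 3 + (3093 / 10000) ^ 6 * y ^ 4) <
      3093 / 10000 := by
  have h1 : 0 ≤ (y - 7178 / 10000) ^ 2 *
      (6004107 / 10000000 - 26818 / 100000 * y + 28332 / 1000000 * y ^ 2
        - 87555 / 100000000 * y ^ 3) := by
    refine mul_nonneg (sq_nonneg _) ?_
    nlinarith [mul_nonneg hy0 (sub_nonneg.2 hy1), mul_nonneg (mul_nonneg hy0 hy0) (sub_nonneg.2 hy1)]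
  have e2 := pow_nonneg hy0 2
  have e3 := pow_nonneg hy0 3
  have e4 := pow_nonneg hy0 4
  have e5 := pow_nonneg hy0 5
  have f2 := pow_le_one₀ (n := 2) hy0 hy1
  have f3 := pow_le_one₀ (n := 3) hy0 hy1
  have f4 := pow_le_one₀ (n := 4) hy0 hy1
  have f5 := pow_le_one₀ (n := 5) hy0 hy1
  ring_nf at h1 ⊢
  nlinarith [sq_nonneg (y - 7178 / 10000)]

lemma critical_witness :
    (3092 / 10000 : ℝ) ≤ 7176 / 10000 * altTheta (3092 / 10000 : ℝ) (7176 / 10000 : ℝ) := by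
  have := (altTheta_bounds (q := 3092 / 10000) (x := 7176 / 10000) (by norm_num) (by norm_num)
    (by norm_num) (by norm_num) 3).1
  norm_num [Finset.sum_range_succ] at this
  norm_num
  linarith

lemma continuousOn_altTheta_real :
    ContinuousOn (fun p : ℝ × ℝ => altTheta p.1 p.2)
      (Set.Icc (0 : ℝ) (1 / 3) ×ˢ Set.Icc (0 : ℝ) 1) := by
  refine LipschitzOnWith.continuousOn (K := 2) (LipschitzOnWith.of_dist_le_mul ?_)
  rintro ⟨p, x⟩ ⟨⟨hp0, hp1⟩, hx0, hx1⟩ ⟨q, y⟩ ⟨⟨hq0, hq1⟩, hy0, hy1⟩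
  have := altTheta_lipschitz hp0 hp1 hq0 hq1 hx0 hx1 hy0 hy1
  simp only [Real.dist_eq, Prod.dist_eq] at this ⊢
  have h1 := le_max_left |p - q| |x - y|
  have h2 := le_max_right |p - q| |x - y|
  norm_num
  linarith

/-- The largest parameter `c ≤ 1/3` for which `y g_c(y)` reaches the value `c` on `[0,1]`. -/
theorem exists_critical : ∃ c : ℝ, 3092 / 10000 ≤ c ∧ c ≤ 3093 / 10000 ∧
    (∃ y ∈ Set.Icc (0 : ℝ) 1, c ≤ y * altTheta c y) ∧
    (∀ y ∈ Set.Icc (0 : ℝ) 1, y * altTheta c y ≤ c) ∧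
    (∀ q, 0 ≤ q → q ≤ 1 / 3 → (∃ y ∈ Set.Icc (0 : ℝ) 1, q ≤ y * altTheta q y) → q ≤ c) := by
  set K : Set (ℝ × ℝ) := Set.Icc (0 : ℝ) (1 / 3) ×ˢ Set.Icc (0 : ℝ) 1 with hK
  have hKc : IsCompact K := isCompact_Icc.prod isCompact_Icc
  set T : Set (ℝ × ℝ) := {p ∈ K | p.1 ≤ p.2 * altTheta p.1 p.2} with hT
  have hTc : IsCompact T := by
    refine hKc.of_isClosed_subset ?_ (fun p hp => hp.1)
    exact hKc.isClosed.isClosed_le continuousOn_fst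
      (continuousOn_snd.mul continuousOn_altTheta_real)
  have hw : ((3092 / 10000 : ℝ), (7176 / 10000 : ℝ)) ∈ T := by
    refine ⟨⟨⟨?_, ?_⟩, ?_, ?_⟩, critical_witness⟩ <;> norm_num
  obtain ⟨⟨c, y0⟩, ⟨⟨⟨hc0, hc1⟩, hy0, hy1⟩, hcy⟩, hmax⟩ :=
    hTc.exists_isMaxOn ⟨_, hw⟩ (continuousOn_fst (s := T))
  simp only at hc0 hc1 hy0 hy1 hcy
  have hmax' : ∀ q, 0 ≤ q → q ≤ 1 / 3 →
      (∃ y ∈ Set.Icc (0 : ℝ) 1, q ≤ y * altTheta q y) → q ≤ c := by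
    rintro q h0 h1 ⟨y, hy, h⟩
    exact hmax (show (q, y) ∈ T from ⟨⟨⟨h0, h1⟩, hy⟩, h⟩)
  have hlo : 3092 / 10000 ≤ c := hmax hw
  have hup : c ≤ 3093 / 10000 := by
    by_contra! hlt
    have h1 := (altTheta_mono_param (p := 3093 / 10000) (by norm_num) hlt.le hc1 hy0 hy1).2
    have h2 := altTheta_le_quartic (q := 3093 / 10000) (by norm_num) (by norm_num) hy0 hy1
    have h3 := quintic_upper_pos hy0 hy1
    have h4 : y0 * altTheta c y0 ≤ y0 * altTheta (3093 / 10000 : ℝ) y0 + (c - 3093 / 10000) := by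
      have hy3 : y0 ^ 3 ≤ 1 := pow_le_one₀ hy0 hy1
      nlinarith [mul_le_mul_of_nonneg_left h1 hy0]
    have h5 := mul_le_mul_of_nonneg_left h2 hy0
    linarith
  refine ⟨c, hlo, hup, ⟨y0, ⟨hy0, hy1⟩, hcy⟩, ?_, hmax'⟩
  rintro y ⟨h0, h1⟩
  by_contra! hlt
  set q := min (1 / 3) (y * altTheta c y)
  have hcq : c < q := lt_min (by linarith) hlt
  refine absurd (hmax' q (hc0.trans hcq.le) (min_le_left _ _) ⟨y, ⟨h0, h1⟩, ?_⟩) hcq.not_ge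
  refine (min_le_right _ _).trans (mul_le_mul_of_nonneg_left ?_ h0)
  linarith [(altTheta_mono_param hc0 hcq.le (min_le_left _ _) h0 h1).1]

/-- The polynomials obtained from the sections of a power series by reversal and rescaling:
`s n` plays the role of the ratio `a (n-1) * a (n+1) / a n ^ 2`. -/
noncomputable def revSect (s : ℕ → ℝ) : ℕ → ℝ[X]
  | 0 => 1 - X
  | n + 1 => 1 - X * (revSect s n).comp (C (s n) * X)

lemma eval_revSect_zero (s : ℕ → ℝ) (x : ℝ) : (revSect s 0).eval x = 1 - x := by
  simp [revSect]

lemma eval_revSect_succ (s : ℕ → ℝ) (n : ℕ) (x : ℝ) :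
    (revSect s (n + 1)).eval x = 1 - x * (revSect s n).eval (s n * x) := by
  simp [revSect]

lemma aeval_revSect_succ (s : ℕ → ℝ) (n : ℕ) (x : ℂ) :
    aeval x (revSect s (n + 1)) = 1 - x * aeval ((s n : ℂ) * x) (revSect s n) := by
  simp [revSect, aeval_comp]

lemma coeff_zero_revSect (s : ℕ → ℝ) (n : ℕ) : (revSect s n).coeff 0 = 1 := by
  cases n <;> simp [revSect]

lemma coeff_succ_revSect (s : ℕ → ℝ) (n k : ℕ) :
    (revSect s (n + 1)).coeff (k + 1) = -((revSect s n).coeff k * s n ^ k) := by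
  simp [revSect, coeff_one]

lemma coeff_one_revSect (s : ℕ → ℝ) (n : ℕ) : (revSect s n).coeff 1 = -1 := by
  cases n with
  | zero => simp [revSect, coeff_one]
  | succ n => rw [coeff_succ_revSect, coeff_zero_revSect]; simp

lemma coeff_two_revSect (s : ℕ → ℝ) (n : ℕ) : (revSect s (n + 1)).coeff 2 = s n := by
  rw [coeff_succ_revSect, coeff_one_revSect]; simp

lemma coeff_three_revSect (s : ℕ → ℝ) (n : ℕ) :
    (revSect s (n + 2)).coeff 3 = -(s n * s (n + 1) ^ 2) := by
  rw [coeff_succ_revSect, coeff_two_revSect]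

lemma one_le_eval_revSect {s : ℕ → ℝ} (hs : ∀ n, 0 ≤ s n) (n : ℕ) :
    ∀ x ≤ 0, 1 ≤ (revSect s n).eval x := by
  induction n with
  | zero => intro x hx; rw [eval_revSect_zero]; linarith
  | succ n ih =>
    intro x hx
    rw [eval_revSect_succ]
    have := ih (s n * x) (mul_nonpos_of_nonneg_of_nonpos (hs n) hx)
    nlinarith

/-- The ratios `a (n-1) * a (n+1) / a n ^ 2`, with value `0` at `n = 0`. -/
noncomputable def ratioSeq (a : ℕ → ℝ) : ℕ → ℝ
  | 0 => 0
  | n + 1 => a n * a (n + 2) / a (n + 1) ^ 2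

lemma aeval_sect_succ (a : ℕ → ℝ) (m : ℕ) (w : ℂ) :
    aeval w (sect a (m + 1)) = aeval w (sect a m) + a (m + 1) * w ^ (m + 1) := by
  simp [sect, Finset.sum_range_succ _ (m + 1)]

lemma revSect_congr {s t : ℕ → ℝ} : ∀ {m : ℕ}, (∀ n < m, s n = t n) → revSect s m = revSect t m
  | 0, _ => rfl
  | m + 1, h => by
    rw [revSect, revSect, revSect_congr fun n hn => h n (by omega), h m (by omega)]

lemma aeval_sect_eq {a : ℕ → ℝ} (m : ℕ) (ha : ∀ i ≤ m + 1, 0 < a i) {w : ℂ} (hw : w ≠ 0) :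
    aeval w (sect a (m + 1)) = a (m + 1) * w ^ (m + 1) *
      aeval (-(a m / (a (m + 1) * w) : ℂ)) (revSect (ratioSeq a) (m + 1)) := by
  have hne : ∀ i ≤ m + 1, (a i : ℂ) ≠ 0 := fun i hi => by exact_mod_cast (ha i hi).ne'
  induction m with
  | zero =>
    have h1 := hne 1 le_rfl
    simp [sect, revSect, ratioSeq, Finset.sum_range_succ]
    field_simp
    ring
  | succ m ih =>
    have h2 := hne (m + 2) le_rfl
    have h1 := hne (m + 1) (by omega)
    rw [aeval_sect_succ, ih (fun i hi => ha i (by omega)) (fun i hi => hne i (by omega)),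
      aeval_revSect_succ _ (m + 1)]
    have e : ((ratioSeq a (m + 1) : ℝ) : ℂ) * (-(a (m + 1) / (a (m + 1 + 1) * w) : ℂ)) =
        -(a m / (a (m + 1) * w) : ℂ) := by
      simp only [ratioSeq]
      push_cast
      field_simp
    rw [e]
    generalize aeval (-(a m / (a (m + 1) * w) : ℂ)) (revSect (ratioSeq a) (m + 1)) = A
    field_simp
    ring

lemma hyperbolic_sect_iff {a : ℕ → ℝ} (m : ℕ) (ha : ∀ i ≤ m + 1, 0 < a i) :
    Hyperbolic (sect a (m + 1)) ↔ Hyperbolic (revSect (ratioSeq a) (m + 1)) := by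
  have h1 : (a (m + 1) : ℂ) ≠ 0 := by exact_mod_cast (ha _ le_rfl).ne'
  have h0 : (a m : ℂ) ≠ 0 := by exact_mod_cast (ha m (by omega)).ne'
  constructor
  · intro h z hz
    have hz0 : z ≠ 0 := by
      rintro rfl
      have : aeval (0 : ℂ) (revSect (ratioSeq a) (m + 1)) = 1 := by simp [revSect]
      simp [this] at hz
    set w : ℂ := -(a m / (a (m + 1) * z)) with hw
    have hw0 : w ≠ 0 := by simp [hw, h1, h0, hz0]
    have e : (-(a m / (a (m + 1) * w) : ℂ)) = z := by
      rw [hw]; field_simp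
    have := h w (by rw [aeval_sect_eq m ha hw0, e, hz, mul_zero])
    have hw' : w = (w.re : ℂ) := by apply Complex.ext <;> simp [this]
    rw [← e, hw']
    norm_cast
  · intro h w hw
    by_cases hw0 : w = 0
    · simp [hw0]
    rw [aeval_sect_eq m ha hw0] at hw
    have := h _ ((mul_eq_zero.1 hw).resolve_left (mul_ne_zero h1 (pow_ne_zero _ hw0)))
    set z : ℂ := -(a m / (a (m + 1) * w)) with hz
    have e : w = (-(a m / (a (m + 1) * z) : ℂ)) := by
      rw [hz]; field_simp
    have hz' : z = (z.re : ℂ) := by apply Complex.ext <;> simp [this]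
    rw [e, hz']
    norm_cast

lemma Hyperbolic.splits {P : ℝ[X]} (h : Hyperbolic P) : P.Splits := by
  refine Splits.of_splits_map (algebraMap ℝ ℂ) (IsAlgClosed.splits _) fun z hz => ?_
  have := h z (by simpa [aeval_def, eval_map] using (mem_roots'.1 hz).2)
  exact ⟨z.re, by apply Complex.ext <;> simp [this]⟩

lemma eq_prod_one_sub_of_splits {P : ℝ[X]} (h : P.Splits) (h0 : P.coeff 0 = 1) :
    P = ((P.roots.map (·⁻¹)).map fun r => 1 - C r * X).prod := by
  have hne : ∀ x ∈ P.roots, x ≠ 0 := by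
    rintro x hx rfl
    have := (mem_roots'.1 hx).2
    rw [IsRoot, ← coeff_zero_eq_eval_zero, h0] at this
    exact one_ne_zero this
  have key : ∀ R : Multiset ℝ, (∀ x ∈ R, x ≠ 0) →
      (R.map fun a => X - C a).prod =
        C ((R.map fun a => -a).prod) * ((R.map (·⁻¹)).map fun r => 1 - C r * X).prod := by
    intro R
    induction R using Multiset.induction with
    | empty => simp
    | cons a R ih =>
      intro hR
      have ha : a ≠ 0 := hR a (by simp)
      simp only [Multiset.map_cons, Multiset.prod_cons, ih fun x hx => hR x (by simp [hx]), C_mul]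
      have : (X - C a : ℝ[X]) = C (-a) * (1 - C a⁻¹ * X) := by
        rw [mul_sub, ← mul_assoc, ← C_mul]
        simp [ha]; ring
      rw [this]; ring
  have h1 := h.eq_prod_roots
  rw [key _ hne, ← mul_assoc, ← C_mul] at h1
  have h2 := congrArg (eval 0) h1
  rw [← coeff_zero_eq_eval_zero, h0] at h2
  simp only [eval_mul, eval_C, eval_multiset_prod, Multiset.map_map, Function.comp_def] at h2
  simp only [eval_sub, eval_one, eval_mul, eval_X, mul_zero, sub_zero, Multiset.map_const',
    Multiset.prod_replicate, one_pow, mul_one] at h2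
  rw [← h2] at h1
  simpa using h1

lemma coeff_succ_one_sub_mul (r : ℝ) (Q : ℝ[X]) (k : ℕ) :
    ((1 - C r * X) * Q).coeff (k + 1) = Q.coeff (k + 1) - r * Q.coeff k := by
  rw [sub_mul, one_mul, coeff_sub, mul_assoc, coeff_C_mul, coeff_X_mul]

lemma newton_prod_one_sub (R : Multiset ℝ) :
    let Q := (R.map fun r => 1 - C r * X).prod
    Q.coeff 0 = 1 ∧ R.sum = -Q.coeff 1 ∧
      (R.map (· ^ 2)).sum = Q.coeff 1 ^ 2 - 2 * Q.coeff 2 ∧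
      (R.map (· ^ 3)).sum = -Q.coeff 1 ^ 3 + 3 * Q.coeff 1 * Q.coeff 2 - 3 * Q.coeff 3 := by
  induction R using Multiset.induction with
  | empty => simp [coeff_one]
  | cons a R ih =>
    simp only [Multiset.map_cons, Multiset.prod_cons, Multiset.sum_cons] at ih ⊢
    obtain ⟨i0, i1, i2, i3⟩ := ih
    rw [coeff_succ_one_sub_mul, coeff_succ_one_sub_mul, coeff_succ_one_sub_mul, i0, i1, i2, i3]
    refine ⟨?_, by ring, by ring, by ring⟩
    rw [mul_coeff_zero, i0]
    simp

lemma power_sum_quadratic_nonneg {R : Multiset ℝ} (hR : ∀ r ∈ R, 0 ≤ r) (t : ℝ) :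
    0 ≤ R.sum * t ^ 2 - 2 * (R.map (· ^ 2)).sum * t + (R.map (· ^ 3)).sum := by
  induction R using Multiset.induction with
  | empty => simp
  | cons a R ih =>
    simp only [Multiset.map_cons, Multiset.sum_cons]
    have h := ih fun r hr => hR r (by simp [hr])
    have ha : 0 ≤ a := hR a (by simp)
    nlinarith [mul_nonneg ha (sq_nonneg (t - a))]

lemma sum_sq_le_of_le {R : Multiset ℝ} {b : ℝ} (hR : ∀ r ∈ R, 0 ≤ r) (hb : ∀ r ∈ R, r ≤ b) :
    (R.map (· ^ 2)).sum ≤ b * R.sum := by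
  induction R using Multiset.induction with
  | empty => simp
  | cons a R ih =>
    simp only [Multiset.map_cons, Multiset.sum_cons]
    have h := ih (fun r hr => hR r (by simp [hr])) (fun r hr => hb r (by simp [hr]))
    have ha : 0 ≤ a := hR a (by simp)
    have hab : a ≤ b := hb a (by simp)
    nlinarith [mul_nonneg ha (sub_nonneg.2 hab)]

/-- If `revSect s (n+2)` is hyperbolic, then Newton's inequalities for its reciprocal roots bound
`s (n+1)` and locate a root. -/
lemma exists_eq_mul_eval_of_hyperbolic {s : ℕ → ℝ} (hs : ∀ n, 0 ≤ s n) {n : ℕ} (ht : s n < 1 / 3)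
    (h : Hyperbolic (revSect s (n + 2))) :
    ∃ y ∈ Set.Icc (0 : ℝ) 1, s (n + 1) = y * (revSect s (n + 1)).eval y := by
  set P := revSect s (n + 2) with hP
  set R := P.roots.map (·⁻¹) with hR
  have hPR : P = (R.map fun r => 1 - C r * X).prod :=
    eq_prod_one_sub_of_splits h.splits (coeff_zero_revSect _ _)
  have hpos : ∀ r ∈ R, 0 < r ∧ P.eval r⁻¹ = 0 := by
    intro r hr
    obtain ⟨x, hx, rfl⟩ := Multiset.mem_map.1 hr
    have hx0 := (mem_roots'.1 hx).2
    rw [IsRoot] at hx0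
    refine ⟨inv_pos.2 ?_, by simpa using hx0⟩
    by_contra! hle
    have := one_le_eval_revSect hs (n + 2) x hle
    rw [← hP, hx0] at this
    linarith
  have hN := newton_prod_one_sub R
  simp only [← hPR] at hN
  obtain ⟨-, h1, h2, h3⟩ := hN
  rw [hP, coeff_one_revSect] at h1 h2 h3
  rw [coeff_two_revSect] at h2 h3
  rw [coeff_three_revSect] at h3
  have hq := power_sum_quadratic_nonneg (fun r hr => (hpos r hr).1.le) (1 - 2 * s (n + 1))
  rw [h1, h2, h3] at hq
  have hs0 := hs (n + 1)
  have hs1 : s (n + 1) < 1 / 3 := by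
    by_contra! hge
    have hlt : s (n + 1) ^ 2 * s n < s (n + 1) ^ 2 * (1 / 3) :=
      mul_lt_mul_of_pos_left ht (by positivity)
    nlinarith
  obtain ⟨r, hr, hsr⟩ : ∃ r ∈ R, s (n + 1) < r := by
    by_contra! hle
    have := sum_sq_le_of_le (fun r hr => (hpos r hr).1.le) hle
    rw [h1, h2] at this
    linarith
  obtain ⟨hr0, hroot⟩ := hpos r hr
  refine ⟨s (n + 1) * r⁻¹, ⟨by positivity, ?_⟩, ?_⟩
  · rw [← div_eq_mul_inv]
    exact (div_le_one hr0).2 hsr.le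
  · rw [hP, eval_revSect_succ] at hroot
    linear_combination s (n + 1) * hroot

lemma eval_revSect_add_two (s : ℕ → ℝ) (n : ℕ) (x : ℝ) :
    (revSect s (n + 2)).eval x =
      1 - x + s (n + 1) * x ^ 2 * (revSect s n).eval (s (n + 1) * s n * x) := by
  rw [eval_revSect_succ, eval_revSect_succ]
  ring_nf

lemma altTheta_eq_two {q : ℝ} (hq0 : 0 ≤ q) (hq1 : q < 1) (x : ℝ) :
    altTheta q x = 1 - x + q * x ^ 2 * altTheta q (q ^ 2 * x) := by
  rw [altTheta_eq hq0 hq1, altTheta_eq hq0 hq1]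
  simp only [RCLike.ofReal_real_eq_id, id_eq]
  ring_nf

section Invariant

variable {c : ℝ}

lemma cubic_loss_bound {e u : ℝ} (hc1 : 3092 / 10000 ≤ c) (hc2 : c ≤ 3093 / 10000)
    (he0 : 0 ≤ e) (he1 : e ≤ 3 / 20) (hu0 : 0 ≤ u) (hu1 : u ≤ 1 / 10) :
    (1 - e) * ((u - u * (1 - e) * (1 - 20 / 3 * e)) -
      c * (u ^ 2 - (u * (1 - e) * (1 - 20 / 3 * e)) ^ 2) +
      c ^ 3 * (u ^ 3 - (u * (1 - e) * (1 - 20 / 3 * e)) ^ 3)) ≤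
    e * (23 / 3 * u * (1 - 2 * c * u + 3 * c ^ 3 * u ^ 2)) := by
  set v := 23 / 3 - 20 / 3 * e with hv
  have hw : u * (1 - e) * (1 - 20 / 3 * e) = u * (1 - e * v) := by rw [hv]; ring
  rw [hw]
  have hv0 : 0 ≤ v := by linarith
  have hv1 : v ≤ 23 / 3 := by linarith
  set X₀ := 1 - 2 * c * u + 3 * c ^ 3 * u ^ 2 with hX
  have hc0 : 0 ≤ c := by linarith
  have hcu : c * u ≤ 3093 / 100000 := by nlinarith
  have hcu0 : 0 ≤ c * u := by positivity
  have hX0 : 9 / 10 ≤ X₀ := by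
    have : 0 ≤ 3 * c ^ 3 * u ^ 2 := by positivity
    linarith
  have hw1 : e * v ≤ 3 := by nlinarith
  have hw0 : 0 ≤ e * v := by positivity
  have e1 : (u - u * (1 - e * v)) - c * (u ^ 2 - (u * (1 - e * v)) ^ 2) +
      c ^ 3 * (u ^ 3 - (u * (1 - e * v)) ^ 3) =
      e * v * u * (X₀ + c * u * (e * v) - c ^ 3 * u ^ 2 * ((e * v) * (3 - e * v))) := by
    rw [hX]; ring
  have e2 : (1 - e) * (X₀ + c * u * (e * v) - c ^ 3 * u ^ 2 * ((e * v) * (3 - e * v))) ≤ X₀ := by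
    have h3 : 0 ≤ c ^ 3 * u ^ 2 * ((e * v) * (3 - e * v)) :=
      mul_nonneg (by positivity) (mul_nonneg hw0 (by linarith))
    have h4 : c * u * v ≤ X₀ := by nlinarith
    have h5 : (1 - e) * (c * u * v) ≤ X₀ := by
      have : 0 ≤ c * u * v := by positivity
      nlinarith
    nlinarith
  rw [e1]
  have e3 : e * v * u * X₀ ≤ e * (23 / 3 * u * X₀) := by
    have : v * (e * u * X₀) ≤ 23 / 3 * (e * u * X₀) :=
      mul_le_mul_of_nonneg_right hv1 (by positivity)
    linarith
  have e4 := mul_le_mul_of_nonneg_left e2 (show 0 ≤ e * v * u by positivity)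
  linarith

lemma gain_lower_bound {s t y : ℝ} (hc1 : 3092 / 10000 ≤ c) (hc2 : c ≤ 3093 / 10000)
    (hs1 : s ≤ c) (ht1 : t ≤ c) (hst : 3 / 20 * (c - t) ≤ c - s)
    (hd : c - s ≤ 3 / 20 * c) (hy0 : 0 ≤ y) (hy1 : y ≤ 1) :
    (c - s) * (1 - 8292 / 10000 * y + 461 / 10000 * y ^ 2 - 7 / 10000 * y ^ 3) ≤
      c * altTheta c (c ^ 2 * y) - s * altTheta c (s * t * y) := by
  have hc0 : 0 < c := by linarith
  set e := (c - s) / c with he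
  have hce : c * e = c - s := by rw [he]; field_simp
  have he0 : 0 ≤ e := div_nonneg (by linarith) hc0.le
  have he1 : e ≤ 3 / 20 := (div_le_iff₀ hc0).2 hd
  have hs : s = c * (1 - e) := by linarith
  have hs0 : 0 ≤ s := by rw [hs]; exact mul_nonneg hc0.le (by linarith)
  set t₀ := c * (1 - 20 / 3 * e) with ht0
  have ht0' : 0 ≤ t₀ := mul_nonneg hc0.le (by linarith)
  have htt : t₀ ≤ t := by rw [ht0]; nlinarith
  set u := c ^ 2 * y with hu
  have hu0 : 0 ≤ u := by positivity
  have hcc : c ^ 2 ≤ 957 / 10000 := by nlinarith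
  have hu1 : u ≤ 1 / 10 := by nlinarith
  have hu2 : s * t₀ * y = u * (1 - e) * (1 - 20 / 3 * e) := by rw [hs, ht0, hu]; ring
  have hsty : s * t₀ * y ≤ s * t * y := by gcongr
  have hstu : s * t * y ≤ u := by
    rw [hu, sq]
    have : s * t ≤ c * c := mul_le_mul hs1 ht1 (by linarith) hc0.le
    gcongr
  have hc3 : c ≤ 1 / 3 := by linarith
  have g1 : altTheta c (s * t * y) ≤ altTheta c (s * t₀ * y) :=
    altTheta_antitone hc0.le hc3 (by positivity) hsty (by linarith)
  have g2 := altTheta_sub_le_cubic hc0.le hc3 (show 0 ≤ s * t₀ * y by positivity)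
    (hsty.trans hstu) (by linarith)
  have g3 := altTheta_ge_cubic hc0.le (by linarith) hu0 (show u ≤ 1 by linarith)
  have g4 := cubic_loss_bound hc1 hc2 he0 he1 hu0 hu1
  rw [hu2] at g2
  set A := (u - u * (1 - e) * (1 - 20 / 3 * e)) -
      c * (u ^ 2 - (u * (1 - e) * (1 - 20 / 3 * e)) ^ 2) +
      c ^ 3 * (u ^ 3 - (u * (1 - e) * (1 - 20 / 3 * e)) ^ 3)
  have g5 : s * altTheta c (s * t * y) ≤ s * (altTheta c u + A) := by
    refine mul_le_mul_of_nonneg_left ?_ hs0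
    rw [hu2] at g1
    linarith
  have g6 : s * A ≤ (c - s) * (23 / 3 * u * (1 - 2 * c * u + 3 * c ^ 3 * u ^ 2)) := by
    have := mul_le_mul_of_nonneg_left g4 hc0.le
    rw [← hce]
    calc s * A = c * ((1 - e) * A) := by rw [hs]; ring
      _ ≤ _ := this
      _ = _ := by ring
  have g7 := mul_le_mul_of_nonneg_left g3 (sub_nonneg.2 hs1)
  have g8 : 1 - 8292 / 10000 * y + 461 / 10000 * y ^ 2 - 7 / 10000 * y ^ 3 ≤
      1 - u + c * u ^ 2 - c ^ 3 * u ^ 3 - 23 / 3 * u * (1 - 2 * c * u + 3 * c ^ 3 * u ^ 2) := by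
    have i1 : 26 / 3 * c ^ 2 ≤ 8292 / 10000 := by
      have : c ^ 2 ≤ (3093 / 10000) ^ 2 := by gcongr
      norm_num at this; linarith
    have i2 : 461 / 10000 ≤ 49 / 3 * c ^ 5 := by
      have : (3092 / 10000) ^ 5 ≤ c ^ 5 := by gcongr
      norm_num at this; linarith
    have i3 : 24 * c ^ 9 ≤ 7 / 10000 := by
      have : c ^ 9 ≤ (3093 / 10000) ^ 9 := by gcongr
      norm_num at this; linarith
    have j1 := mul_le_mul_of_nonneg_right i1 hy0
    have j2 := mul_le_mul_of_nonneg_right i2 (pow_nonneg hy0 2)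
    have j3 := mul_le_mul_of_nonneg_right i3 (pow_nonneg hy0 3)
    calc _ ≤ 1 - 26 / 3 * c ^ 2 * y + 49 / 3 * c ^ 5 * y ^ 2 - 24 * c ^ 9 * y ^ 3 := by linarith
      _ = _ := by rw [hu]; ring
  have g9 := mul_le_mul_of_nonneg_left g8 (sub_nonneg.2 hs1)
  linarith

lemma mul_altTheta_le {s t x : ℝ} (hc1 : 3092 / 10000 ≤ c) (hc2 : c ≤ 3093 / 10000)
    (hs0 : 0 ≤ s) (hs1 : s ≤ c) (ht0 : 0 ≤ t) (ht1 : t ≤ c)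
    (hst : 3 / 20 * (c - t) ≤ c - s) (hx0 : 0 ≤ x) (hx1 : x ≤ 1) :
    s * altTheta c (s * t * x) ≤ c * altTheta c (c ^ 2 * x) := by
  have hc0 : 0 < c := by linarith
  have hcc : c ^ 2 ≤ 957 / 10000 := by nlinarith
  have hcx : c ^ 2 * x ≤ 957 / 10000 := by nlinarith
  have hstx : s * t * x ≤ c ^ 2 * x := by
    rw [sq]; gcongr
  rcases le_total (c - s) (3 / 20 * c) with hd | hd
  · have := gain_lower_bound hc1 hc2 hs1 ht1 hst hd hx0 hx1
    have h2 : 0 ≤ 1 - 8292 / 10000 * x + 461 / 10000 * x ^ 2 - 7 / 10000 * x ^ 3 := by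
      have h3 : x ^ 3 ≤ 1 := pow_le_one₀ hx0 hx1
      nlinarith [sq_nonneg x]
    have := mul_nonneg (sub_nonneg.2 hs1) h2
    linarith
  · have h1 := altTheta_le_one hc0.le (by linarith) (show 0 ≤ s * t * x by positivity) (by linarith)
    have h2 := altTheta_ge_one_sub hc0.le (by linarith) (show 0 ≤ c ^ 2 * x by positivity)
      (by linarith)
    have h3 := mul_le_mul_of_nonneg_left h1 hs0
    have h4 := mul_le_mul_of_nonneg_left h2 hc0.le
    nlinarith

lemma quintic_lower_nonneg {y : ℝ} (hy0 : 0 ≤ y) (hy1 : y ≤ 705 / 1000) :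
    0 ≤ 3092 / 10000 - y * (1 - y + (3092 / 10000) * y ^ 2 - (3092 / 10000) ^ 3 * y ^ 3 +
      (3092 / 10000) ^ 6 * y ^ 4) := by
  have h1 : 0 ≤ (y - 705 / 1000) ^ 2 *
      (6068 / 10000 - 26883 / 100000 * y + 2832 / 100000 * y ^ 2 - 874 / 1000000 * y ^ 3) := by
    refine mul_nonneg (sq_nonneg _) ?_
    nlinarith [mul_nonneg hy0 (sub_nonneg.2 hy1), mul_nonneg (mul_nonneg hy0 hy0) (sub_nonneg.2 hy1)]
  have e2 := pow_nonneg hy0 2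
  have e3 := pow_nonneg hy0 3
  have e4 := pow_nonneg hy0 4
  have e5 := pow_nonneg hy0 5
  have f2 := pow_le_one₀ (n := 2) hy0 (by linarith)
  have f3 := pow_le_one₀ (n := 3) hy0 (by linarith)
  have f4 := pow_le_one₀ (n := 4) hy0 (by linarith)
  have f5 := pow_le_one₀ (n := 5) hy0 (by linarith)
  ring_nf at h1 ⊢
  nlinarith [sq_nonneg (y - 705 / 1000)]

lemma sextic_lower_nonneg {y : ℝ} (hy0 : 0 ≤ y) (hy1 : y ≤ 705 / 1000) :
    0 ≤ 3092 / 10000 - y * (1 - y + (3092 / 10000) * y ^ 2 - (3092 / 10000) ^ 3 * y ^ 3 +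
      (3092 / 10000) ^ 6 * y ^ 4) + 464 / 10000 *
      (y ^ 3 * (1 - 8292 / 10000 * y + 461 / 10000 * y ^ 2 - 7 / 10000 * y ^ 3) - 3 / 20) := by
  have h1 : 0 ≤ (y - 697 / 1000) ^ 2 *
      (6223 / 10000 - 27343 / 100000 * y - 72 / 10000 * y ^ 2 + 1219 / 1000000 * y ^ 3
        - 4 / 100000 * y ^ 4) := by
    have f4 := pow_le_one₀ (n := 4) hy0 (by linarith)
    have e3 := pow_nonneg hy0 3
    refine mul_nonneg (sq_nonneg _) ?_
    nlinarith [mul_nonneg hy0 (sub_nonneg.2 hy1), mul_nonneg (mul_nonneg hy0 hy0) (sub_nonneg.2 hy1)]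
  have e2 := pow_nonneg hy0 2
  have e3 := pow_nonneg hy0 3
  have e4 := pow_nonneg hy0 4
  have e5 := pow_nonneg hy0 5
  have e6 := pow_nonneg hy0 6
  have f2 := pow_le_one₀ (n := 2) hy0 (by linarith)
  have f3 := pow_le_one₀ (n := 3) hy0 (by linarith)
  have f4 := pow_le_one₀ (n := 4) hy0 (by linarith)
  have f5 := pow_le_one₀ (n := 5) hy0 (by linarith)
  have f6 := pow_le_one₀ (n := 6) hy0 (by linarith)
  ring_nf at h1 ⊢
  nlinarith [sq_nonneg (y - 697 / 1000)]

lemma gain_factor_nonneg {y : ℝ} (hy0 : 705 / 1000 ≤ y) (hy1 : y ≤ 1) :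
    0 ≤ y ^ 3 * (1 - 8292 / 10000 * y + 461 / 10000 * y ^ 2 - 7 / 10000 * y ^ 3) - 3 / 20 := by
  have h1 : 0 ≤ (y - 705 / 1000) * (1 - y) :=
    mul_nonneg (by linarith) (by linarith)
  have h0 : 0 ≤ y := by linarith
  have a1 : 1 - 8292 / 10000 * y + 44 / 1000 * y ^ 2 ≤
      1 - 8292 / 10000 * y + 461 / 10000 * y ^ 2 - 7 / 10000 * y ^ 3 := by
    nlinarith [mul_nonneg (sq_nonneg y) (sub_nonneg.2 hy1), sq_nonneg y]
  have a2 := mul_le_mul_of_nonneg_left a1 (pow_nonneg h0 3)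
  have a3 : 3 / 20 ≤ y ^ 3 * (1 - 8292 / 10000 * y + 44 / 1000 * y ^ 2) := by
    nlinarith [mul_nonneg h1 h0, mul_nonneg h1 (sq_nonneg y), mul_nonneg h1 (pow_nonneg h0 3),
      mul_nonneg h1 (mul_nonneg h0 (sub_nonneg.2 hy1))]
  linarith

lemma quartic_value_le {s t y : ℝ} (hc1 : 3092 / 10000 ≤ c) (hc2 : c ≤ 3093 / 10000)
    (hN : ∀ y ∈ Set.Icc (0 : ℝ) 1, y * altTheta c y ≤ c)
    (hs0 : 0 ≤ s) (hs1 : s ≤ c) (ht0 : 0 ≤ t) (ht1 : t ≤ c)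
    (hst : 3 / 20 * (c - t) ≤ c - s) (hy0 : 0 ≤ y) (hy1 : y ≤ 1) :
    y * (1 - y + s * y ^ 2 * altTheta c (s * t * y)) ≤ c - 3 / 20 * (c - s) := by
  have hc0 : 0 < c := by linarith
  have y3 : y ^ 3 ≤ 1 := pow_le_one₀ hy0 hy1
  have y30 : 0 ≤ y ^ 3 := pow_nonneg hy0 3
  rcases le_total (c - s) (3 / 20 * c) with hd | hd
  · have h1 := gain_lower_bound hc1 hc2 hs1 ht1 hst hd hy0 hy1
    have h2 := mul_le_mul_of_nonneg_left h1 y30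
    have h3 := altTheta_eq_two hc0.le (by linarith) y
    set k := 1 - 8292 / 10000 * y + 461 / 10000 * y ^ 2 - 7 / 10000 * y ^ 3 with hk
    suffices 0 ≤ c - y * altTheta c y + (c - s) * (y ^ 3 * k - 3 / 20) by
      rw [h3] at this
      nlinarith
    rcases le_total (705 / 1000) y with hy | hy
    · have h4 := mul_nonneg (sub_nonneg.2 hs1) (gain_factor_nonneg hy hy1)
      have h5 := hN y ⟨hy0, hy1⟩
      rw [← hk] at h4
      linarith
    · have h4 := (altTheta_mono_param (p := 3092 / 10000) (by norm_num) hc1 (by linarith) hy0 hy1).2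
      have h5 := altTheta_le_quartic (q := 3092 / 10000) (by norm_num) (by norm_num) hy0 hy1
      have h6 := quintic_lower_nonneg hy0 hy
      have h7 := sextic_lower_nonneg hy0 hy
      rw [← hk] at h7
      set M := y * (1 - y + (3092 / 10000) * y ^ 2 - (3092 / 10000) ^ 3 * y ^ 3 +
        (3092 / 10000) ^ 6 * y ^ 4)
      have h8 : y * altTheta c y ≤ M + (c - 3092 / 10000) := by
        have h9 := mul_le_mul_of_nonneg_left h4 hy0
        have h10 : y * altTheta (3092 / 10000 : ℝ) y ≤ M := mul_le_mul_of_nonneg_left h5 hy0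
        have h11 := mul_nonneg (sub_nonneg.2 hc1) (sub_nonneg.2 y3)
        linarith
      have hd' : c - s ≤ 464 / 10000 := by linarith
      nlinarith [mul_nonneg (sub_nonneg.2 hs1) h7, mul_nonneg (sub_nonneg.2 hd') h6]
  · have hst1 : s * t * y ≤ 1 := by
      have : s * t ≤ 1 := by nlinarith
      have h0 : 0 ≤ s * t := by positivity
      nlinarith
    have h1 := altTheta_le_one hc0.le (by linarith) (show 0 ≤ s * t * y by positivity) hst1
    have h2 := mul_le_mul_of_nonneg_left h1 (show 0 ≤ s * y ^ 3 by positivity)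
    have h3 : y - y ^ 2 ≤ 1 / 4 := by nlinarith [sq_nonneg (y - 1 / 2)]
    have h4 : 0 ≤ 3022 / 10000 - y + y ^ 2 - 2629 / 10000 * y ^ 3 := by
      nlinarith [mul_nonneg hy0 (sq_nonneg (y - 7 / 10)), sq_nonneg (y - 7 / 10),
        mul_nonneg (sub_nonneg.2 hy1) (sq_nonneg (y - 7 / 10))]
    have h5 : y - y ^ 2 + s * y ^ 3 ≤ c - 3 / 20 * (c - s) := by
      rcases le_total (y ^ 3) (3 / 20) with h | h
      · have := mul_nonneg hs0 (sub_nonneg.2 h)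
        nlinarith
      · nlinarith [mul_nonneg (show 0 ≤ 17 / 20 * c - s by linarith) (sub_nonneg.2 h)]
    nlinarith

/-- Section-hyperbolicity keeps every ratio below the critical parameter. -/
theorem ratio_le_critical {s : ℕ → ℝ} (hc1 : 3092 / 10000 ≤ c) (hc2 : c ≤ 3093 / 10000)
    (hN : ∀ y ∈ Set.Icc (0 : ℝ) 1, y * altTheta c y ≤ c) (hs : ∀ n, 0 ≤ s n) (hs0 : s 0 = 0)
    (n : ℕ) (h : ∀ m, 2 ≤ m → m ≤ n + 2 → Hyperbolic (revSect s m)) :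
    s n ≤ c ∧ s (n + 1) ≤ c ∧ 3 / 20 * (c - s n) ≤ c - s (n + 1) ∧
      (∀ x ∈ Set.Icc (0 : ℝ) 1, (revSect s n).eval x ≤ altTheta c x) ∧
      (∀ x ∈ Set.Icc (0 : ℝ) 1, (revSect s (n + 1)).eval x ≤ altTheta c x) := by
  have hc0 : 0 < c := by linarith
  have hc1' : c < 1 := by linarith
  induction n with
  | zero =>
    have hlin : ∀ x ∈ Set.Icc (0 : ℝ) 1, 1 - x ≤ altTheta c x :=
      fun x hx => altTheta_ge_one_sub hc0.le hc1' hx.1 hx.2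
    have h1 : ∀ x, (revSect s 1).eval x = 1 - x := by
      intro x
      rw [eval_revSect_succ, eval_revSect_zero, hs0]
      ring
    obtain ⟨y, hy, he⟩ := exists_eq_mul_eval_of_hyperbolic hs (n := 0) (by rw [hs0]; norm_num)
      (h 2 le_rfl le_rfl)
    rw [zero_add, h1] at he
    have hs1 : s 1 ≤ 1 / 4 := by nlinarith [sq_nonneg (y - 1 / 2)]
    simp only [eval_revSect_zero, zero_add, h1, hs0]
    exact ⟨hc0.le, by linarith, by linarith, hlin, hlin⟩
  | succ n ih =>
    obtain ⟨i1, i2, i3, i4, i5⟩ := ih fun m h2 hm => h m h2 (by omega)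
    have key : ∀ x ∈ Set.Icc (0 : ℝ) 1, (revSect s (n + 2)).eval x ≤
        1 - x + s (n + 1) * x ^ 2 * altTheta c (s (n + 1) * s n * x) := by
      rintro x ⟨hx0, hx1⟩
      rw [eval_revSect_add_two]
      have h0 : 0 ≤ s (n + 1) * s n * x := mul_nonneg (mul_nonneg (hs _) (hs _)) hx0
      have h1 : s (n + 1) * s n * x ≤ 1 := by
        have h2 : s (n + 1) * s n ≤ 1 * 1 :=
          mul_le_mul (by linarith) (by linarith) (hs _) zero_le_one
        calc s (n + 1) * s n * x ≤ 1 * 1 * 1 := mul_le_mul h2 hx1 hx0 (by norm_num)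
          _ = 1 := by norm_num
      have := mul_le_mul_of_nonneg_left (i4 _ ⟨h0, h1⟩)
        (show 0 ≤ s (n + 1) * x ^ 2 from mul_nonneg (hs _) (sq_nonneg x))
      linarith
    have hnew : 3 / 20 * (c - s (n + 1)) ≤ c - s (n + 2) := by
      obtain ⟨y, hy, he⟩ := exists_eq_mul_eval_of_hyperbolic hs (n := n + 1) (by linarith)
        (h (n + 3) (by omega) le_rfl)
      have h1 := quartic_value_le hc1 hc2 hN (hs _) i2 (hs _) i1 i3 hy.1 hy.2
      have h2 := mul_le_mul_of_nonneg_left (key y hy) hy.1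
      rw [show n + 1 + 1 = n + 2 from rfl] at he
      linarith
    refine ⟨i2, by linarith, hnew, i5, fun x hx => (key x hx).trans ?_⟩
    rw [altTheta_eq_two hc0.le hc1' x]
    have := mul_altTheta_le hc1 hc2 (hs _) i2 (hs _) i1 i3 hx.1 hx.2
    nlinarith [mul_le_mul_of_nonneg_left this (sq_nonneg x)]

end Invariant

lemma Polynomial.Splits.hyperbolic {P : ℝ[X]} (h : P.Splits) (h0 : P ≠ 0) : Hyperbolic P := by
  intro z hz
  obtain ⟨x, rfl⟩ := h.mem_range_of_isRoot h0 (i := algebraMap ℝ ℂ)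
    (by rwa [IsRoot, eval_map, ← aeval_def])
  simp

/-- A real polynomial of degree at most `n` whose signs alternate along `n + 1` increasing points
has only real roots. -/
lemma hyperbolic_of_alternating {P : ℝ[X]} {n : ℕ} (hdeg : P.natDegree ≤ n) (x : ℕ → ℝ)
    (hx : ∀ j < n, x j < x (j + 1)) (hodd : ∀ j ≤ n, Odd j → P.eval (x j) < 0)
    (heven : ∀ j ≤ n, Even j → 0 < P.eval (x j)) : Hyperbolic P := by
  have hP0 : P ≠ 0 := fun h => by simpa [h] using heven 0 (Nat.zero_le _) (by simp)
  have hroot : ∀ j : ℕ, j < n → ∃ r, x j < r ∧ r < x (j + 1) ∧ P.eval r = 0 := by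
    intro j hj
    have hcont : ContinuousOn (fun t => P.eval t) (Set.Icc (x j) (x (j + 1))) :=
      P.continuous.continuousOn
    rcases Nat.even_or_odd j with he | ho
    · obtain ⟨r, hr, h0⟩ := intermediate_value_Ioo' (hx j hj).le hcont
        ⟨hodd (j + 1) hj he.add_one, heven j hj.le he⟩
      exact ⟨r, hr.1, hr.2, h0⟩
    · obtain ⟨r, hr, h0⟩ := intermediate_value_Ioo (hx j hj).le hcont
        ⟨hodd j hj.le ho, heven (j + 1) hj ho.add_one⟩
      exact ⟨r, hr.1, hr.2, h0⟩
  choose! r hr1 hr2 hr0 using hroot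
  have hxmono : ∀ i j, i ≤ j → j ≤ n → x i ≤ x j := by
    intro i j hij
    induction j, hij using Nat.le_induction with
    | base => intro _; exact le_rfl
    | succ j _ ih => intro hj; exact (ih (by omega)).trans (hx j (by omega)).le
  have hinj : Set.InjOn r (Finset.range n) := by
    have hlt : ∀ i j, i < j → j < n → r i < r j := fun i j hij hj =>
      (hr2 i (hij.trans hj)).trans_le ((hxmono (i + 1) j hij hj.le).trans (hr1 j hj).le)
    intro i hi j hj hrij
    simp only [Finset.coe_range, Set.mem_Iio] at hi hj
    rcases lt_trichotomy i j with h | h | h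
    · exact absurd hrij (hlt i j h hj).ne
    · exact h
    · exact absurd hrij (hlt j i h hi).ne'
  have hsub : (Finset.range n).image r ⊆ P.roots.toFinset := by
    intro y hy
    obtain ⟨j, hj, rfl⟩ := Finset.mem_image.1 hy
    simpa [hP0] using hr0 j (Finset.mem_range.1 hj)
  have hcard : n ≤ P.roots.card := by
    have := Finset.card_le_card hsub
    rw [Finset.card_image_of_injOn hinj, Finset.card_range] at this
    exact this.trans (Multiset.toFinset_card_le _)
  refine Splits.hyperbolic (splits_iff_card_roots.2 ?_) hP0
  exact le_antisymm (P.card_roots') (hdeg.trans hcard)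

lemma natDegree_revSect_le {s : ℕ → ℝ} (hs0 : s 0 = 0) (n : ℕ) :
    (revSect s (n + 1)).natDegree ≤ n + 1 := by
  induction n with
  | zero =>
    simp only [revSect, hs0, C_0, zero_mul, comp_zero]
    compute_degree
  | succ n ih =>
    rw [revSect]
    refine (natDegree_sub_le _ _).trans (max_le (by simp) ?_)
    refine natDegree_mul_le.trans ?_
    have h1 : ((revSect s (n + 1)).comp (C (s (n + 1)) * X)).natDegree ≤ (n + 1) * 1 :=
      natDegree_comp_le.trans (Nat.mul_le_mul ih ((natDegree_C_mul_le _ _).trans natDegree_X_le))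
    have h2 := natDegree_X_le (R := ℝ)
    omega

lemma exists_alternating_points {s : ℕ → ℝ} (hs0 : s 0 = 0) {y₀ : ℝ} (hy : y₀ < 1)
    (hs : ∀ k, 1 ≤ k → 0 < s k ∧ s k < y₀ ∧ s k < y₀ * (revSect s k).eval y₀) (n : ℕ) :
    ∃ x : ℕ → ℝ, x 0 = 0 ∧ (∀ j < n + 1, x j < x (j + 1)) ∧ (∀ j, 1 ≤ j → j ≤ n + 1 → 1 < x j) ∧
      (∀ j ≤ n + 1, Odd j → (revSect s (n + 1)).eval (x j) < 0) ∧
      (∀ j ≤ n + 1, Even j → 1 ≤ (revSect s (n + 1)).eval (x j)) := by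
  have hzero : ∀ m, (revSect s m).eval 0 = 1 := fun m => by
    rw [← coeff_zero_eq_eval_zero, coeff_zero_revSect]
  induction n with
  | zero =>
    refine ⟨fun j => 2 * j, by simp, ?_, ?_, ?_, ?_⟩
    · intro j _; push_cast; linarith
    · intro j h1 h2
      obtain rfl : j = 1 := by omega
      norm_num
    · intro j h1 h2
      obtain rfl : j = 1 := by obtain ⟨k, rfl⟩ := h2; omega
      rw [eval_revSect_succ, hs0, eval_revSect_zero]
      norm_num
    · intro j h1 h2
      obtain rfl : j = 0 := by obtain ⟨k, rfl⟩ := h2; omega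
      simp [hzero]
  | succ n ih =>
    obtain ⟨x, hx0, hxlt, hx1, hodd, heven⟩ := ih
    obtain ⟨hspos, hsy, hsval⟩ := hs (n + 1) (by omega)
    set σ := s (n + 1)
    have hval : ∀ t, (revSect s (n + 1 + 1)).eval (t / σ) =
        1 - t / σ * (revSect s (n + 1)).eval t := by
      intro t
      rw [eval_revSect_succ, mul_div_cancel₀ _ hspos.ne']
    have hbig : ∀ j, 1 ≤ j → j ≤ n + 1 → 1 < x j / σ := fun j h1 h2 =>
      (one_lt_div hspos).2 ((hsy.trans hy).trans (hx1 j h1 h2))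
    refine ⟨fun j => match j with | 0 => 0 | 1 => y₀ / σ | j + 2 => x (j + 1) / σ, rfl,
      ?_, ?_, ?_, ?_⟩
    · intro j hj
      match j with
      | 0 => exact div_pos (hspos.trans hsy) hspos
      | 1 => exact (div_lt_div_iff_of_pos_right hspos).2 (hy.trans (hx1 1 le_rfl (by omega)))
      | j + 2 => exact (div_lt_div_iff_of_pos_right hspos).2 (hxlt (j + 1) (by omega))
    · intro j h1 hj
      match j with
      | 1 => exact (one_lt_div hspos).2 hsy
      | j + 2 => exact hbig (j + 1) (by omega) (by omega)
    · intro j hj ho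
      match j with
      | 1 =>
        simp only [hval]
        have : 1 < y₀ / σ * (revSect s (n + 1)).eval y₀ := by
          rw [div_mul_eq_mul_div]
          exact (one_lt_div hspos).2 hsval
        linarith
      | j + 2 =>
        simp only [hval]
        have h1 := heven (j + 1) (by omega) (by grind)
        have h2 : 1 < x (j + 1) / σ := hbig (j + 1) (by omega) (by omega)
        nlinarith
    · intro j hj he
      match j with
      | 0 => simp [hzero]
      | 1 => exact absurd he (by decide)
      | j + 2 =>
        simp only [hval]
        have h1 := hodd (j + 1) (by omega) (by grind)
        have h2 : 1 < x (j + 1) / σ := hbig (j + 1) (by omega) (by omega)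
        nlinarith

lemma hyperbolic_revSect {s : ℕ → ℝ} (hs0 : s 0 = 0) {y₀ : ℝ} (hy : y₀ < 1)
    (hs : ∀ k, 1 ≤ k → 0 < s k ∧ s k < y₀ ∧ s k < y₀ * (revSect s k).eval y₀) (n : ℕ) :
    Hyperbolic (revSect s (n + 1)) := by
  obtain ⟨x, -, h1, -, h2, h3⟩ := exists_alternating_points hs0 hy hs n
  exact hyperbolic_of_alternating (natDegree_revSect_le hs0 n) x h1 h2
    fun j hj he => zero_lt_one.trans_le (h3 j hj he)

lemma abs_revSect_sub_altTheta_le {s : ℕ → ℝ} (hs0 : s 0 = 0) (hs : ∀ n, 0 ≤ s n)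
    (hs1 : ∀ n, s n ≤ 1 / 3) {η : ℝ} (hη : ∀ n, |s n - s (n + 1)| ≤ η) (n : ℕ) :
    (∀ x ∈ Set.Icc (0 : ℝ) 1, |(revSect s n).eval x - altTheta (s n) x| ≤ 3 * η) ∧
      (∀ x ∈ Set.Icc (0 : ℝ) 1, |(revSect s (n + 1)).eval x - altTheta (s (n + 1)) x| ≤ 3 * η) := by
  have hη0 : 0 ≤ η := (abs_nonneg _).trans (hη 0)
  induction n with
  | zero =>
    constructor
    · intro x hx
      rw [eval_revSect_zero, hs0, altTheta_eq le_rfl (by norm_num)]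
      simp only [RCLike.ofReal_real_eq_id, id_eq, zero_mul]
      rw [altTheta_zero le_rfl (by norm_num)]
      simpa using hη0
    · rintro x ⟨hx0, hx1⟩
      have h1 := hs 1
      have h1' := hs1 1
      have h2 := hη 0
      rw [hs0, zero_add, zero_sub, abs_neg, abs_of_nonneg h1] at h2
      rw [eval_revSect_succ, eval_revSect_zero, hs0, zero_add,
        altTheta_eq_two h1 (by linarith), zero_mul]
      have hx2 : s 1 ^ 2 * x ≤ 1 := by
        have : s 1 ^ 2 ≤ 1 := pow_le_one₀ h1 (by linarith)
        nlinarith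
      have g1 := altTheta_le_one h1 (by linarith) (show 0 ≤ s 1 ^ 2 * x by positivity) hx2
      have g0 := altTheta_nonneg h1 (by linarith) (show 0 ≤ s 1 ^ 2 * x by positivity) hx2
      have hxx : x ^ 2 ≤ 1 := pow_le_one₀ hx0 hx1
      have g2 : s 1 * x ^ 2 * altTheta (s 1) (s 1 ^ 2 * x) ≤ s 1 * 1 * 1 := by gcongr
      have g3 : 0 ≤ s 1 * x ^ 2 * altTheta (s 1) (s 1 ^ 2 * x) := by positivity
      rw [abs_le]
      constructor <;> linarith
  | succ n ih =>
    refine ⟨ih.2, ?_⟩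
    rintro x ⟨hx0, hx1⟩
    have hσ0 := hs (n + 2)
    have hσ1 := hs1 (n + 2)
    have hτ0 := hs (n + 1)
    have hτ1 := hs1 (n + 1)
    have ht0 := hs n
    have ht1 := hs1 n
    have d1 := hη (n + 1)
    have d0 := hη n
    rw [show n + 1 + 1 = n + 2 from rfl] at *
    rw [eval_revSect_add_two, altTheta_eq_two hσ0 (by linarith)]
    set σ := s (n + 2)
    set τ := s (n + 1)
    set t := s n
    have d2 : |t - σ| ≤ 2 * η := by
      calc |t - σ| ≤ |t - τ| + |τ - σ| := abs_sub_le _ _ _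
        _ ≤ 2 * η := by linarith
    have hτt : τ * t ≤ 1 / 9 := by nlinarith
    have hτt0 : 0 ≤ τ * t := by positivity
    have hσσ : σ ^ 2 ≤ 1 / 9 := by nlinarith
    have ha1 : τ * t * x ≤ 1 := by nlinarith
    have hb1 : σ ^ 2 * x ≤ 1 := by nlinarith [sq_nonneg σ]
    have e1 := ih.1 (τ * t * x) ⟨by positivity, ha1⟩
    have e2 := altTheta_lipschitz ht0 ht1 hσ0 hσ1 (show 0 ≤ τ * t * x by positivity) ha1
      (show 0 ≤ σ ^ 2 * x by positivity) hb1
    have e3 : |τ * t * x - σ ^ 2 * x| ≤ η := by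
      have : τ * t * x - σ ^ 2 * x = ((τ - σ) * t + σ * (t - σ)) * x := by ring
      rw [this, abs_mul, abs_of_nonneg hx0]
      have h1 : |(τ - σ) * t + σ * (t - σ)| ≤ η := by
        refine (abs_add_le _ _).trans ?_
        rw [abs_mul, abs_mul, abs_of_nonneg ht0, abs_of_nonneg hσ0]
        nlinarith [abs_nonneg (τ - σ), abs_nonneg (t - σ)]
      nlinarith [abs_nonneg ((τ - σ) * t + σ * (t - σ))]
    have g1 := altTheta_le_one hσ0 (by linarith) (show 0 ≤ σ ^ 2 * x by positivity) hb1
    have g0 := altTheta_nonneg hσ0 (by linarith) (show 0 ≤ σ ^ 2 * x by positivity) hb1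
    set A := (revSect s n).eval (τ * t * x)
    set B := altTheta t (τ * t * x)
    set D := altTheta σ (σ ^ 2 * x)
    have e4 : |A - D| ≤ 6 * η := by
      calc |A - D| ≤ |A - B| + |B - D| := abs_sub_le _ _ _
        _ ≤ 6 * η := by linarith
    have e5 : |τ * A - σ * D| ≤ 3 * η := by
      have : τ * A - σ * D = τ * (A - D) + (τ - σ) * D := by ring
      rw [this]
      refine (abs_add_le _ _).trans ?_
      rw [abs_mul, abs_mul, abs_of_nonneg hτ0, abs_of_nonneg g0]
      nlinarith [abs_nonneg (A - D), abs_nonneg (τ - σ)]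
    have : 1 - x + τ * x ^ 2 * A - (1 - x + σ * x ^ 2 * D) = (τ * A - σ * D) * x ^ 2 := by ring
    rw [this, abs_mul, abs_of_nonneg (sq_nonneg x)]
    have hxx : x ^ 2 ≤ 1 := pow_le_one₀ hx0 hx1
    nlinarith [abs_nonneg (τ * A - σ * D)]

/-- Below the critical parameter, a slowly increasing ratio sequence that becomes constant equal to
`q` yields only hyperbolic polynomials. -/
theorem exists_hyperbolic_ramp {c : ℝ} (hc : c ≤ 3093 / 10000)
    (hy : ∃ y ∈ Set.Icc (0 : ℝ) 1, c ≤ y * altTheta c y) {q : ℝ} (hq0 : 0 < q) (hqc : q < c) :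
    ∃ s : ℕ → ℝ, s 0 = 0 ∧ (∀ k, 1 ≤ k → 0 < s k) ∧ (∃ K, ∀ k ≥ K, s k = q) ∧
      ∀ n, Hyperbolic (revSect s (n + 1)) := by
  obtain ⟨y, ⟨hy0, hy1⟩, hcy⟩ := hy
  have hc0 : 0 < c := hq0.trans hqc
  have hyc : c ≤ y := by
    have := altTheta_le_one hc0.le (by linarith) hy0 hy1
    nlinarith
  have hy1' : y < 1 := by
    refine lt_of_le_of_ne hy1 ?_
    rintro rfl
    rw [altTheta_eq hc0.le (by linarith)] at hcy
    simp only [RCLike.ofReal_real_eq_id, id_eq, mul_one, one_mul] at hcy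
    have h1 := altTheta_ge_cubic hc0.le (by linarith) hc0.le (show c ≤ 1 by linarith)
    have h2 : 0 < c ^ 3 * (1 - c ^ 3) :=
      mul_pos (by positivity) (sub_pos.2 (pow_lt_one₀ hc0.le (by linarith) (by norm_num)))
    nlinarith
  have hy3 : y ^ 3 < 1 := pow_lt_one₀ hy0 hy1' (by norm_num)
  set δ := (c - q) * (1 - y ^ 3) with hδ
  have hδ0 : 0 < δ := mul_pos (by linarith) (by linarith)
  set η := δ / 4 with hη
  have hη0 : 0 < η := by positivity
  set s : ℕ → ℝ := fun k => min (k * η) q with hs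
  have hs0 : s 0 = 0 := by simp [hs, hq0.le]
  have hsnn : ∀ k, 0 ≤ s k := fun k => le_min (by positivity) hq0.le
  have hsq : ∀ k, s k ≤ q := fun k => min_le_right _ _
  have hsη : ∀ k, |s k - s (k + 1)| ≤ η := by
    intro k
    refine (abs_min_sub_min_le_max _ _ _ _).trans ?_
    push_cast
    rw [show (k : ℝ) * η - (k + 1) * η = -η by ring]
    simp [abs_of_pos hη0, hη0.le]
  refine ⟨s, hs0, fun k hk => lt_min ?_ hq0, ?_, ?_⟩
  · have : (0 : ℝ) < k := by exact_mod_cast hk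
    positivity
  · obtain ⟨K, hK⟩ := exists_nat_gt (q / η)
    refine ⟨K, fun k hk => min_eq_right ?_⟩
    have h1 : (K : ℝ) ≤ k := by exact_mod_cast hk
    exact ((div_le_iff₀ hη0).1 (hK.le.trans h1))
  · refine hyperbolic_revSect hs0 hy1' fun k hk => ⟨?_, ?_, ?_⟩
    · have : (0 : ℝ) < k := by exact_mod_cast hk
      exact lt_min (by positivity) hq0
    · exact (hsq k).trans_lt (hqc.trans_le hyc)
    · have h1 := (abs_revSect_sub_altTheta_le hs0 hsnn (fun n => (hsq n).trans (by linarith))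
        hsη k).1 y ⟨hy0, hy1⟩
      have h2 := (altTheta_mono_param (hsnn k) ((hsq k).trans hqc.le) (by linarith) hy0 hy1).2
      have h3 := (abs_le.1 h1).1
      have h4 := mul_le_mul_of_nonneg_left h2 hy0
      have h5 : (c - q) * (1 - y ^ 3) ≤ (c - s k) * (1 - y ^ 3) :=
        mul_le_mul_of_nonneg_right (by linarith [hsq k]) (by linarith)
      have h6 := mul_le_mul_of_nonneg_left h3 hy0
      have h7 : y * (3 * η) ≤ 3 * η := by nlinarith
      nlinarith

/-- Coefficients with prescribed ratios `a (n-1) * a (n+1) / a n ^ 2`. -/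
noncomputable def coeffOfRatio (s : ℕ → ℝ) : ℕ → ℝ
  | 0 => 1
  | 1 => 1
  | n + 2 => s (n + 1) * coeffOfRatio s (n + 1) ^ 2 / coeffOfRatio s n

lemma coeffOfRatio_pos {s : ℕ → ℝ} (hs : ∀ k, 1 ≤ k → 0 < s k) : ∀ n, 0 < coeffOfRatio s n
  | 0 => by simp [coeffOfRatio]
  | 1 => by simp [coeffOfRatio]
  | n + 2 => by
    have h1 := coeffOfRatio_pos hs (n + 1)
    have h2 := coeffOfRatio_pos hs n
    have h3 := hs (n + 1) (by omega)
    rw [coeffOfRatio]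
    positivity

lemma ratioSeq_coeffOfRatio {s : ℕ → ℝ} (hs0 : s 0 = 0) (hs : ∀ k, 1 ≤ k → 0 < s k) :
    ratioSeq (coeffOfRatio s) = s := by
  funext n
  cases n with
  | zero => simp [ratioSeq, hs0]
  | succ n =>
    have h1 := (coeffOfRatio_pos hs (n + 1)).ne'
    have h2 := (coeffOfRatio_pos hs n).ne'
    rw [ratioSeq, coeffOfRatio]
    field_simp

lemma sectionHyperbolic_coeffOfRatio {s : ℕ → ℝ} (hs0 : s 0 = 0) (hs : ∀ k, 1 ≤ k → 0 < s k)
    (h : ∀ n, Hyperbolic (revSect s (n + 1))) (n : ℕ) : SectionHyperbolic (coeffOfRatio s) n := by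
  refine ⟨fun i _ => coeffOfRatio_pos hs i, fun i h1 _ => ?_⟩
  obtain ⟨m, rfl⟩ : ∃ m, i = m + 1 := ⟨i - 1, by omega⟩
  rw [hyperbolic_sect_iff m fun i _ => coeffOfRatio_pos hs i, ratioSeq_coeffOfRatio hs0 hs]
  exact h m

lemma eq_inv_ratioSeq (a : ℕ → ℝ) (i : ℕ) :
    a (i + 1) ^ 2 / (a (i + 1 - 1) * a (i + 1 + 1)) = 1 / ratioSeq a (i + 1) := by
  rw [ratioSeq, one_div_div, Nat.add_sub_cancel]

/-- The numbers `m_i` converge to the inverse of the critical parameter. -/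
theorem tendsto_mSeq {c : ℝ} (hc1 : 3092 / 10000 ≤ c) (hc2 : c ≤ 3093 / 10000)
    (hy : ∃ y ∈ Set.Icc (0 : ℝ) 1, c ≤ y * altTheta c y)
    (hN : ∀ y ∈ Set.Icc (0 : ℝ) 1, y * altTheta c y ≤ c) :
    Tendsto mSeq atTop (nhds (1 / c)) := by
  have hc0 : 0 < c := by linarith
  have hlower : ∀ i : ℕ, ∀ r ∈ {r : ℝ | ∃ a : ℕ → ℝ, SectionHyperbolic a (i + 1 + 1) ∧
      r = a (i + 1) ^ 2 / (a (i + 1 - 1) * a (i + 1 + 1))}, 1 / c ≤ r := by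
    rintro i r ⟨a, ⟨ha, hhyp⟩, rfl⟩
    rw [eq_inv_ratioSeq]
    set s : ℕ → ℝ := fun n => if n ≤ i + 1 then ratioSeq a n else 0 with hs
    have hpos : ∀ n ≤ i, 0 < ratioSeq a (n + 1) := by
      intro n hn
      have h1 := ha n (by omega)
      have h2 := ha (n + 1) (by omega)
      have h3 := ha (n + 2) (by omega)
      rw [ratioSeq]
      positivity
    have hs0 : s 0 = 0 := by simp [hs, ratioSeq]
    have hsnn : ∀ n, 0 ≤ s n := by
      intro n
      simp only [hs]
      split_ifs with h
      · cases n with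
        | zero => exact le_rfl
        | succ n => exact (hpos n (by omega)).le
      · exact le_rfl
    have h := (ratio_le_critical hc1 hc2 hN hsnn hs0 i fun m hm2 hm => ?_).2.1
    · simp only [hs, le_refl, if_true] at h
      exact one_div_le_one_div_of_le (hpos i le_rfl) h
    · obtain ⟨k, rfl⟩ : ∃ k, m = k + 1 := ⟨m - 1, by omega⟩
      rw [revSect_congr (t := ratioSeq a) fun n hn => by simp only [hs]; rw [if_pos (by omega)],
        ← hyperbolic_sect_iff k fun j hj => ha j (by omega)]
      exact hhyp _ (by omega) hm
  have hupper : ∀ q, 0 < q → q < c → ∀ᶠ i in atTop, 1 / c ≤ mSeq i ∧ mSeq i ≤ 1 / q := by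
    intro q hq0 hqc
    obtain ⟨s, hs0, hspos, ⟨K, hK⟩, hhyp⟩ := exists_hyperbolic_ramp hc2 hy hq0 hqc
    filter_upwards [eventually_ge_atTop (K + 1)] with j hj
    obtain ⟨i, rfl⟩ : ∃ i, j = i + 1 := ⟨j - 1, by omega⟩
    have hmem : 1 / q ∈ {r : ℝ | ∃ a : ℕ → ℝ, SectionHyperbolic a (i + 1 + 1) ∧
        r = a (i + 1) ^ 2 / (a (i + 1 - 1) * a (i + 1 + 1))} := by
      refine ⟨coeffOfRatio s, sectionHyperbolic_coeffOfRatio hs0 hspos hhyp _, ?_⟩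
      rw [eq_inv_ratioSeq, ratioSeq_coeffOfRatio hs0 hspos, hK _ (by omega)]
    exact ⟨le_csInf ⟨_, hmem⟩ (hlower i), csInf_le ⟨1 / c, hlower i⟩ hmem⟩
  rw [tendsto_order]
  refine ⟨fun b hb => ?_, fun b hb => ?_⟩
  · filter_upwards [hupper (c / 2) (by positivity) (by linarith)] with i hi
    exact hb.trans_le hi.1
  · have hb0 : 0 < b := (one_div_pos.2 hc0).trans hb
    have hbc : 1 / b < c := (one_div_lt hb0 hc0).2 hb
    obtain ⟨q, hq1, hq2⟩ := exists_between hbc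
    have hq0 : 0 < q := (one_div_pos.2 hb0).trans hq1
    filter_upwards [hupper q hq0 hq2] with i hi
    exact hi.2.trans_lt ((one_div_lt hq0 hb0).2 hq1)

lemma differentiable_altTheta {q : ℝ} (hq0 : 0 ≤ q) (hq1 : q < 1) :
    Differentiable ℂ (altTheta q : ℂ → ℂ) := by
  intro z
  have h := Complex.differentiableOn_tsum_of_summable_norm (U := Metric.ball (0 : ℂ) (‖z‖ + 1))
    (F := fun (j : ℕ) (w : ℂ) => ((-1) ^ j * q ^ (j * (j - 1) / 2) : ℝ) • w ^ j)
    (summable_theta hq0 hq1 (‖z‖ + 1)) (fun j => by fun_prop) Metric.isOpen_ball ?_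
  · exact h.differentiableAt (Metric.isOpen_ball.mem_nhds (by simp))
  · intro j w hw
    have hw' : ‖w‖ ≤ ‖z‖ + 1 := by simpa using (Metric.mem_ball.1 hw).le
    rw [norm_smul, norm_mul, norm_pow, norm_pow, norm_neg, norm_one, one_pow, one_mul, norm_pow,
      Real.norm_of_nonneg hq0]
    gcongr

lemma continuousOn_altTheta_param (z : ℂ) :
    ContinuousOn (fun q : ℝ => altTheta q z) (Set.Icc 0 (1 / 3)) := by
  unfold altTheta
  refine continuousOn_tsum (fun j => by fun_prop)
    (summable_theta (q := 1 / 3) (by norm_num) (by norm_num) ‖z‖) ?_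
  rintro j q ⟨hq0, hq1⟩
  rw [norm_smul, norm_mul, norm_pow, norm_pow, norm_neg, norm_one, one_pow, one_mul, norm_pow,
    Real.norm_of_nonneg hq0]
  gcongr

lemma PsiC_eq_altTheta (q : ℝ) (u : ℂ) : PsiC q u = altTheta q (-(q * u) : ℂ) := by
  unfold PsiC altTheta
  congr 1
  funext j
  have h : j * (j + 1) / 2 = j * (j - 1) / 2 + j := by
    rw [← triangle_succ, mul_comm, Nat.add_sub_cancel]
  rw [h, Complex.real_smul]
  push_cast
  rw [neg_pow ((q : ℂ) * u), mul_pow, pow_add]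
  have : (-1 : ℂ) ^ j * (-1) ^ j = 1 := by rw [← mul_pow]; simp
  linear_combination -((q : ℂ) ^ (j * (j - 1) / 2) * q ^ j * u ^ j) * this

/-- The modulus does not decrease when moving away from the real axis along vertical lines. -/
def VerticallyMonotone (f : ℂ → ℂ) : Prop :=
  ∀ x y y' : ℝ, |y'| ≤ |y| → ‖f (x + y' * Complex.I)‖ ≤ ‖f (x + y * Complex.I)‖

lemma norm_one_sub_mul_le (r x y y' : ℝ) (h : |y'| ≤ |y|) :
    ‖(1 - r * (x + y' * Complex.I) : ℂ)‖ ≤ ‖(1 - r * (x + y * Complex.I) : ℂ)‖ := by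
  have e : ∀ t : ℝ, (1 - r * (x + t * Complex.I) : ℂ) = ((1 - r * x : ℝ) : ℂ) +
      ((-(r * t) : ℝ) : ℂ) * Complex.I := by
    intro t; push_cast; ring
  rw [e, e, Complex.norm_add_mul_I, Complex.norm_add_mul_I]
  refine Real.sqrt_le_sqrt ?_
  have := sq_le_sq.2 h
  nlinarith [mul_le_mul_of_nonneg_left this (sq_nonneg r)]

lemma Hyperbolic.verticallyMonotone {P : ℝ[X]} (h : Hyperbolic P) (h0 : P.coeff 0 = 1) :
    VerticallyMonotone fun z => aeval z P := by
  intro x y y' hy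
  rw [eq_prod_one_sub_of_splits h.splits h0]
  induction P.roots.map (·⁻¹) using Multiset.induction with
  | empty => simp
  | cons r R ih =>
    simp only [Multiset.map_cons, Multiset.prod_cons, map_mul, norm_mul]
    refine mul_le_mul ?_ ih (norm_nonneg _) (norm_nonneg _)
    simpa using norm_one_sub_mul_le r x y y' hy

lemma VerticallyMonotone.of_tendsto {ι : Type*} {l : Filter ι} [l.NeBot] {F : ι → ℂ → ℂ} {f : ℂ → ℂ}
    (hF : ∀ᶠ i in l, VerticallyMonotone (F i)) (h : ∀ z, Tendsto (fun i => F i z) l (nhds (f z))) :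
    VerticallyMonotone f := fun x y y' hy =>
  le_of_tendsto_of_tendsto (h _).norm (h _).norm (hF.mono fun _ hi => hi x y y' hy)

lemma aeval_revSect_sub_altTheta {s : ℕ → ℝ} {q : ℝ} (hq0 : 0 ≤ q) (hq1 : q < 1) {K : ℕ}
    (hK : ∀ k ≥ K, s k = q) (n : ℕ) (z : ℂ) :
    aeval z (revSect s (K + n)) - altTheta q z = (-z) ^ n * q ^ (n * (n - 1) / 2) *
      (aeval (q ^ n * z) (revSect s K) - altTheta q (q ^ n * z)) := by
  induction n generalizing z with
  | zero => simp
  | succ n ih =>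
    rw [← add_assoc, aeval_revSect_succ, altTheta_eq hq0 hq1 z, hK _ (by omega)]
    have := ih (q * z)
    rw [triangle_succ, pow_succ, pow_succ, pow_add, mul_assoc _ (q : ℂ) z]
    rw [show (-((q : ℂ) * z)) ^ n = q ^ n * (-z) ^ n by rw [← mul_pow]; ring] at this
    linear_combination (-z) * this

lemma tendsto_aeval_revSect {s : ℕ → ℝ} {q : ℝ} (hq0 : 0 ≤ q) (hq1 : q < 1) {K : ℕ}
    (hK : ∀ k ≥ K, s k = q) (z : ℂ) :
    Tendsto (fun n => aeval z (revSect s (K + n))) atTop (nhds (altTheta q z)) := by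
  rw [tendsto_iff_norm_sub_tendsto_zero]
  have h1 := (summable_theta hq0 hq1 ‖z‖).tendsto_atTop_zero
  have hcont : Continuous fun w : ℂ => ‖aeval w (revSect s K) - altTheta q w‖ :=
    ((revSect s K).continuous_aeval.sub (differentiable_altTheta hq0 hq1).continuous).norm
  have h2 : Tendsto (fun n : ℕ => (q : ℂ) ^ n * z) atTop (nhds 0) := by
    have : ‖(q : ℂ)‖ < 1 := by simpa [abs_of_nonneg hq0] using hq1
    simpa using (tendsto_pow_atTop_nhds_zero_of_norm_lt_one this).mul_const z
  have h3 := h1.mul ((hcont.tendsto 0).comp h2)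
  rw [zero_mul] at h3
  refine h3.congr fun n => ?_
  rw [aeval_revSect_sub_altTheta hq0 hq1 hK]
  simp only [norm_mul, norm_pow, norm_neg, Complex.norm_real, Real.norm_of_nonneg hq0,
    Function.comp_apply]
  ring

/-- At the critical parameter the partial theta function has only real zeros. -/
theorem altTheta_critical_real_zeros {c : ℝ} (hc0 : 0 < c) (hc : c ≤ 3093 / 10000)
    (hy : ∃ y ∈ Set.Icc (0 : ℝ) 1, c ≤ y * altTheta c y) (z : ℂ) (hz : altTheta c z = 0) :
    z.im = 0 := by
  have hbelow : ∀ q, 0 < q → q < c → VerticallyMonotone (altTheta q) := by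
    intro q hq0 hqc
    obtain ⟨s, -, -, ⟨K, hK⟩, hhyp⟩ := exists_hyperbolic_ramp hc hy hq0 hqc
    refine VerticallyMonotone.of_tendsto (l := atTop) ?_
      (tendsto_aeval_revSect hq0.le (by linarith) hK)
    filter_upwards [eventually_ge_atTop 1] with n hn
    obtain ⟨m, rfl⟩ : ∃ m, n = m + 1 := ⟨n - 1, by omega⟩
    exact (hhyp (K + m)).verticallyMonotone (coeff_zero_revSect _ _)
  have hmono : VerticallyMonotone (altTheta c) := by
    have := right_nhdsWithin_Ioo_neBot hc0
    refine VerticallyMonotone.of_tendsto (l := nhdsWithin c (Set.Ioo 0 c)) (F := fun q => altTheta q)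
      ?_ fun w => ?_
    · filter_upwards [self_mem_nhdsWithin] with q hq using hbelow q hq.1 hq.2
    · refine ((continuousOn_altTheta_param w) c ⟨hc0.le, by linarith⟩).mono_left
        (nhdsWithin_mono _ fun q hq => ⟨hq.1.le, by linarith [hq.2]⟩)
  by_contra him
  have hseg : ∀ t : ℝ, |t| ≤ |z.im| → altTheta c ((z.re : ℂ) + t * Complex.I) = 0 := by
    intro t ht
    have := hmono z.re z.im t ht
    rw [Complex.re_add_im, hz, norm_zero] at this
    exact norm_le_zero_iff.1 this
  have han : AnalyticOnNhd ℂ (altTheta c : ℂ → ℂ) Set.univ :=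
    (differentiable_altTheta hc0.le (by linarith)).differentiableOn.analyticOnNhd isOpen_univ
  have hfreq : ∃ᶠ w in nhdsWithin (z.re : ℂ) {(z.re : ℂ)}ᶜ, altTheta c w = 0 := by
    have ht : Tendsto (fun t : ℝ => (z.re : ℂ) + t * Complex.I) (nhdsWithin 0 (Set.Ioi 0))
        (nhdsWithin (z.re : ℂ) {(z.re : ℂ)}ᶜ) := by
      refine tendsto_nhdsWithin_iff.2 ⟨?_, ?_⟩
      · have : Continuous fun t : ℝ => (z.re : ℂ) + t * Complex.I := by fun_prop
        simpa using (this.tendsto 0).mono_left nhdsWithin_le_nhds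
      · filter_upwards [self_mem_nhdsWithin] with t ht
        simpa using (ne_of_gt ht)
    refine ht.frequently (Eventually.frequently ?_)
    filter_upwards [Ioc_mem_nhdsGT (abs_pos.2 him)] with t ht
    exact hseg t (by rw [abs_of_pos ht.1]; exact ht.2)
  have := han.eqOn_zero_of_preconnected_of_frequently_eq_zero isPreconnected_univ
    (Set.mem_univ _) hfreq (Set.mem_univ (0 : ℂ))
  rw [altTheta_zero hc0.le (by linarith)] at this
  exact one_ne_zero this

lemma Differentiable.norm_le_of_sphere {f : ℂ → ℂ} (hf : Differentiable ℂ f) {ρ B : ℝ}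
    (hρ : 0 < ρ) (h : ∀ z, ‖z‖ = ρ → ‖f z‖ ≤ B) {z : ℂ} (hz : ‖z‖ ≤ ρ) : ‖f z‖ ≤ B := by
  refine Complex.norm_le_of_forall_mem_frontier_norm_le (U := Metric.ball 0 ρ)
    Metric.isBounded_ball hf.diffContOnCl (fun w hw => h w ?_) ?_
  · rw [frontier_ball _ hρ.ne'] at hw
    simpa using hw
  · rw [closure_ball _ hρ.ne']
    simpa using hz

lemma Differentiable.exists_eq_one_sub_mul {f : ℂ → ℂ} (hf : Differentiable ℂ f) (h0 : f 0 = 1)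
    {x : ℂ} (hx : f x = 0) :
    ∃ k : ℂ → ℂ, Differentiable ℂ k ∧ k 0 = 1 ∧ ∀ z, f z = (1 - x⁻¹ * z) * k z := by
  have hx0 : x ≠ 0 := by
    rintro rfl
    simp [h0] at hx
  have hd : Differentiable ℂ (dslope f x) := by
    rw [← differentiableOn_univ, Complex.differentiableOn_dslope Filter.univ_mem]
    exact hf.differentiableOn
  have hfac : ∀ z, f z = (1 - x⁻¹ * z) * (-x * dslope f x z) := by
    intro z
    have h := sub_smul_dslope f x z
    rw [hx, sub_zero, smul_eq_mul] at h
    rw [← h]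
    field_simp
    ring
  refine ⟨fun z => -x * dslope f x z, hd.const_mul _, ?_, hfac⟩
  have := hfac 0
  rw [h0] at this
  simpa using this.symm

lemma two_pow_card_le_norm_aeval_prod {R : Multiset ℝ} {ρ : ℝ} (hρ : 0 < ρ)
    (hR : ∀ r ∈ R, ρ⁻¹ ≤ r) {z : ℂ} (hz : ‖z‖ = 3 * ρ) :
    2 ^ R.card ≤ ‖aeval z (R.map fun r => 1 - C r * X).prod‖ := by
  induction R using Multiset.induction_on with
  | empty => simp
  | cons r R ih =>
    rw [Multiset.map_cons, Multiset.prod_cons, map_mul, norm_mul, Multiset.card_cons, pow_succ']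
    refine mul_le_mul ?_ (ih fun s hs => hR s (Multiset.mem_cons_of_mem hs)) (by positivity)
      (norm_nonneg _)
    have hr := hR r (Multiset.mem_cons_self r R)
    have hr0 : 0 < r := lt_of_lt_of_le (inv_pos.2 hρ) hr
    have h1 : 3 ≤ ‖(r : ℂ) * z‖ := by
      rw [norm_mul, hz, Complex.norm_real, Real.norm_of_nonneg hr0.le]
      have := (inv_le_iff_one_le_mul₀ hρ).1 hr
      nlinarith
    have h2 := norm_sub_norm_le ((r : ℂ) * z) 1
    rw [norm_sub_rev, norm_one] at h2
    have h3 : aeval z (1 - C r * X : ℝ[X]) = 1 - (r : ℂ) * z := by simp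
    rw [h3]
    linarith

lemma norm_cofactor_le {f k : ℂ → ℂ} (hk : Differentiable ℂ k) {R : Multiset ℝ} {ρ B : ℝ}
    (hρ : 0 < ρ) (hR : ∀ r ∈ R, ρ⁻¹ ≤ r)
    (hfk : ∀ z, f z = aeval z (R.map fun r => 1 - C r * X).prod * k z)
    (hB : ∀ z, ‖z‖ = 3 * ρ → ‖f z‖ ≤ B) {z : ℂ} (hz : ‖z‖ ≤ 3 * ρ) :
    ‖k z‖ ≤ B / 2 ^ R.card := by
  refine hk.norm_le_of_sphere (by positivity) (fun w hw => ?_) hz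
  have h1 := hB w hw
  rw [hfk, norm_mul] at h1
  rw [le_div_iff₀ (by positivity)]
  have := two_pow_card_le_norm_aeval_prod hρ hR hw
  nlinarith [norm_nonneg (k w)]

/-- An entire function with positive zeros is a product of finitely many linear factors and an
entire function without zeros in a given disc. -/
lemma Differentiable.exists_factorization {f : ℂ → ℂ} (hf : Differentiable ℂ f) (h0 : f 0 = 1)
    (hzero : ∀ z, f z = 0 → ∃ x : ℝ, 0 < x ∧ z = x) {ρ : ℝ} (hρ : 0 < ρ) :
    ∃ (R : Multiset ℝ) (k : ℂ → ℂ), (∀ r ∈ R, ρ⁻¹ ≤ r ∧ f ((r⁻¹ : ℝ) : ℂ) = 0) ∧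
      Differentiable ℂ k ∧ k 0 = 1 ∧
      (∀ z, f z = aeval z (R.map fun r => 1 - C r * X).prod * k z) ∧
      ∀ z, ‖z‖ ≤ ρ → k z ≠ 0 := by
  by_contra hcon
  have key : ∀ n : ℕ, ∃ (R : Multiset ℝ) (k : ℂ → ℂ), R.card = n ∧
      (∀ r ∈ R, ρ⁻¹ ≤ r ∧ f ((r⁻¹ : ℝ) : ℂ) = 0) ∧ Differentiable ℂ k ∧ k 0 = 1 ∧
      (∀ z, f z = aeval z (R.map fun r => 1 - C r * X).prod * k z) := by
    intro n
    induction n with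
    | zero => exact ⟨0, f, by simp, by simp, hf, h0, by simp⟩
    | succ n ih =>
      obtain ⟨R, k, hn, hR, hk, hk0, hfk⟩ := ih
      have hnot : ∃ z, ‖z‖ ≤ ρ ∧ k z = 0 := by
        by_contra! h
        exact hcon ⟨R, k, hR, hk, hk0, hfk, h⟩
      obtain ⟨z, hzρ, hkz⟩ := hnot
      have hfz : f z = 0 := by rw [hfk, hkz, mul_zero]
      obtain ⟨x, hx0, rfl⟩ := hzero z hfz
      obtain ⟨k₁, hk₁, hk₁0, hkk⟩ := hk.exists_eq_one_sub_mul hk0 hkz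
      refine ⟨x⁻¹ ::ₘ R, k₁, by simp [hn], ?_, hk₁, hk₁0, fun w => ?_⟩
      · intro r hr
        rcases Multiset.mem_cons.1 hr with rfl | hr
        · refine ⟨?_, by rw [inv_inv]; exact hfz⟩
          rw [Complex.norm_real, Real.norm_of_nonneg hx0.le] at hzρ
          exact inv_anti₀ hx0 hzρ
        · exact hR r hr
      · rw [Multiset.map_cons, Multiset.prod_cons, map_mul, hfk, hkk]
        simp only [map_sub, map_one, map_mul, aeval_X, aeval_C, Complex.coe_algebraMap,
          Complex.ofReal_inv]
        ring
  obtain ⟨B, hB⟩ := (isCompact_sphere (0 : ℂ) (3 * ρ)).exists_bound_of_continuousOn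
    hf.continuous.continuousOn
  obtain ⟨n, hn⟩ := pow_unbounded_of_one_lt B (one_lt_two (α := ℝ))
  obtain ⟨R, k, hcard, hR, hk, hk0, hfk⟩ := key n
  have h := norm_cofactor_le (z := 0) hk hρ (fun r hr => (hR r hr).1) hfk
    (fun z hz => hB z (by simpa using hz)) (by simp; positivity)
  rw [hk0, norm_one, hcard, le_div_iff₀ (by positivity)] at h
  linarith

/-- A nonvanishing entire function normalised at `0` has small logarithm near `0` when it is
bounded on a large disc. -/
lemma exists_log_norm_le {k : ℂ → ℂ} (hk : Differentiable ℂ k) (hk0 : k 0 = 1) {ρ M : ℝ}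
    (hρ : 2 ≤ ρ) (hM : 0 < M) (hne : ∀ z, ‖z‖ ≤ ρ → k z ≠ 0)
    (hB : ∀ z, ‖z‖ ≤ ρ → ‖k z‖ ≤ Real.exp M) {z : ℂ} (hz : ‖z‖ ≤ 1) :
    ∃ l : ℂ, k z = Complex.exp l ∧ ‖l‖ ≤ 4 * M / ρ := by
  have hmem : ∀ w ∈ Metric.ball (0 : ℂ) ρ, ‖w‖ ≤ ρ := fun w hw => by
    simpa using (Metric.mem_ball.1 hw).le
  have hk' : Differentiable ℂ (deriv k) := fun w => by
    exact ((hk.analyticAt w).deriv).differentiableAt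
  have hdiv : DifferentiableOn ℂ (fun w => deriv k w / k w) (Metric.ball 0 ρ) :=
    hk'.differentiableOn.div hk.differentiableOn fun w hw => hne w (hmem w hw)
  obtain ⟨g, hg0, hg⟩ := hdiv.isExactOn_ball.with_val_at 0 0
  have hρ0 : 0 < ρ := by linarith
  have hexp : ∀ w ∈ Metric.ball (0 : ℂ) ρ, k w = Complex.exp (g w) := by
    intro w hw
    have hder : ∀ v ∈ Metric.ball (0 : ℂ) ρ,
        HasDerivAt (fun v => k v * Complex.exp (-g v)) 0 v := by
      intro v hv
      have h := (hk v).hasDerivAt.mul ((hg v hv).neg.cexp)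
      refine h.congr_deriv ?_
      have hcancel := mul_div_cancel₀ (deriv k v) (hne v (hmem v hv))
      simp only [Pi.neg_apply]
      linear_combination -Complex.exp (-g v) * hcancel
    have hc := Metric.isOpen_ball.is_const_of_deriv_eq_zero (convex_ball (0 : ℂ) ρ).isPreconnected
      (fun v hv => (hder v hv).differentiableAt.differentiableWithinAt)
      (fun v hv => (hder v hv).deriv) hw (Metric.mem_ball_self hρ0)
    simp only [hg0, hk0, neg_zero, Complex.exp_zero, mul_one] at hc
    rw [Complex.exp_neg, mul_inv_eq_one₀ (Complex.exp_ne_zero _)] at hc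
    exact hc
  have hzb : z ∈ Metric.ball (0 : ℂ) ρ := by
    simp only [Metric.mem_ball, dist_zero_right]
    linarith
  refine ⟨g z, hexp z hzb, ?_⟩
  have hbc := Complex.borelCaratheodory_zero hM
    (fun w hw => (hg w hw).differentiableAt.differentiableWithinAt) (fun w hw => ?_) hρ0 hzb hg0
  · refine hbc.trans ?_
    rw [div_le_div_iff₀ (by linarith) hρ0]
    have h1 : 0 ≤ M * (ρ - 2 * ‖z‖) := mul_nonneg hM.le (by linarith)
    have h2 : 0 ≤ M * ρ * (1 - ‖z‖) := mul_nonneg (by positivity) (by linarith)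
    nlinarith
  · have h := hB w (hmem w hw)
    rw [hexp w hw, Complex.norm_exp, Real.exp_le_exp] at h
    exact h

/-- An entire function of growth at most order one, minimal type, with positive zeros is a limit
of products of the corresponding linear factors. -/
theorem exists_prod_one_sub_near {f : ℂ → ℂ} (hf : Differentiable ℂ f) (h0 : f 0 = 1)
    (hzero : ∀ z, f z = 0 → ∃ x : ℝ, 0 < x ∧ z = x)
    (hgrowth : ∀ ε > 0, ∃ A : ℝ, ∀ z, ‖f z‖ ≤ Real.exp (A + ε * ‖z‖)) {δ : ℝ} (hδ : 0 < δ) :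
    ∃ R : Multiset ℝ, (∀ r ∈ R, 0 < r ∧ f ((r⁻¹ : ℝ) : ℂ) = 0) ∧
      ∀ z : ℂ, ‖z‖ ≤ 1 → ‖aeval z (R.map fun r => 1 - C r * X).prod - f z‖ ≤ δ := by
  obtain ⟨D, hD⟩ := (isCompact_closedBall (0 : ℂ) 1).exists_bound_of_continuousOn
    hf.continuous.continuousOn
  have hD1 : 1 ≤ D := by simpa [h0] using hD 0 (by simp)
  obtain ⟨η, hη0, hη1, hηδ⟩ : ∃ η : ℝ, 0 < η ∧ η ≤ 1 / 4 ∧ 4 * D * η ≤ δ := by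
    refine ⟨min (1 / 4) (δ / (4 * D)), by positivity, min_le_left _ _, ?_⟩
    have := min_le_right (1 / 4) (δ / (4 * D))
    rw [le_div_iff₀ (by positivity)] at this
    linarith
  obtain ⟨A, hA⟩ := hgrowth (η / 24) (by positivity)
  set A' : ℝ := max A 1
  have hA'1 : 1 ≤ A' := le_max_right _ _
  set ρ : ℝ := max 2 (8 * A' / η)
  have hρ2 : 2 ≤ ρ := le_max_left _ _
  have hρA : 8 * A' ≤ η * ρ := by
    have : 8 * A' / η ≤ ρ := le_max_right _ _
    rw [div_le_iff₀ hη0] at this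
    linarith
  have hρ0 : 0 < ρ := by linarith
  obtain ⟨R, k, hR, hk, hk0, hfk, hne⟩ := hf.exists_factorization h0 hzero hρ0
  refine ⟨R, fun r hr => ⟨lt_of_lt_of_le (inv_pos.2 hρ0) (hR r hr).1, (hR r hr).2⟩,
    fun z hz => ?_⟩
  set M : ℝ := A' + η / 8 * ρ
  have hM : 0 < M := by positivity
  have hkB : ∀ w : ℂ, ‖w‖ ≤ ρ → ‖k w‖ ≤ Real.exp M := by
    intro w hw
    refine (norm_cofactor_le hk hρ0 (fun r hr => (hR r hr).1) hfk (B := Real.exp M)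
      (fun v hv => (hA v).trans ?_) (by linarith)).trans
      (div_le_self (Real.exp_pos _).le (one_le_pow₀ one_le_two))
    rw [Real.exp_le_exp, hv]
    have : A ≤ A' := le_max_left _ _
    simp only [M]
    linarith
  obtain ⟨l, hl, hlM⟩ := exists_log_norm_le hk hk0 hρ2 hM hne hkB hz
  have hlη : ‖l‖ ≤ η := by
    refine hlM.trans ?_
    rw [div_le_iff₀ hρ0]
    simp only [M]
    linarith
  have hk1 : ‖k z - 1‖ ≤ 2 * η := by
    rw [hl]
    exact (Complex.norm_exp_sub_one_le (by linarith)).trans (by linarith)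
  have hkhalf : 1 / 2 ≤ ‖k z‖ := by
    have := norm_sub_norm_le 1 (k z)
    rw [norm_one, norm_sub_rev] at this
    linarith
  have hfz := hD z (by simpa using hz)
  rw [hfk, norm_mul] at hfz
  set P := aeval z (R.map fun r => 1 - C r * X).prod
  have hP : ‖P‖ ≤ 2 * D := by nlinarith [norm_nonneg P]
  calc ‖P - f z‖ = ‖P‖ * ‖k z - 1‖ := by
        rw [hfk, ← norm_neg, ← norm_mul]
        congr 1
        ring
    _ ≤ 2 * D * (2 * η) := by gcongr
    _ ≤ δ := by linarith

lemma abs_coeff_sub_le {a : ℕ → ℝ} {G : ℕ → ℂ → ℂ} (hG : ∀ n, Differentiable ℂ (G n))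
    (hrec : ∀ n z, G n z = a n + z * G (n + 1) z) (n : ℕ) :
    ∀ (N : ℕ) (P : ℝ[X]) (δ : ℝ), (∀ z : ℂ, ‖z‖ ≤ 1 → ‖aeval z P - G N z‖ ≤ δ) →
      |P.coeff n - a (N + n)| ≤ 2 ^ n * δ := by
  have hconst : ∀ (N : ℕ) (P : ℝ[X]) (δ : ℝ),
      (∀ z : ℂ, ‖z‖ ≤ 1 → ‖aeval z P - G N z‖ ≤ δ) → |P.coeff 0 - a N| ≤ δ := by
    intro N P δ h
    have h0 := h 0 (by simp)
    rw [hrec, ← coeff_zero_eq_aeval_zero', zero_mul, add_zero, Complex.coe_algebraMap,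
      ← Complex.ofReal_sub, Complex.norm_real] at h0
    exact h0
  induction n with
  | zero =>
    intro N P δ h
    simpa using hconst N P δ h
  | succ n ih =>
    intro N P δ h
    have hdiff : Differentiable ℂ fun z : ℂ => aeval z P.divX - G (N + 1) z :=
      P.divX.differentiable_aeval.sub (hG (N + 1))
    have hsphere : ∀ z : ℂ, ‖z‖ = 1 → ‖aeval z P.divX - G (N + 1) z‖ ≤ 2 * δ := by
      intro z hz
      have hsplit : z * (aeval z P.divX - G (N + 1) z) =
          (aeval z P - G N z) - ((P.coeff 0 - a N : ℝ) : ℂ) := by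
        have hP := congrArg (aeval z) (divX_mul_X_add P)
        simp only [map_add, map_mul, aeval_X, aeval_C, Complex.coe_algebraMap] at hP
        rw [← hP, hrec N z]
        push_cast
        ring
      calc ‖aeval z P.divX - G (N + 1) z‖ = ‖z * (aeval z P.divX - G (N + 1) z)‖ := by
            rw [norm_mul, hz, one_mul]
        _ ≤ ‖aeval z P - G N z‖ + ‖((P.coeff 0 - a N : ℝ) : ℂ)‖ := by
            rw [hsplit]
            exact norm_sub_le _ _
        _ ≤ 2 * δ := by
            rw [Complex.norm_real, Real.norm_eq_abs]
            linarith [h z hz.le, hconst N P δ h]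
    have h' := ih (N + 1) P.divX (2 * δ) fun z hz =>
      hdiff.norm_le_of_sphere one_pos hsphere hz
    rw [coeff_divX, show N + 1 + n = N + (n + 1) by ring] at h'
    rw [pow_succ]
    linarith

lemma abs_coeff_sub_altTheta_le {q : ℝ} (hq0 : 0 ≤ q) (hq1 : q < 1) {P : ℝ[X]} {δ : ℝ}
    (h : ∀ z : ℂ, ‖z‖ ≤ 1 → ‖aeval z P - altTheta q z‖ ≤ δ) (n : ℕ) :
    |P.coeff n - (-1) ^ n * q ^ (n * (n - 1) / 2)| ≤ 2 ^ n * δ := by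
  have key := abs_coeff_sub_le (a := fun n => (-1) ^ n * q ^ (n * (n - 1) / 2))
    (G := fun n z => (-1) ^ n * (q : ℂ) ^ (n * (n - 1) / 2) * altTheta q ((q : ℂ) ^ n * z))
    (fun n => ((differentiable_altTheta hq0 hq1).comp (by fun_prop)).const_mul _)
    (fun n z => ?_) n 0 P δ (by simpa using h)
  · simpa using key
  · have heq : ∀ w : ℂ, altTheta q w = 1 - w * altTheta q ((q : ℂ) * w) := altTheta_eq hq0 hq1
    rw [heq, triangle_succ, ← mul_assoc (q : ℂ),
      ← pow_succ']
    push_cast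
    ring

lemma exists_pow_triangle_le {q ε : ℝ} (hq0 : 0 < q) (hq1 : q < 1) (hε : 0 < ε) :
    ∃ A : ℝ, ∀ j : ℕ, q ^ (j * (j - 1) / 2) ≤ Real.exp A * (ε ^ j / j.factorial) := by
  have hsum : Summable fun j : ℕ => q ^ (j * (j - 1) / 2) * j.factorial / ε ^ j := by
    refine summable_of_ratio_test_tendsto_lt_one zero_lt_one
      (Eventually.of_forall fun j => by positivity) ?_
    have h1 : Tendsto (fun j : ℕ => ((j : ℝ) * q ^ j + q ^ j) / ε) atTop (nhds 0) := by
      simpa using ((tendsto_self_mul_const_pow_of_lt_one hq0.le hq1).add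
        (tendsto_pow_atTop_nhds_zero_of_lt_one hq0.le hq1)).div_const ε
    refine h1.congr fun j => ?_
    rw [Real.norm_of_nonneg (by positivity), Real.norm_of_nonneg (by positivity), triangle_succ,
      Nat.factorial_succ, pow_add, pow_succ]
    push_cast
    field_simp
  obtain ⟨K, hK⟩ := hsum.tendsto_atTop_zero.bddAbove_range
  refine ⟨Real.log (max K 1), fun j => ?_⟩
  have hj : q ^ (j * (j - 1) / 2) * j.factorial / ε ^ j ≤ max K 1 :=
    (hK ⟨j, rfl⟩).trans (le_max_left _ _)
  rw [Real.exp_log (by positivity)]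
  rw [div_le_iff₀ (by positivity)] at hj
  rw [← mul_div_assoc, le_div_iff₀ (by positivity)]
  exact hj

lemma exists_norm_altTheta_le {q ε : ℝ} (hq0 : 0 < q) (hq1 : q < 1) (hε : 0 < ε) :
    ∃ A : ℝ, ∀ z : ℂ, ‖altTheta q z‖ ≤ Real.exp (A + ε * ‖z‖) := by
  obtain ⟨A, hA⟩ := exists_pow_triangle_le hq0 hq1 hε
  refine ⟨A, fun z => ?_⟩
  have hexp := (NormedSpace.expSeries_div_hasSum_exp (ε * ‖z‖)).mul_left (Real.exp A)
  rw [← Real.exp_eq_exp_ℝ, ← Real.exp_add] at hexp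
  refine tsum_of_norm_bounded hexp fun j => ?_
  rw [norm_smul, norm_mul, norm_pow, norm_pow, norm_neg, norm_one, one_pow, one_mul, norm_pow,
    Real.norm_of_nonneg hq0.le]
  refine (mul_le_mul_of_nonneg_right (hA j) (by positivity)).trans_eq ?_
  rw [mul_pow]
  ring

lemma one_le_altTheta_of_nonpos {q x : ℝ} (hq0 : 0 ≤ q) (hq1 : q < 1) (hx : x ≤ 0) :
    1 ≤ altTheta q x := by
  have h := (hasSum_altTheta hq0 hq1 x).summable.sum_le_tsum (Finset.range 1) fun j _ => ?_
  · simpa [altTheta] using h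
  · rw [smul_eq_mul, mul_assoc, mul_left_comm, ← mul_pow]
    exact mul_nonneg (pow_nonneg hq0 _) (pow_nonneg (by linarith) _)

lemma continuous_altTheta {q : ℝ} (hq0 : 0 ≤ q) (hq1 : q < 1) :
    Continuous (altTheta q : ℝ → ℝ) := by
  have h : (altTheta q : ℝ → ℝ) = fun x : ℝ => (altTheta q (x : ℂ)).re := by
    ext x
    rw [← altTheta_ofReal, Complex.ofReal_re]
  rw [h]
  exact Complex.continuous_re.comp
    ((differentiable_altTheta hq0 hq1).continuous.comp Complex.continuous_ofReal)

/-- If the zeros of the alternating partial theta function are real, then it is a limit of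
polynomials whose inverse roots are positive inverse zeros of the function. -/
lemma exists_approximating_prod {q : ℝ} (hq0 : 0 < q) (hq1 : q < 1)
    (hreal : ∀ z : ℂ, altTheta q z = 0 → z.im = 0) :
    ∃ R : ℕ → Multiset ℝ, (∀ n, ∀ r ∈ R n, 0 < r ∧ altTheta q r⁻¹ = 0) ∧
      Tendsto (fun n => (R n).sum) atTop (nhds 1) ∧
      Tendsto (fun n => ((R n).map (· ^ 2)).sum) atTop (nhds (1 - 2 * q)) ∧
      Tendsto (fun n => ((R n).map (· ^ 3)).sum) atTop (nhds (1 - 3 * q + 3 * q ^ 3)) := by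
  have hzero : ∀ z : ℂ, altTheta q z = 0 → ∃ x : ℝ, 0 < x ∧ z = x := by
    intro z hz
    obtain ⟨x, rfl⟩ : ∃ x : ℝ, z = x := ⟨z.re, Complex.ext rfl (by simpa using hreal z hz)⟩
    refine ⟨x, ?_, rfl⟩
    by_contra! hx
    rw [← altTheta_ofReal, Complex.ofReal_eq_zero] at hz
    linarith [one_le_altTheta_of_nonpos hq0.le hq1 hx]
  have happ : ∀ n : ℕ, ∃ R : Multiset ℝ, (∀ r ∈ R, 0 < r ∧ altTheta q ((r⁻¹ : ℝ) : ℂ) = 0) ∧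
      ∀ z : ℂ, ‖z‖ ≤ 1 →
        ‖aeval z (R.map fun r => 1 - C r * X).prod - altTheta q z‖ ≤ 1 / ((n : ℝ) + 1) :=
    fun n => exists_prod_one_sub_near (differentiable_altTheta hq0.le hq1)
      (altTheta_zero hq0.le hq1) hzero (fun ε hε => exists_norm_altTheta_le hq0 hq1 hε)
      (by positivity)
  choose R hR hclose using happ
  have hcoeff : ∀ i : ℕ, Tendsto
      (fun n => ((R n).map fun r => (1 - C r * X : ℝ[X])).prod.coeff i) atTop
      (nhds ((-1) ^ i * q ^ (i * (i - 1) / 2))) := by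
    intro i
    rw [tendsto_iff_norm_sub_tendsto_zero]
    refine squeeze_zero (fun n => norm_nonneg _)
      (fun n => abs_coeff_sub_altTheta_le hq0.le hq1 (hclose n) i) ?_
    simpa using tendsto_one_div_add_atTop_nhds_zero_nat.const_mul ((2 : ℝ) ^ i)
  have h1 := hcoeff 1
  have h2 := hcoeff 2
  have h3 := hcoeff 3
  norm_num at h1 h2 h3
  refine ⟨R, fun n r hr => ⟨(hR n r hr).1, ?_⟩, ?_, ?_, ?_⟩
  · have h := (hR n r hr).2
    rwa [← altTheta_ofReal, Complex.ofReal_eq_zero] at h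
  · have h := h1.neg
    rw [neg_neg] at h
    exact h.congr fun n => (newton_prod_one_sub (R n)).2.1.symm
  · have h := (h1.pow 2).sub (h2.const_mul 2)
    rw [show (-1 : ℝ) ^ 2 - 2 * q = 1 - 2 * q by ring] at h
    exact h.congr fun n => (newton_prod_one_sub (R n)).2.2.1.symm
  · have h := (((h1.pow 3).neg).add ((h1.const_mul 3).mul h2)).sub (h3.const_mul 3)
    rw [show -(-1 : ℝ) ^ 3 + 3 * -1 * q - 3 * -q ^ 3 = 1 - 3 * q + 3 * q ^ 3 by ring] at h
    exact h.congr fun n => (newton_prod_one_sub (R n)).2.2.2.symm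

/-- If the alternating partial theta function has only real zeros, then `q ≤ 1/3` and it has a
nonpositive value at some point `y / q` with `y ∈ [0,1]`. -/
theorem exists_le_mul_altTheta_of_real_zeros {q : ℝ} (hq0 : 0 < q) (hq1 : q < 1)
    (hreal : ∀ z : ℂ, altTheta q z = 0 → z.im = 0) :
    q ≤ 1 / 3 ∧ ∃ y ∈ Set.Icc (0 : ℝ) 1, q ≤ y * altTheta q y := by
  obtain ⟨R, hR, hs1, hs2, hs3⟩ := exists_approximating_prod hq0 hq1 hreal
  have hR0 : ∀ n, ∀ r ∈ R n, 0 ≤ r := fun n r hr => (hR n r hr).1.le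
  have hthird : q ≤ 1 / 3 := by
    have h := ge_of_tendsto' (((hs1.mul_const ((1 - 2 * q) ^ 2)).sub
      ((hs2.const_mul 2).mul_const (1 - 2 * q))).add hs3)
      fun n => power_sum_quadratic_nonneg (hR0 n) (1 - 2 * q)
    have h' : 0 ≤ q * (1 - q) * (1 - 3 * q) := by linarith
    have := nonneg_of_mul_nonneg_right h' (mul_pos hq0 (by linarith))
    linarith
  refine ⟨hthird, ?_⟩
  by_contra! hcon
  have hpos : ∀ x ∈ Set.Icc (0 : ℝ) q⁻¹, 0 < altTheta q x := by
    intro x hx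
    rw [Set.mem_Icc, ← one_div, le_div_iff₀ hq0] at hx
    have h := hcon (q * x) ⟨by nlinarith [hx.1], by linarith [hx.2]⟩
    have h1 := altTheta_eq hq0.le hq1 x
    simp only [RCLike.ofReal_real_eq_id, id_eq] at h1
    have h2 : x * altTheta q (q * x) < 1 := by nlinarith
    linarith
  obtain ⟨ε, hε, hball⟩ := Metric.eventually_nhds_iff.1
    ((continuous_altTheta hq0.le hq1).continuousAt.eventually
      (lt_mem_nhds (hpos q⁻¹ ⟨by positivity, le_rfl⟩)))
  have hrX : ∀ n, ∀ r ∈ R n, r ≤ (q⁻¹ + ε)⁻¹ := by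
    intro n r hr
    obtain ⟨hr0, hzero⟩ := hR n r hr
    rw [le_inv_comm₀ hr0 (by positivity)]
    by_contra! hlt
    rcases le_or_gt r⁻¹ q⁻¹ with hle | hgt
    · exact (hpos _ ⟨by positivity, hle⟩).ne' hzero
    · refine (hball ?_).ne' hzero
      rw [Real.dist_eq, abs_of_pos (by linarith)]
      linarith
  have h := le_of_tendsto_of_tendsto' hs2 (hs1.const_mul (q⁻¹ + ε)⁻¹)
    fun n => sum_sq_le_of_le (hR0 n) (hrX n)
  have hlt : (q⁻¹ + ε)⁻¹ < q := by
    rw [inv_lt_comm₀ (by positivity) hq0]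
    linarith
  linarith

/-- There is a largest `q̃ ∈ (0,1)` such that all complex zeros of `u ↦ Ψ(q,u)` are real, and
`m_i → 1/q̃` as `i → ∞`. -/
theorem stmt6 :
    ∃ qt : ℝ, qt ∈ Set.Ioo (0 : ℝ) 1 ∧
      (∀ u : ℂ, PsiC qt u = 0 → u.im = 0) ∧
      (∀ q ∈ Set.Ioo (0 : ℝ) 1, (∀ u : ℂ, PsiC q u = 0 → u.im = 0) → q ≤ qt) ∧
      Tendsto mSeq atTop (nhds (1 / qt)) := by
  obtain ⟨c, hc1, hc2, hy, hN, hmax⟩ := exists_critical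
  have hc0 : 0 < c := by linarith
  refine ⟨c, ⟨hc0, by linarith⟩, fun u hu => ?_, fun q hq hreal => ?_,
    tendsto_mSeq hc1 hc2 hy hN⟩
  · rw [PsiC_eq_altTheta] at hu
    have h := altTheta_critical_real_zeros hc0 hc2 hy _ hu
    simpa [hc0.ne'] using h
  · obtain ⟨hthird, hex⟩ := exists_le_mul_altTheta_of_real_zeros hq.1 hq.2 fun z hz => by
      have hq' : (q : ℂ) ≠ 0 := Complex.ofReal_ne_zero.2 hq.1.ne'
      have h := hreal (((-q⁻¹ : ℝ) : ℂ) * z) (by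
        rw [PsiC_eq_altTheta, ← hz]
        congr 1
        push_cast
        field_simp)
      rw [Complex.im_ofReal_mul] at h
      simpa [hq.1.ne'] using h
    exact hmax q hq.1.le hthird hex
end

section
/- For every real q ∈ (0,1) the entire function g_q(x) = Σ_{k=0}^∞ q^{k^2} x^k has only finitely many non-real zeros. Moreover, the number of non-real zeros counted with multiplicity is a non-decreasing function of q: if 0 < q_1 < q_2 < 1, then the number of non-real zeros of g_{q_1} is at most the number of non-real zeros of g_{q_2}. -/
open Filter
open scoped ENNReal

/-- The entire function `g_q(x) = Σ_{k≥0} q^{k²} x^k` (as a function of a complex variable). -/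
noncomputable def gq (q : ℝ) (z : ℂ) : ℂ :=
  ∑' k : ℕ, (q : ℂ) ^ (k ^ 2) * z ^ k

/-- The order (multiplicity) of a zero of `f` at `z₀`: the `n` such that
`f(z) = (z - z₀)^n g(z)` near `z₀` with `g` analytic and `g(z₀) ≠ 0`. -/
noncomputable def zeroOrder (f : ℂ → ℂ) (z₀ : ℂ) : ℕ :=
  sInf {n : ℕ | ∃ g : ℂ → ℂ, AnalyticAt ℂ g z₀ ∧ g z₀ ≠ 0 ∧
    ∀ᶠ z in nhds z₀, f z = (z - z₀) ^ n * g z}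

open Polynomial in
/-- The number of non-real complex roots, with multiplicity, of a real polynomial. -/
noncomputable def nonrealCount (p : ℝ[X]) : ℕ :=
  Multiset.card ((p.map (algebraMap ℝ ℂ)).roots.filter fun z => z.im ≠ 0)

namespace Polynomial

lemma card_roots_add_nonrealCount (p : ℝ[X]) :
    Multiset.card p.roots + nonrealCount p = p.natDegree := by
  classical
  have hinj : Function.Injective (algebraMap ℝ ℂ) := Complex.ofReal_injective
  have h1 : Multiset.card (p.map (algebraMap ℝ ℂ)).roots = p.natDegree := by
    rw [← (IsAlgClosed.splits (p.map (algebraMap ℝ ℂ))).natDegree_eq_card_roots, natDegree_map]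
  have h2 : (p.map (algebraMap ℝ ℂ)).roots.filter (fun z => ¬ z.im ≠ 0)
      = p.roots.map (algebraMap ℝ ℂ) := by
    ext z
    rw [Multiset.count_filter]
    by_cases hz : z.im = 0
    · have : z = algebraMap ℝ ℂ z.re := by
        apply Complex.ext <;> simp [hz]
      rw [if_pos (by simpa using hz), this, Multiset.count_map_eq_count' _ _ hinj, count_roots,
        count_roots, ← eq_rootMultiplicity_map hinj]
    · rw [if_neg (by simpa using hz)]
      symm
      rw [Multiset.count_eq_zero]
      intro h
      obtain ⟨x, -, rfl⟩ := Multiset.mem_map.1 h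
      simp at hz
  have h3 := congrArg Multiset.card
    (Multiset.filter_add_not (fun z : ℂ => z.im ≠ 0) (p.map (algebraMap ℝ ℂ)).roots)
  rw [Multiset.card_add, h2, Multiset.card_map, h1] at h3
  rw [nonrealCount]
  omega

lemma natDegree_natCast_mul_add_X_mul_derivative {M : ℕ} (hM : 0 < M) (p : ℝ[X]) :
    (C (M : ℝ) * p + X * derivative p).natDegree = p.natDegree := by
  have hc : ∀ k, (C (M : ℝ) * p + X * derivative p).coeff k = (M + k) * p.coeff k := by
    intro k
    cases k with
    | zero => simp
    | succ k => simp [coeff_X_mul, coeff_derivative]; ring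
  have hMk : ∀ k : ℕ, (M + k : ℝ) ≠ 0 := fun k => by positivity
  apply le_antisymm
  · rw [natDegree_le_iff_coeff_eq_zero]
    intro k hk
    rw [hc, coeff_eq_zero_of_natDegree_lt hk, mul_zero]
  · by_cases hp : p = 0
    · simp [hp]
    apply le_natDegree_of_ne_zero
    rw [hc]
    exact mul_ne_zero (hMk _) (by simpa using hp)

lemma card_roots_le_natCast_mul_add_X_mul_derivative {M : ℕ} (hM : 0 < M) (p : ℝ[X]) :
    Multiset.card p.roots ≤ Multiset.card (C (M : ℝ) * p + X * derivative p).roots := by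
  by_cases hp : p = 0
  · simp [hp]
  obtain ⟨N, rfl⟩ : ∃ N, M = N + 1 := ⟨M - 1, by omega⟩
  have hq : C ((N + 1 : ℕ) : ℝ) * p + X * derivative p ≠ 0 := by
    intro h
    have h0 := natDegree_natCast_mul_add_X_mul_derivative hM p
    rw [h, natDegree_zero] at h0
    have h1 := congrArg (coeff · 0) h
    rw [eq_C_of_natDegree_eq_zero h0.symm] at h1 hp
    simp only [coeff_add, coeff_C_zero, mul_coeff_zero, coeff_X_zero, zero_mul,
      add_zero, coeff_zero] at h1
    rcases mul_eq_zero.1 h1 with h1 | h1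
    · exact absurd h1 (by positivity)
    · exact hp (by rw [h1, C_0])
  have hd : derivative (X ^ (N + 1) * p)
      = X ^ N * (C ((N + 1 : ℕ) : ℝ) * p + X * derivative p) := by
    rw [derivative_mul, derivative_X_pow]
    simp only [Nat.add_sub_cancel]
    ring
  have h := card_roots_le_derivative (X ^ (N + 1) * p)
  rw [hd, roots_mul (mul_ne_zero (pow_ne_zero _ X_ne_zero) hp),
    roots_mul (mul_ne_zero (pow_ne_zero _ X_ne_zero) hq), Multiset.card_add, Multiset.card_add,
    roots_X_pow, roots_X_pow] at h
  simp only [Multiset.card_nsmul, Multiset.card_singleton] at h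
  omega

/-- Laguerre's theorem for the operator `M + x d/dx`. -/
lemma nonrealCount_natCast_mul_add_X_mul_derivative_le {M : ℕ} (hM : 0 < M) (p : ℝ[X]) :
    nonrealCount (C (M : ℝ) * p + X * derivative p) ≤ nonrealCount p := by
  have h1 := card_roots_add_nonrealCount p
  have h2 := card_roots_add_nonrealCount (C (M : ℝ) * p + X * derivative p)
  rw [natDegree_natCast_mul_add_X_mul_derivative hM] at h2
  have h3 := card_roots_le_natCast_mul_add_X_mul_derivative hM p
  omega

lemma nonrealCount_comp_C_mul_X {t : ℝ} (ht : t ≠ 0) (p : ℝ[X]) :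
    nonrealCount (p.comp (C t * X)) = nonrealCount p := by
  have h1 := card_roots_add_nonrealCount p
  have h2 := card_roots_add_nonrealCount (p.comp (C t * X))
  have h3 := roots_comp_C_mul_X_add_C p t 0 ht.isUnit
  rw [C_0, add_zero] at h3
  rw [natDegree_comp, natDegree_C_mul_X t ht, mul_one, h3, Multiset.card_map] at h2
  omega

lemma nonrealCount_C_mul {t : ℝ} (ht : t ≠ 0) (p : ℝ[X]) :
    nonrealCount (C t * p) = nonrealCount p := by
  have ht' : (t : ℂ) ≠ 0 := by exact_mod_cast ht
  rw [nonrealCount, nonrealCount, Polynomial.map_mul, map_C]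
  simp only [Complex.coe_algebraMap]
  rw [roots_C_mul _ ht']

/-- The multiplier `k ↦ (t ^ k (1 + k / M)) ^ m` does not increase the number of non-real roots. -/
lemma exists_coeff_eq_mul_nonrealCount_le {M : ℕ} (hM : 0 < M) {t : ℝ} (ht : t ≠ 0) (m : ℕ)
    (p : ℝ[X]) : ∃ r : ℝ[X], (∀ k, r.coeff k = (t ^ k * (1 + k / M)) ^ m * p.coeff k) ∧
      nonrealCount r ≤ nonrealCount p := by
  have hM' : (M : ℝ) ≠ 0 := by positivity
  induction m with
  | zero => exact ⟨p, by simp, le_rfl⟩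
  | succ m ih =>
    obtain ⟨r, hr, hle⟩ := ih
    refine ⟨C ((M : ℝ)⁻¹) * (C (M : ℝ) * r + X * derivative r).comp (C t * X), ?_, ?_⟩
    · intro k
      rw [coeff_C_mul, comp_C_mul_X_coeff]
      cases k with
      | zero => simp [hr, hM']
      | succ k =>
        simp only [coeff_add, coeff_C_mul, coeff_X_mul, coeff_derivative, hr]
        rw [pow_succ _ m]
        generalize (t ^ (k + 1) * (1 + ((k + 1 : ℕ) : ℝ) / M)) ^ m = A
        push_cast
        field_simp
    · rw [nonrealCount_C_mul (inv_ne_zero hM'), nonrealCount_comp_C_mul_X ht]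
      exact (nonrealCount_natCast_mul_add_X_mul_derivative_le hM r).trans hle

end Polynomial

open Metric in
lemma circleIntegral_sum_one_div_sub {c : ℂ} {r : ℝ} (hr : 0 < r) (s : Multiset ℂ)
    (hs : ∀ w ∈ s, w ∉ sphere c r) [DecidablePred (· ∈ ball c r)] :
    CircleIntegrable (fun z => (s.map fun w => 1 / (z - w)).sum) c r ∧
    (∮ z in C(c, r), (s.map fun w => 1 / (z - w)).sum)
      = 2 * Real.pi * Complex.I * Multiset.card (s.filter (· ∈ ball c r)) := by
  induction s using Multiset.induction with
  | empty => simp [circleIntegral]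
  | cons a s ih =>
    obtain ⟨h1, h2⟩ := ih fun w hw => hs w (Multiset.mem_cons_of_mem hw)
    have ha := hs a (Multiset.mem_cons_self a s)
    have hd : ∀ z ∈ sphere c r, z - a ≠ 0 := fun z hz h => ha (sub_eq_zero.1 h ▸ hz)
    have hI : CircleIntegrable (fun z => 1 / (z - a)) c r := by
      apply ContinuousOn.circleIntegrable hr.le
      exact continuousOn_const.div (by fun_prop) hd
    simp only [Multiset.map_cons, Multiset.sum_cons]
    refine ⟨hI.add h1, ?_⟩
    rw [circleIntegral.integral_add hI h1, h2]
    by_cases hab : a ∈ ball c r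
    · rw [Multiset.filter_cons_of_pos _ hab, Multiset.card_cons]
      have := circleIntegral.integral_sub_inv_of_mem_ball hab
      simp only [one_div, this]
      push_cast
      ring
    · rw [Multiset.filter_cons_of_neg _ hab]
      have hac : a ∉ closedBall c r := by
        rw [← ball_union_sphere]
        exact fun h => h.elim hab ha
      have hd' : ∀ z ∈ closedBall c r, z - a ≠ 0 := fun z hz h => hac (sub_eq_zero.1 h ▸ hz)
      have : (∮ z in C(c, r), 1 / (z - a)) = 0 := by
        apply DiffContOnCl.circleIntegral_eq_zero hr.le
        apply DifferentiableOn.diffContOnCl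
        rw [closure_ball c hr.ne']
        exact (differentiableOn_const _).div (by fun_prop) hd'
      rw [this, zero_add]

open Metric in
/-- The argument principle for a polynomial on a circle. -/
lemma circleIntegral_derivative_div_eval {c : ℂ} {r : ℝ} (hr : 0 < r) (p : Polynomial ℂ)
    (hp : ∀ z ∈ sphere c r, p.eval z ≠ 0) [DecidablePred (· ∈ ball c r)] :
    (∮ z in C(c, r), p.derivative.eval z / p.eval z)
      = 2 * Real.pi * Complex.I * Multiset.card (p.roots.filter (· ∈ ball c r)) := by
  have hs : ∀ w ∈ p.roots, w ∉ sphere c r := fun w hw h =>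
    hp w h (Polynomial.isRoot_of_mem_roots hw)
  rw [← (circleIntegral_sum_one_div_sub hr p.roots hs).2]
  apply circleIntegral.integral_congr hr.le
  intro z hz
  exact (IsAlgClosed.splits p).eval_derivative_div_eval_of_ne_zero (hp z hz)

open Metric Topology in
/-- Around each point of finite order the argument principle holds on all small circles. -/
lemma eventually_circleIntegral_deriv_div {f : ℂ → ℂ} {c : ℂ} (hf : Differentiable ℂ f)
    (hc : analyticOrderAt f c ≠ ⊤) :
    ∀ᶠ r in 𝓝[>] (0 : ℝ), (∀ z ∈ sphere c r, f z ≠ 0) ∧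
      (∮ z in C(c, r), deriv f z / f z) = 2 * Real.pi * Complex.I * analyticOrderNatAt f c := by
  obtain ⟨h, hh, hh0, hfh⟩ := (hf.analyticAt c).analyticOrderNatAt_eq_iff hc |>.1 rfl
  set k := analyticOrderNatAt f c
  have hev : ∀ᶠ z in 𝓝 c, (∀ᶠ w in 𝓝 z, f w = (w - c) ^ k • h w) ∧ AnalyticAt ℂ h z ∧ h z ≠ 0 :=
    hfh.eventually_nhds.and (hh.eventually_analyticAt.and (hh.continuousAt.eventually_ne hh0))
  obtain ⟨ε, hε, hball⟩ := Metric.eventually_nhds_iff_ball.1 hev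
  filter_upwards [Ioo_mem_nhdsGT hε] with r hr
  have hsub : closedBall c r ⊆ ball c ε := closedBall_subset_ball hr.2
  have hsph : ∀ z ∈ sphere c r, z - c ≠ 0 := fun z hz h0 => by
    rw [sub_eq_zero.1 h0] at hz
    simp at hz
    exact hr.1.ne hz
  have hne : ∀ z ∈ sphere c r, f z ≠ 0 := fun z hz => by
    obtain ⟨h1, -, h3⟩ := hball z (hsub (sphere_subset_closedBall hz))
    rw [h1.self_of_nhds]
    exact mul_ne_zero (pow_ne_zero _ (hsph z hz)) h3
  refine ⟨hne, ?_⟩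
  have heq : Set.EqOn (fun z => deriv f z / f z)
      (fun z => k * (z - c)⁻¹ + deriv h z / h z) (sphere c r) := by
    intro z hz
    obtain ⟨h1, h2, h3⟩ := hball z (hsub (sphere_subset_closedBall hz))
    have hz' := hsph z hz
    have hder : HasDerivAt f (k * (z - c) ^ (k - 1) * h z + (z - c) ^ k * deriv h z) z := by
      have h4 := (((hasDerivAt_id z).sub_const c).pow k).mul h2.differentiableAt.hasDerivAt
      refine (h4.congr_of_eventuallyEq (h1.mono fun w hw => by simp [hw])).congr_deriv ?_
      simp
    simp only
    rw [hder.deriv, h1.self_of_nhds]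
    rcases Nat.eq_zero_or_pos k with hk | hk
    · simp [hk]
    · obtain ⟨l, hl⟩ : ∃ l, k = l + 1 := ⟨k - 1, by omega⟩
      rw [hl, Nat.add_sub_cancel, smul_eq_mul]
      field_simp
      ring
  have hdiff : DifferentiableOn ℂ (fun z => deriv h z / h z) (closedBall c r) := by
    intro z hz
    obtain ⟨-, h2, h3⟩ := hball z (hsub hz)
    exact (h2.deriv.differentiableAt.div h2.differentiableAt h3).differentiableWithinAt
  rw [circleIntegral.integral_congr hr.1.le heq, circleIntegral.integral_add,
    circleIntegral.integral_const_mul,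
    circleIntegral.integral_sub_inv_of_mem_ball (mem_ball_self hr.1),
    DiffContOnCl.circleIntegral_eq_zero hr.1.le]
  · ring
  · exact DifferentiableOn.diffContOnCl (by rwa [closure_ball c hr.1.ne'])
  · apply ContinuousOn.circleIntegrable hr.1.le
    exact continuousOn_const.mul ((continuousOn_id.sub continuousOn_const).inv₀ hsph)
  · exact (hdiff.continuousOn.mono sphere_subset_closedBall).circleIntegrable hr.1.le

open Metric Topology in
lemma tendsto_circleIntegral_of_tendstoUniformlyOn {G : ℕ → ℂ → ℂ} {g : ℂ → ℂ} {c : ℂ} {r : ℝ}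
    (hr : 0 ≤ r) (hG : ∀ᶠ n in atTop, CircleIntegrable (G n) c r) (hg : CircleIntegrable g c r)
    (h : TendstoUniformlyOn G g atTop (sphere c r)) :
    Tendsto (fun n => ∮ z in C(c, r), G n z) atTop (𝓝 (∮ z in C(c, r), g z)) := by
  rw [Metric.tendsto_nhds]
  intro ε hε
  have hpos : 0 < 2 * Real.pi * r + 1 := by positivity
  filter_upwards [hG, Metric.tendstoUniformlyOn_iff.1 h _ (div_pos hε hpos)] with n hn hn2
  rw [dist_eq_norm, ← circleIntegral.integral_sub hn hg]
  refine (circleIntegral.norm_integral_le_of_norm_le_const hr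
    (C := ε / (2 * Real.pi * r + 1)) fun z hz => ?_).trans_lt ?_
  · rw [← dist_eq_norm, dist_comm]
    exact (hn2 z hz).le
  · rw [mul_div_assoc', div_lt_iff₀ hpos]
    nlinarith

open Metric Topology in
/-- **Hurwitz's theorem** for locally uniform limits of polynomials. -/
lemma eventually_card_roots_ball_eq {P : ℕ → Polynomial ℂ} {f : ℂ → ℂ}
    (hP : TendstoLocallyUniformlyOn (fun n z => (P n).eval z) f atTop Set.univ) {c : ℂ}
    (hc : analyticOrderAt f c ≠ ⊤) :
    ∀ᶠ r in 𝓝[>] (0 : ℝ), ∀ᶠ n in atTop, open scoped Classical in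
      Multiset.card ((P n).roots.filter (· ∈ ball c r)) = analyticOrderNatAt f c := by
  classical
  have hPd : ∀ n, Differentiable ℂ (fun z => (P n).eval z) := fun n => (P n).differentiable
  have hf : Differentiable ℂ f := differentiableOn_univ.1
    (hP.differentiableOn (Eventually.of_forall fun n => (hPd n).differentiableOn) isOpen_univ)
  have hdP := hP.deriv (Eventually.of_forall fun n => (hPd n).differentiableOn) isOpen_univ
  filter_upwards [eventually_circleIntegral_deriv_div hf hc, self_mem_nhdsWithin] with r hr hr0
  obtain ⟨hne, hint⟩ := hr
  replace hr0 : 0 < r := hr0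
  have hcpt : IsCompact (sphere c r) := isCompact_sphere c r
  have hfc : ContinuousOn f (sphere c r) := hf.continuous.continuousOn
  have hdf : Continuous (deriv f) := hf.deriv.continuous
  have hunif : TendstoUniformlyOn (fun n z => (P n).eval z) f atTop (sphere c r) :=
    (tendstoLocallyUniformlyOn_iff_tendstoUniformlyOn_of_compact hcpt).1
      (hP.mono (Set.subset_univ _))
  have hPne : ∀ᶠ n in atTop, ∀ z ∈ sphere c r, (P n).eval z ≠ 0 := by
    obtain ⟨z₀, hz₀, hmin⟩ := hcpt.exists_isMinOn (NormedSpace.sphere_nonempty.2 hr0.le) hfc.norm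
    filter_upwards [Metric.tendstoUniformlyOn_iff.1 hunif _ (norm_pos_iff.2 (hne z₀ hz₀))]
      with n hn z hz h0
    have h1 := hn z hz
    rw [h0, dist_zero_right] at h1
    exact absurd (isMinOn_iff.1 hmin z hz) (not_le.2 h1)
  have hdiv := (tendstoLocallyUniformlyOn_iff_tendstoUniformlyOn_of_compact hcpt).1
    ((hdP.mono (Set.subset_univ _)).div₀ (hP.mono (Set.subset_univ (sphere c r)))
      hdf.continuousOn hfc hne)
  have hlim := tendsto_circleIntegral_of_tendstoUniformlyOn hr0.le
    (hPne.mono fun n hn => ContinuousOn.circleIntegrable hr0.le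
      (ContinuousOn.div (hPd n).deriv.continuous.continuousOn
        (hPd n).continuous.continuousOn hn))
    (ContinuousOn.circleIntegrable hr0.le (hdf.continuousOn.div hfc hne)) hdiv
  have hint' : (∮ z in C(c, r), (deriv f / f) z)
      = 2 * Real.pi * Complex.I * analyticOrderNatAt f c := hint
  rw [hint'] at hlim
  have hpi : (2 * Real.pi * Complex.I : ℂ) ≠ 0 := Complex.two_pi_I_ne_zero
  have hlim2 : Tendsto (fun n => (Multiset.card ((P n).roots.filter (· ∈ ball c r)) : ℂ)) atTop
      (𝓝 (analyticOrderNatAt f c : ℂ)) := by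
    have h1 := hlim.const_mul (2 * Real.pi * Complex.I : ℂ)⁻¹
    rw [inv_mul_cancel_left₀ hpi] at h1
    refine h1.congr' (hPne.mono fun n hn => ?_)
    have h2 := circleIntegral_derivative_div_eval hr0 (P n) hn
    simp only [Pi.div_apply, Polynomial.deriv]
    rw [h2, inv_mul_cancel_left₀ hpi]
  have hlim3 : Tendsto (fun n => (Multiset.card ((P n).roots.filter (· ∈ ball c r)) : ℝ)) atTop
      (𝓝 (analyticOrderNatAt f c : ℝ)) := by
    refine ((Complex.continuous_re.tendsto _).comp hlim2).congr fun n => ?_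
    simp
  filter_upwards [(Metric.tendsto_nhds.1 hlim3) 1 one_pos] with n hn
  rw [Real.dist_eq, abs_lt, sub_lt_iff_lt_add, lt_sub_iff_add_lt] at hn
  obtain ⟨h1, h2⟩ := hn
  rw [neg_add_lt_iff_lt_add] at h1
  norm_cast at h1 h2
  omega

open Metric Topology in
/-- The number of non-real zeros is lower semicontinuous along limits of real polynomials. -/
lemma sum_analyticOrderNatAt_le_of_nonrealCount_le {P : ℕ → Polynomial ℝ} {f : ℂ → ℂ} {N : ℕ}
    (hP : TendstoLocallyUniformlyOn (fun n z => ((P n).map (algebraMap ℝ ℂ)).eval z) f atTop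
      Set.univ)
    (hN : ∀ᶠ n in atTop, nonrealCount (P n) ≤ N) (S : Finset ℂ) (hS : ∀ z ∈ S, z.im ≠ 0)
    (hfS : ∀ z ∈ S, analyticOrderAt f z ≠ ⊤) :
    ∑ z ∈ S, analyticOrderNatAt f z ≤ N := by
  classical
  have h1 : ∀ᶠ r in 𝓝[>] (0 : ℝ), ∀ z ∈ S, ∀ᶠ n in atTop,
      Multiset.card (((P n).map (algebraMap ℝ ℂ)).roots.filter (· ∈ ball z r))
        = analyticOrderNatAt f z := by
    rw [Filter.eventually_all_finset]
    intro z hz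
    filter_upwards [eventually_card_roots_ball_eq hP (hfS z hz)] with r hr
    filter_upwards [hr] with n hn
    rw [← hn]
  have h2 : ∀ᶠ r in 𝓝[>] (0 : ℝ), ∀ z ∈ S, ∀ w ∈ ball z r, w.im ≠ 0 := by
    rw [Filter.eventually_all_finset]
    intro z hz
    have := hS z hz
    filter_upwards [Ioo_mem_nhdsGT (abs_pos.2 this)] with r hr w hw h0
    have h3 := Complex.abs_im_le_norm (w - z)
    rw [mem_ball, dist_eq_norm] at hw
    rw [Complex.sub_im, h0, zero_sub, abs_neg] at h3
    linarith [hr.2]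
  have h3 : ∀ᶠ r in 𝓝[>] (0 : ℝ), ∀ z ∈ S, ∀ w ∈ S, z ≠ w → Disjoint (ball z r) (ball w r) := by
    rw [Filter.eventually_all_finset]
    intro z hz
    rw [Filter.eventually_all_finset]
    intro w hw
    by_cases hzw : z = w
    · simp [hzw]
    · have : 0 < dist z w / 2 := half_pos (dist_pos.2 hzw)
      filter_upwards [Ioo_mem_nhdsGT this] with r hr _
      exact ball_disjoint_ball (by linarith [hr.2])
  obtain ⟨r, h1, h2, h3⟩ := (h1.and (h2.and h3)).exists
  have h4 : ∀ᶠ n in atTop, ∀ z ∈ S,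
      Multiset.card (((P n).map (algebraMap ℝ ℂ)).roots.filter (· ∈ ball z r))
        = analyticOrderNatAt f z := by
    rwa [Filter.eventually_all_finset]
  obtain ⟨n, h4, h5⟩ := (h4.and hN).exists
  refine le_trans ?_ h5
  rw [← Finset.sum_congr rfl h4, nonrealCount]
  generalize ((P n).map (algebraMap ℝ ℂ)).roots = s
  have key : ∀ T ⊆ S, (∑ z ∈ T, s.filter (· ∈ ball z r))
      ≤ s.filter (fun w => ∃ z ∈ T, w ∈ ball z r) := by
    intro T
    induction T using Finset.induction with
    | empty => simp
    | insert a T ha ih =>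
      intro hT
      rw [Finset.sum_insert ha]
      have haS : a ∈ S := hT (Finset.mem_insert_self a T)
      have hTS : T ⊆ S := (Finset.subset_insert a T).trans hT
      refine (add_le_add le_rfl (ih hTS)).trans ?_
      rw [Multiset.filter_add_filter]
      have : s.filter (fun w => w ∈ ball a r ∧ ∃ z ∈ T, w ∈ ball z r) = 0 := by
        rw [Multiset.filter_eq_nil]
        rintro w - ⟨hw, z, hz, hwz⟩
        exact Set.disjoint_left.1 (h3 a haS z (hTS hz) (fun h => ha (h ▸ hz))) hw hwz
      rw [this, add_zero]
      apply Multiset.monotone_filter_right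
      rintro w (hw | ⟨z, hz, hw⟩)
      · exact ⟨a, Finset.mem_insert_self a T, hw⟩
      · exact ⟨z, Finset.mem_insert_of_mem hz, hw⟩
  have h6 := Multiset.card_le_card (key S subset_rfl)
  rw [Multiset.card_sum] at h6
  refine h6.trans (Multiset.card_le_card (Multiset.monotone_filter_right _ ?_))
  rintro w ⟨z, hz, hw⟩
  exact h2 z hz w hw

section ThetaSeries

variable {q : ℝ}

theorem summable_pow_natAbs_sq (hq0 : 0 < q) (hq1 : q < 1) :
    Summable fun m : ℤ => q ^ (m.natAbs ^ 2) := by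
  have h : Summable fun k : ℕ => q ^ (k ^ 2) :=
    Summable.of_nonneg_of_le (fun k => by positivity)
      (fun k => pow_le_pow_of_le_one hq0.le hq1.le (Nat.le_self_pow two_ne_zero k))
      (summable_geometric_of_lt_one hq0.le hq1)
  refine Summable.of_nat_of_neg ?_ ?_ <;> simpa using h

/-- Completing the square in the exponent. -/
theorem pow_sq_mul_inv_pow (hq0 : 0 < q) (n k : ℕ) :
    q ^ (k ^ 2) * (q⁻¹ ^ (2 * n)) ^ k = q⁻¹ ^ (n ^ 2) * q ^ (((k : ℤ) - n).natAbs ^ 2) := by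
  have h : q ^ (((k : ℤ) - n).natAbs ^ 2) = q ^ (((k : ℤ) - n) ^ 2) := by
    rw [← zpow_natCast]; push_cast; rw [sq_abs]
  rw [h, ← pow_mul, inv_pow, inv_pow, ← zpow_natCast, ← zpow_natCast, ← zpow_natCast,
    ← zpow_neg, ← zpow_neg, ← zpow_add₀ hq0.ne', ← zpow_add₀ hq0.ne']
  congr 1
  push_cast
  ring

theorem norm_pow_sq_mul_pow_le (hq0 : 0 < q) {n : ℕ} {z : ℂ} (hz : ‖z‖ ≤ q⁻¹ ^ (2 * n)) (k : ℕ) :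
    ‖(q : ℂ) ^ (k ^ 2) * z ^ k‖ ≤ q⁻¹ ^ (n ^ 2) * q ^ (((k : ℤ) - n).natAbs ^ 2) := by
  rw [← pow_sq_mul_inv_pow hq0, norm_mul, norm_pow, norm_pow, Complex.norm_real,
    Real.norm_of_nonneg hq0.le]
  gcongr

theorem summable_inv_pow_mul_pow_natAbs_sq (hq0 : 0 < q) (hq1 : q < 1) (n : ℕ) :
    Summable fun k : ℕ => q⁻¹ ^ (n ^ 2) * q ^ (((k : ℤ) - n).natAbs ^ 2) :=
  ((summable_pow_natAbs_sq hq0 hq1).comp_injective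
    (i := fun k : ℕ => (k : ℤ) - n) (fun a b h => by simpa using h)).mul_left _

theorem exists_le_inv_pow_two_mul (hq0 : 0 < q) (hq1 : q < 1) (r : ℝ) :
    ∃ n : ℕ, r ≤ q⁻¹ ^ (2 * n) := by
  obtain ⟨n, hn⟩ := pow_unbounded_of_one_lt r (one_lt_inv₀ hq0 |>.2 hq1)
  exact ⟨n, hn.le.trans (pow_le_pow_right₀ ((one_lt_inv₀ hq0).2 hq1).le (by omega))⟩

theorem summable_norm_gq (hq0 : 0 < q) (hq1 : q < 1) (z : ℂ) :
    Summable fun k : ℕ => ‖(q : ℂ) ^ (k ^ 2) * z ^ k‖ := by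
  obtain ⟨n, hn⟩ := exists_le_inv_pow_two_mul hq0 hq1 ‖z‖
  exact Summable.of_nonneg_of_le (fun k => norm_nonneg _) (norm_pow_sq_mul_pow_le hq0 hn)
    (summable_inv_pow_mul_pow_natAbs_sq hq0 hq1 n)

theorem hasSum_gq (hq0 : 0 < q) (hq1 : q < 1) (z : ℂ) :
    HasSum (fun k : ℕ => (q : ℂ) ^ (k ^ 2) * z ^ k) (gq q z) :=
  (summable_norm_gq hq0 hq1 z).of_norm.hasSum

theorem differentiable_gq (hq0 : 0 < q) (hq1 : q < 1) : Differentiable ℂ (gq q) := by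
  intro z
  obtain ⟨n, hn⟩ := exists_le_inv_pow_two_mul hq0 hq1 (‖z‖ + 1)
  have h : DifferentiableOn ℂ (gq q) (Metric.ball 0 (q⁻¹ ^ (2 * n))) :=
    Complex.differentiableOn_tsum_of_summable_norm
      (summable_inv_pow_mul_pow_natAbs_sq hq0 hq1 n) (fun k => by fun_prop) Metric.isOpen_ball
      (fun k w hw => norm_pow_sq_mul_pow_le hq0 (mem_ball_zero_iff.1 hw).le k)
  exact h.differentiableAt (Metric.isOpen_ball.mem_nhds (mem_ball_zero_iff.2 (by linarith)))

theorem gq_zero (q : ℝ) : gq q 0 = 1 := by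
  rw [gq, tsum_eq_single 0 (fun k hk => by simp [hk])]
  simp

theorem gq_conj (q : ℝ) (z : ℂ) : gq q (starRingEnd ℂ z) = starRingEnd ℂ (gq q z) := by
  simp only [gq, Complex.conj_tsum, map_mul, map_pow, Complex.conj_ofReal]

theorem exists_norm_gq_le (hq0 : 0 < q) (hq1 : q < 1) :
    ∃ C : ℝ, 1 ≤ C ∧ ∀ (n : ℕ) (z : ℂ), ‖z‖ ≤ q⁻¹ ^ (2 * n) → ‖gq q z‖ ≤ C * q⁻¹ ^ (n ^ 2) := by
  have hs := summable_pow_natAbs_sq hq0 hq1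
  refine ⟨∑' m : ℤ, q ^ (m.natAbs ^ 2), ?_, fun n z hz => ?_⟩
  · simpa using hs.le_tsum 0 (fun j _ => by positivity)
  · have h := tsum_of_norm_bounded (summable_inv_pow_mul_pow_natAbs_sq hq0 hq1 n).hasSum
      (norm_pow_sq_mul_pow_le hq0 hz)
    refine h.trans ?_
    rw [tsum_mul_left, mul_comm]
    gcongr
    exact tsum_comp_le_tsum_of_inj hs (fun j => by positivity)
      (i := fun k : ℕ => (k : ℤ) - n) (fun a b h => by simpa using h)

theorem zeroOrder_eq_analyticOrderNatAt {f : ℂ → ℂ} {z : ℂ} (hf : AnalyticAt ℂ f z)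
    (h : analyticOrderAt f z ≠ ⊤) : zeroOrder f z = analyticOrderNatAt f z := by
  have : {n : ℕ | ∃ g : ℂ → ℂ, AnalyticAt ℂ g z ∧ g z ≠ 0 ∧
      ∀ᶠ w in nhds z, f w = (w - z) ^ n * g w} = {analyticOrderNatAt f z} := by
    ext n
    simp only [Set.mem_ofPred_eq, Set.mem_singleton_iff, eq_comm (a := n),
      hf.analyticOrderNatAt_eq_iff h, smul_eq_mul]
  rw [zeroOrder, this, csInf_singleton]

theorem analyticOrderAt_ne_top_of_differentiable {f : ℂ → ℂ} (hf : Differentiable ℂ f)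
    (h0 : f 0 ≠ 0) (z : ℂ) : analyticOrderAt f z ≠ ⊤ := by
  have ha : AnalyticOnNhd ℂ f Set.univ := fun w _ => hf.analyticAt w
  exact AnalyticOnNhd.analyticOrderAt_ne_top_of_isPreconnected ha isPreconnected_univ
    (Set.mem_univ 0) (Set.mem_univ z) (by simp [analyticOrderAt_eq_zero.2 (Or.inr h0)])

end ThetaSeries

section ZeroFactorization

open Metric

theorem exists_eq_sub_pow_mul {f : ℂ → ℂ} (hf : Differentiable ℂ f) {w : ℂ}
    (hw : analyticOrderAt f w ≠ ⊤) :
    ∃ h : ℂ → ℂ, Differentiable ℂ h ∧ h w ≠ 0 ∧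
      ∀ z, f z = (z - w) ^ analyticOrderNatAt f w * h z := by
  obtain ⟨g, hg, hgw, hfg⟩ := (hf.analyticAt w).analyticOrderAt_ne_top.1 hw
  set n := analyticOrderNatAt f w
  set h : ℂ → ℂ := Function.update (fun z => f z / (z - w) ^ n) w (g w) with hh
  have hne : ∀ z, z ≠ w → h z = f z / (z - w) ^ n := fun z hz => Function.update_of_ne hz _ _
  have hself : h w = g w := Function.update_self _ _ _
  have heq : h =ᶠ[nhds w] g := by
    filter_upwards [hfg] with z hz
    by_cases hzw : z = w
    · rw [hzw, hself]
    · rw [hne z hzw, hz, smul_eq_mul, mul_div_cancel_left₀ _ (pow_ne_zero _ (sub_ne_zero.2 hzw))]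
  refine ⟨h, fun z => ?_, by rwa [hself], fun z => ?_⟩
  · by_cases hzw : z = w
    · rw [hzw]
      exact (hg.differentiableAt).congr_of_eventuallyEq heq
    · have h1 : DifferentiableAt ℂ (fun z => f z / (z - w) ^ n) z :=
        (hf z).div (by fun_prop) (pow_ne_zero _ (sub_ne_zero.2 hzw))
      refine h1.congr_of_eventuallyEq ?_
      filter_upwards [isOpen_ne.mem_nhds hzw] with x hx using hne x hx
  · by_cases hzw : z = w
    · rw [hzw, hself]
      simpa using hfg.self_of_nhds
    · rw [hne z hzw, mul_div_cancel₀ _ (pow_ne_zero _ (sub_ne_zero.2 hzw))]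

/-- Division of an entire function by its zeros in a finite set. -/
theorem exists_eq_prod_sub_pow_mul {f : ℂ → ℂ} (hf : Differentiable ℂ f)
    (htop : ∀ w, analyticOrderAt f w ≠ ⊤) (Z : Finset ℂ) :
    ∃ h : ℂ → ℂ, Differentiable ℂ h ∧ (∀ w ∈ Z, h w ≠ 0) ∧
      ∀ z, f z = (∏ w ∈ Z, (z - w) ^ analyticOrderNatAt f w) * h z := by
  classical
  induction Z using Finset.induction_on with
  | empty => exact ⟨f, hf, by simp, by simp⟩
  | insert w Z hw ih =>
    obtain ⟨h, hd, hZ, hfh⟩ := ih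
    have hP : Differentiable ℂ fun z : ℂ => ∏ v ∈ Z, (z - v) ^ analyticOrderNatAt f v := by
      fun_prop
    have hPw : (∏ v ∈ Z, (w - v) ^ analyticOrderNatAt f v) ≠ 0 :=
      Finset.prod_ne_zero_iff.2 fun v hv =>
        pow_ne_zero _ (sub_ne_zero.2 fun e => hw (e ▸ hv))
    have hord : analyticOrderAt f w = analyticOrderAt h w := by
      have e : f = (fun z : ℂ => ∏ v ∈ Z, (z - v) ^ analyticOrderNatAt f v) * h := funext hfh
      conv_lhs => rw [e]
      rw [analyticOrderAt_mul (hP.analyticAt w) (hd.analyticAt w),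
        analyticOrderAt_eq_zero (f := fun z : ℂ => ∏ v ∈ Z, (z - v) ^ analyticOrderNatAt f v)
          |>.2 (Or.inr hPw), zero_add]
    obtain ⟨h', hd', hw', hh'⟩ := exists_eq_sub_pow_mul hd (hord ▸ htop w)
    refine ⟨h', hd', fun v hv => ?_, fun z => ?_⟩
    · rcases Finset.mem_insert.1 hv with rfl | hv
      · exact hw'
      · intro e
        exact hZ v hv (by rw [hh' v, e, mul_zero])
    · have e : analyticOrderNatAt f w = analyticOrderNatAt h w := by
        rw [analyticOrderNatAt, analyticOrderNatAt, hord]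
      rw [Finset.prod_insert hw, hfh z, hh' z, e]
      ring

/-- A form of Jensen's inequality. -/
theorem prod_div_norm_le_of_zeros {f : ℂ → ℂ} (hf : Differentiable ℂ f) (h0 : f 0 = 1)
    {R B : ℝ} (hR : 0 < R) (hB : ∀ z, ‖z‖ = R → ‖f z‖ ≤ B) (A : Finset ℂ)
    (hA : ∀ a ∈ A, f a = 0) : ∏ a ∈ A, R / ‖a‖ ≤ B := by
  have htop := analyticOrderAt_ne_top_of_differentiable hf (by simp [h0])
  obtain ⟨h, hd, -, hfh⟩ := exists_eq_prod_sub_pow_mul hf htop A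
  have hpos : ∀ a ∈ A, analyticOrderNatAt f a = analyticOrderNatAt f a - 1 + 1 := by
    intro a ha
    have h1 : analyticOrderAt f a ≠ 0 := (hf.analyticAt a).analyticOrderAt_ne_zero.2 (hA a ha)
    have : analyticOrderNatAt f a ≠ 0 := by
      rw [← Nat.cast_analyticOrderNatAt (htop a)] at h1
      exact_mod_cast h1
    omega
  obtain ⟨k, hkd, hfk⟩ : ∃ k : ℂ → ℂ, Differentiable ℂ k ∧ ∀ z, f z = (∏ a ∈ A, (z - a)) * k z := by
    refine ⟨fun z => (∏ a ∈ A, (z - a) ^ (analyticOrderNatAt f a - 1)) * h z, by fun_prop,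
      fun z => ?_⟩
    rw [hfh z, ← mul_assoc, ← Finset.prod_mul_distrib]
    congr 1
    refine Finset.prod_congr rfl fun a ha => ?_
    conv_lhs => rw [hpos a ha, pow_succ, mul_comm]
  set H : ℂ → ℂ := fun z => (∏ a ∈ A, ((R : ℂ) ^ 2 - starRingEnd ℂ a * z) / R) * k z with hH
  have hHd : Differentiable ℂ H := by
    refine Differentiable.mul ?_ hkd
    exact Differentiable.fun_finsetProd fun a _ => by fun_prop
  have hbd : ∀ z, ‖z‖ = R → ‖H z‖ ≤ B := by
    intro z hz
    refine le_of_eq_of_le ?_ (hB z hz)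
    rw [hfk z, norm_mul, norm_mul, norm_prod, norm_prod]
    refine congrArg (· * ‖k z‖) (Finset.prod_congr rfl fun a _ => ?_)
    have e : (R : ℂ) ^ 2 - starRingEnd ℂ a * z = z * starRingEnd ℂ (z - a) := by
      rw [map_sub, mul_sub, Complex.mul_conj, Complex.normSq_eq_norm_sq, hz]
      push_cast
      ring
    rw [e, norm_div, norm_mul, RCLike.norm_conj, hz, Complex.norm_real,
      Real.norm_of_nonneg hR.le, mul_div_cancel_left₀ _ hR.ne']
  have hmax : ‖H 0‖ ≤ B := by
    refine Complex.norm_le_of_forall_mem_frontier_norm_le (U := ball (0 : ℂ) R) isBounded_ball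
      hHd.diffContOnCl (fun z hz => hbd z ?_) (subset_closure (mem_ball_self hR))
    rw [frontier_ball _ hR.ne'] at hz
    simpa using hz
  refine le_trans (le_of_eq ?_) hmax
  have h1 : (∏ a ∈ A, ‖a‖) * ‖k 0‖ = 1 := by
    have := congrArg norm (hfk 0)
    rw [h0] at this
    simpa [norm_prod] using this.symm
  have hprod : (∏ a ∈ A, ‖a‖) ≠ 0 := left_ne_zero_of_mul_eq_one h1
  rw [hH, Finset.prod_div_distrib, div_eq_iff hprod, norm_mul, mul_assoc, mul_comm ‖k 0‖, h1,
    mul_one, norm_prod]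
  refine Finset.prod_congr rfl fun a _ => ?_
  rw [mul_zero, sub_zero, sq, mul_div_assoc, div_self (by exact_mod_cast hR.ne'), mul_one,
    Complex.norm_real, Real.norm_of_nonneg hR.le]

end ZeroFactorization

section FiniteNonrealZeros

open Complex in
theorem tsum_neg_one_zpow_mul_pow_natAbs_sq_ne_zero {q : ℝ} (hq0 : 0 < q) (hq1 : q < 1) :
    ∑' m : ℤ, (-1 : ℝ) ^ m * q ^ (m.natAbs ^ 2) ≠ 0 := by
  set t : ℝ := -Real.log q / Real.pi with ht
  have htpos : 0 < t := div_pos (neg_pos.2 (Real.log_neg hq0 hq1)) Real.pi_pos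
  have hqt : q = Real.exp (-(Real.pi * t)) := by
    rw [ht, mul_div_cancel₀ _ Real.pi_ne_zero, neg_neg, Real.exp_log hq0]
  have htc : (t : ℂ) ≠ 0 := by exact_mod_cast htpos.ne'
  have hτ : (t : ℂ) * I ≠ 0 := mul_ne_zero htc I_ne_zero
  have h1 : ((∑' m : ℤ, (-1 : ℝ) ^ m * q ^ (m.natAbs ^ 2) : ℝ) : ℂ)
      = jacobiTheta₂ (1 / 2) (t * I) := by
    rw [Complex.ofReal_tsum, jacobiTheta₂]
    refine tsum_congr fun m => ?_
    have e1 : q ^ (m.natAbs ^ 2) = Real.exp (-(Real.pi * t) * m ^ 2) := by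
      rw [hqt, ← Real.exp_nat_mul, mul_comm]
      congr 2
      push_cast
      rw [← sq_abs (m : ℝ), Nat.cast_natAbs, Int.cast_abs]
    rw [jacobiTheta₂_term, Complex.exp_add, e1]
    push_cast
    congr 1
    · rw [show (2 * Real.pi * I * m * (1 / 2) : ℂ) = m * (Real.pi * I) by ring, Complex.exp_int_mul,
        Complex.exp_pi_mul_I]
    · congr 1
      linear_combination (-(Real.pi : ℂ) * m ^ 2 * t) * I_sq
  have h2 : jacobiTheta₂ (1 / 2 / (t * I)) (-1 / (t * I))
      = ((∑' n : ℤ, Real.exp (Real.pi * n / t - Real.pi * n ^ 2 / t) : ℝ) : ℂ) := by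
    rw [Complex.ofReal_tsum, jacobiTheta₂]
    refine tsum_congr fun n => ?_
    rw [jacobiTheta₂_term]
    push_cast
    congr 1
    field_simp
    ring
  have hinv : -1 / ((t : ℂ) * I) = ((1 / t : ℝ) : ℂ) * I := by
    push_cast
    field_simp
    rw [I_sq]
  have him : 0 < (-1 / ((t : ℂ) * I)).im := by
    rw [hinv, Complex.im_ofReal_mul, Complex.I_im, mul_one]
    positivity
  have hsum : Summable fun n : ℤ => Real.exp (Real.pi * n / t - Real.pi * n ^ 2 / t) := by
    have h3 := (hasSum_jacobiTheta₂_term (1 / 2 / (t * I)) him).summable.norm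
    refine h3.congr fun n => ?_
    rw [norm_jacobiTheta₂_term]
    congr 1
    have e1 : 1 / 2 / ((t : ℂ) * I) = ((-1 / (2 * t) : ℝ) : ℂ) * I := by
      push_cast
      field_simp
      rw [I_sq]; ring
    rw [e1, hinv, Complex.im_ofReal_mul, Complex.im_ofReal_mul, Complex.I_im]
    field_simp
    ring
  have hpos : 0 < ∑' n : ℤ, Real.exp (Real.pi * n / t - Real.pi * n ^ 2 / t) :=
    hsum.tsum_pos (fun n => (Real.exp_pos _).le) 0 (Real.exp_pos _)
  intro h0
  rw [h0, jacobiTheta₂_functional_equation, h2] at h1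
  have h4 := h1.symm
  simp only [Complex.ofReal_zero, mul_eq_zero, Complex.exp_ne_zero, or_false,
    Complex.ofReal_eq_zero, hpos.ne', one_div, inv_eq_zero] at h4
  rw [Complex.cpow_eq_zero_iff] at h4
  exact mul_ne_zero (neg_ne_zero.2 I_ne_zero) hτ h4.1

theorem gq_neg_inv_pow {q : ℝ} (hq0 : 0 < q) (n : ℕ) :
    gq q ((-(q⁻¹ ^ (2 * n)) : ℝ) : ℂ) = (((-1) ^ n * q⁻¹ ^ (n ^ 2) *
      ∑' k : ℕ, (-1 : ℝ) ^ ((k : ℤ) - n) * q ^ (((k : ℤ) - n).natAbs ^ 2) : ℝ) : ℂ) := by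
  rw [← tsum_mul_left, Complex.ofReal_tsum, gq]
  refine tsum_congr fun k => ?_
  have h := pow_sq_mul_inv_pow hq0 n k
  have h1 : (-1 : ℝ) ^ n * (-1) ^ ((k : ℤ) - n) = (-1) ^ k := by
    rw [← zpow_natCast, ← zpow_add₀ (by norm_num), add_sub_cancel, zpow_natCast]
  rw [← Complex.ofReal_pow, ← Complex.ofReal_pow, ← Complex.ofReal_mul]
  congr 1
  rw [neg_pow, mul_left_comm, h, ← h1]
  ring

theorem tendsto_tsum_neg_one_zpow {q : ℝ} (hq0 : 0 < q) (hq1 : q < 1) :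
    Tendsto (fun n : ℕ => ∑' k : ℕ, (-1 : ℝ) ^ ((k : ℤ) - n) * q ^ (((k : ℤ) - n).natAbs ^ 2))
      atTop (nhds (∑' m : ℤ, (-1 : ℝ) ^ m * q ^ (m.natAbs ^ 2))) := by
  set f : ℤ → ℝ := fun m => (-1 : ℝ) ^ m * q ^ (m.natAbs ^ 2) with hf
  have hfn : ∀ m, ‖f m‖ = q ^ (m.natAbs ^ 2) := fun m => by
    rw [hf, norm_mul, norm_zpow, norm_neg, norm_one, one_zpow, one_mul,
      Real.norm_of_nonneg (by positivity)]
  have h1 : ∀ n : ℕ, ∑' k : ℕ, f ((k : ℤ) - n)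
      = ∑' m : ℤ, (Set.Ici (-(n : ℤ))).indicator f m := by
    intro n
    have hinj : Function.Injective fun k : ℕ => (k : ℤ) - n := fun a b h => by simpa using h
    rw [← hinj.tsum_eq]
    · refine tsum_congr fun k => ?_
      rw [Set.indicator_of_mem]
      simp
    · intro m hm
      have : -(n : ℤ) ≤ m := Set.mem_Ici.1 (Set.mem_of_indicator_ne_zero hm)
      exact ⟨(m + n).toNat, by simp only; omega⟩
  change Tendsto (fun n : ℕ => ∑' k : ℕ, f ((k : ℤ) - n)) _ _
  simp_rw [h1]
  refine tendsto_tsum_of_dominated_convergence (summable_pow_natAbs_sq hq0 hq1) (fun m => ?_)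
    (Eventually.of_forall fun n m => ?_)
  · refine tendsto_const_nhds.congr' ?_
    filter_upwards [eventually_ge_atTop m.natAbs] with n hn
    rw [Set.indicator_of_mem]
    simp only [Set.mem_Ici]
    omega
  · exact (norm_indicator_le_norm_self _ _).trans (hfn m).le

theorem gq_ofReal (q : ℝ) (x : ℝ) : gq q x = ((∑' k : ℕ, q ^ (k ^ 2) * x ^ k : ℝ) : ℂ) := by
  rw [gq, Complex.ofReal_tsum]
  push_cast
  rfl

/-- Eventually there is a real zero in each interval between consecutive even powers. -/
theorem exists_real_zero_gq {q : ℝ} (hq0 : 0 < q) (hq1 : q < 1) :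
    ∃ N : ℕ, ∀ n ≥ N, ∃ y : ℝ,
      q⁻¹ ^ (2 * n) < y ∧ y < q⁻¹ ^ (2 * (n + 1)) ∧ gq q ((-y : ℝ) : ℂ) = 0 := by
  have hQ : 1 < q⁻¹ := (one_lt_inv₀ hq0).2 hq1
  set T : ℝ := ∑' m : ℤ, (-1 : ℝ) ^ m * q ^ (m.natAbs ^ 2)
  have hT : T ≠ 0 := tsum_neg_one_zpow_mul_pow_natAbs_sq_ne_zero hq0 hq1
  have hev := ((tendsto_tsum_neg_one_zpow hq0 hq1).mul_const T).eventually_const_lt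
    (mul_self_pos.2 hT)
  obtain ⟨N, hN⟩ := eventually_atTop.1 hev
  set G : ℝ → ℝ := fun x => T * (gq q ((-x : ℝ) : ℂ)).re with hG
  have hcont : Continuous G := by
    have := (differentiable_gq hq0 hq1).continuous
    fun_prop
  have hval : ∀ n ≥ N, 0 < (-1) ^ n * G (q⁻¹ ^ (2 * n)) := by
    intro n hn
    have h := hN n hn
    rw [hG]
    simp only
    rw [gq_neg_inv_pow hq0, Complex.ofReal_re]
    have : 0 < q⁻¹ ^ (n ^ 2) := by positivity
    refine (mul_pos h this).trans_eq ?_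
    have e : ((-1 : ℝ) ^ n) * (-1) ^ n = 1 := by rw [← mul_pow]; simp
    linear_combination (-1 : ℝ) * T * q⁻¹ ^ (n ^ 2) *
      (∑' k : ℕ, (-1 : ℝ) ^ ((k : ℤ) - n) * q ^ (((k : ℤ) - n).natAbs ^ 2)) * e
  refine ⟨N, fun n hn => ?_⟩
  have hlt : q⁻¹ ^ (2 * n) < q⁻¹ ^ (2 * (n + 1)) := pow_lt_pow_right₀ hQ (by omega)
  have ha := hval n hn
  have hb := hval (n + 1) (by omega)
  rw [pow_succ, mul_neg_one] at hb
  have hmem : (0 : ℝ) ∈ (fun x => (-1) ^ n * G x) '' Set.Ioo (q⁻¹ ^ (2 * n)) (q⁻¹ ^ (2 * (n + 1))) :=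
    intermediate_value_Ioo' hlt.le (hcont.const_mul _).continuousOn ⟨by linarith, ha⟩
  obtain ⟨y, hy, hy0⟩ := hmem
  refine ⟨y, hy.1, hy.2, ?_⟩
  have h2 : (gq q ((-y : ℝ) : ℂ)).re = 0 := by
    simpa [hG, hT] using hy0
  rw [gq_ofReal] at h2 ⊢
  rw [Complex.ofReal_re] at h2
  rw [h2, Complex.ofReal_zero]

theorem finite_nonreal_zeros_gq {q : ℝ} (hq0 : 0 < q) (hq1 : q < 1) :
    {z : ℂ | gq q z = 0 ∧ z.im ≠ 0}.Finite := by
  classical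
  have hQ : 1 < q⁻¹ := (one_lt_inv₀ hq0).2 hq1
  set Q := q⁻¹
  have hQ0 : 0 < Q := by linarith
  by_contra hinf
  obtain ⟨N, hN⟩ := exists_real_zero_gq hq0 hq1
  obtain ⟨C, hC1, hC⟩ := exists_norm_gq_le hq0 hq1
  choose! y hy1 hy2 hy3 using hN
  obtain ⟨A, hA, hcard⟩ := Set.Infinite.exists_subset_card_eq hinf (N + 1)
  have hA0 : ∀ a ∈ A, 0 < ‖a‖ := fun a ha => norm_pos_iff.2 fun e =>
    (hA ha).2 (by rw [e, Complex.zero_im])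
  have hypos : ∀ n ≥ N, 0 < y n := fun n hn => (by positivity : (0 : ℝ) < Q ^ (2 * n)).trans (hy1 n hn)
  have hymono : ∀ m ≥ N, ∀ n > m, y m < y n := fun m hm n hn =>
    (hy2 m hm).trans_le ((pow_le_pow_right₀ hQ.le (by omega)).trans (hy1 n (by omega)).le)
  set P := ∏ a ∈ A, ‖a‖
  have hP : 0 < P := Finset.prod_pos hA0
  have key : ∀ j : ℕ, Q ^ j ≤ C * P := by
    intro j
    set ι : ℕ → ℂ := fun i => ((-y (N + i) : ℝ) : ℂ) with hι
    have hιinj : Function.Injective ι := by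
      intro i i' h
      have h' : y (N + i) = y (N + i') := by
        have := Complex.ofReal_injective h
        linarith
      rcases lt_trichotomy i i' with hlt | rfl | hlt
      · exact absurd h' (hymono _ (by omega) _ (by omega)).ne
      · rfl
      · exact absurd h' (hymono _ (by omega) _ (by omega)).ne'
    set B := (Finset.range j).image ι
    have hdisj : Disjoint A B := by
      rw [Finset.disjoint_left]
      intro a ha hb
      obtain ⟨i, -, rfl⟩ := Finset.mem_image.1 hb
      exact (hA ha).2 (Complex.ofReal_im _)
    have hJ := prod_div_norm_le_of_zeros (differentiable_gq hq0 hq1) (gq_zero q)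
      (R := Q ^ (2 * (N + j))) (by positivity) (fun z hz => hC (N + j) z hz.le) (A ∪ B) (by
        intro a ha
        rcases Finset.mem_union.1 ha with ha | ha
        · exact (hA ha).1
        · obtain ⟨i, -, rfl⟩ := Finset.mem_image.1 ha
          exact hy3 _ (by omega))
    rw [Finset.prod_union hdisj, Finset.prod_image hιinj.injOn, Finset.prod_div_distrib,
      Finset.prod_const, hcard] at hJ
    have hlow : Q ^ (j * (j - 1)) ≤ ∏ i ∈ Finset.range j, Q ^ (2 * (N + j)) / ‖ι i‖ := by
      calc Q ^ (j * (j - 1)) = ∏ i ∈ Finset.range j, Q ^ (2 * (j - 1 - i)) := by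
            rw [Finset.prod_range_reflect (fun i => Q ^ (2 * i)), Finset.prod_pow_eq_pow_sum,
              ← Finset.mul_sum, mul_comm 2, Finset.sum_range_id_mul_two]
        _ ≤ _ := by
            refine Finset.prod_le_prod (fun i _ => by positivity) fun i hi => ?_
            have hi := Finset.mem_range.1 hi
            have hp := hypos (N + i) (by omega)
            rw [hι, Complex.norm_real, norm_neg, Real.norm_of_nonneg hp.le, le_div_iff₀ hp]
            calc Q ^ (2 * (j - 1 - i)) * y (N + i)
                ≤ Q ^ (2 * (j - 1 - i)) * Q ^ (2 * (N + i + 1)) := by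
                  gcongr
                  exact (hy2 _ (by omega)).le
              _ = Q ^ (2 * (N + j)) := by
                  rw [← pow_add]
                  congr 1
                  omega
    have h1 : (Q ^ (2 * (N + j))) ^ (N + 1) / P * Q ^ (j * (j - 1)) ≤ C * Q ^ ((N + j) ^ 2) :=
      (mul_le_mul_of_nonneg_left hlow (by positivity)).trans hJ
    rw [div_mul_eq_mul_div, div_le_iff₀ hP, ← pow_mul, ← pow_add] at h1
    have h2 : Q ^ ((N + j) ^ 2) * Q ^ j ≤ Q ^ (2 * (N + j) * (N + 1) + j * (j - 1)) := by
      rw [← pow_add]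
      refine pow_le_pow_right₀ hQ.le ?_
      rcases j with _ | j
      · simp; nlinarith
      · simp; nlinarith
    have h3 : Q ^ ((N + j) ^ 2) * Q ^ j ≤ Q ^ ((N + j) ^ 2) * (C * P) := by
      refine (h2.trans h1).trans_eq ?_
      ring
    exact le_of_mul_le_mul_left h3 (by positivity)
  obtain ⟨j, hj⟩ := pow_unbounded_of_one_lt (C * P) hQ
  exact (key j).not_gt hj

end FiniteNonrealZeros

section PolynomialApproximation

open Metric Polynomial

theorem analyticOrderNatAt_conj {f : ℂ → ℂ} (hf : Differentiable ℂ f)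
    (hc : ∀ z, f (starRingEnd ℂ z) = starRingEnd ℂ (f z))
    (htop : ∀ w, analyticOrderAt f w ≠ ⊤) (w : ℂ) :
    analyticOrderNatAt f (starRingEnd ℂ w) = analyticOrderNatAt f w := by
  obtain ⟨h, hd, hw, hfh⟩ := exists_eq_sub_pow_mul hf (htop w)
  have hd' : Differentiable ℂ (starRingEnd ℂ ∘ h ∘ starRingEnd ℂ) := by
    intro z
    have := (hd (starRingEnd ℂ z)).conj_conj
    rwa [Complex.conj_conj] at this
  rw [(hf.analyticAt _).analyticOrderNatAt_eq_iff (htop _)]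
  refine ⟨starRingEnd ℂ ∘ h ∘ starRingEnd ℂ, hd'.analyticAt _, by simpa using hw,
    Eventually.of_forall fun z => ?_⟩
  have h1 : f z = starRingEnd ℂ (f (starRingEnd ℂ z)) := by rw [hc, Complex.conj_conj]
  rw [h1, hfh]
  simp

theorem exists_exp_eq_of_forall_ne_zero {k : ℂ → ℂ} {R : ℝ} (hR : 0 < R)
    (hk : DifferentiableOn ℂ k (ball 0 R)) (h0 : k 0 = 1) (hne : ∀ z ∈ ball (0 : ℂ) R, k z ≠ 0) :
    ∃ u : ℂ → ℂ, DifferentiableOn ℂ u (ball 0 R) ∧ u 0 = 0 ∧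
      ∀ z ∈ ball (0 : ℂ) R, k z = Complex.exp (u z) := by
  have hdk : DifferentiableOn ℂ (fun z => deriv k z / k z) (ball 0 R) :=
    (hk.deriv isOpen_ball).div hk hne
  obtain ⟨u, hu0, hu⟩ := hdk.isExactOn_ball.with_val_at 0 0
  refine ⟨u, fun z hz => (hu z hz).differentiableAt.differentiableWithinAt, hu0, ?_⟩
  have hder : ∀ z ∈ ball (0 : ℂ) R, HasDerivAt (fun z => k z * Complex.exp (-u z)) 0 z := by
    intro z hz
    have h1 := ((hk.differentiableAt (isOpen_ball.mem_nhds hz)).hasDerivAt).mul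
      (hu z hz).neg.cexp
    refine h1.congr_deriv ?_
    have h2 : k z * (deriv k z / k z) = deriv k z := mul_div_cancel₀ _ (hne z hz)
    linear_combination -Complex.exp (-u z) * h2
  have hconst : ∀ z ∈ ball (0 : ℂ) R, k z * Complex.exp (-u z) = k 0 * Complex.exp (-u 0) := by
    intro z hz
    exact isOpen_ball.is_const_of_deriv_eq_zero (convex_ball (0 : ℂ) R).isPreconnected
      (fun z hz => (hder z hz).differentiableAt.differentiableWithinAt)
      (fun z hz => (hder z hz).deriv) hz (mem_ball_self hR)
  intro z hz
  have h1 := hconst z hz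
  rw [h0, hu0, neg_zero, Complex.exp_zero, mul_one, Complex.exp_neg] at h1
  exact (mul_inv_eq_one₀ (Complex.exp_ne_zero _)).1 h1

theorem finite_zeros_closedBall {f : ℂ → ℂ} (hf : Differentiable ℂ f) (h0 : f 0 = 1)
    {R B : ℝ} (hR : 0 < R) (hB : ∀ z, ‖z‖ = 2 * R → ‖f z‖ ≤ B) :
    {z : ℂ | f z = 0 ∧ ‖z‖ ≤ R}.Finite := by
  by_contra hinf
  obtain ⟨n, hn⟩ := pow_unbounded_of_one_lt B one_lt_two
  obtain ⟨A, hA, hcard⟩ := Set.Infinite.exists_subset_card_eq hinf n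
  have hJ := prod_div_norm_le_of_zeros hf h0 (by linarith) hB A fun a ha => (hA ha).1
  refine hn.not_ge (le_trans ?_ hJ)
  rw [← hcard, ← Finset.prod_const]
  refine Finset.prod_le_prod (fun _ _ => by norm_num) fun a ha => ?_
  have ha0 : 0 < ‖a‖ := norm_pos_iff.2 fun e => by
    have := (hA ha).1
    rw [e, h0] at this
    exact one_ne_zero this
  rw [le_div_iff₀ ha0]
  linarith [(hA ha).2]

theorem card_filter_roots_prod_X_sub_C_pow (Z : Finset ℂ) (n : ℂ → ℕ) {c : ℂ} (hc : c ≠ 0) :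
    Multiset.card ((C c * ∏ w ∈ Z, (X - C w) ^ n w).roots.filter fun z => z.im ≠ 0)
      = ∑ w ∈ Z with w.im ≠ 0, n w := by
  have hne : ∏ w ∈ Z, (X - C w) ^ n w ≠ 0 :=
    Finset.prod_ne_zero_iff.2 fun w _ => pow_ne_zero _ (X_sub_C_ne_zero w)
  rw [roots_C_mul _ hc, roots_prod _ _ hne, Multiset.filter_bind, Multiset.card_bind,
    Finset.sum_filter]
  refine Finset.sum_congr rfl fun w _ => ?_
  rw [Function.comp_apply, roots_pow, roots_X_sub_C, Multiset.nsmul_singleton]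
  split_ifs with h
  · rw [Multiset.filter_eq_self.2 fun a ha => by rwa [Multiset.eq_of_mem_replicate ha],
      Multiset.card_replicate]
  · rw [Multiset.filter_eq_nil.2 fun a ha => by rwa [Multiset.eq_of_mem_replicate ha],
      Multiset.card_zero]

/-- On a disk, an entire function with real Taylor coefficients is a real polynomial times the
exponential of a function controlled by the growth of the entire function. -/
theorem exists_real_polynomial_eval_eq_mul_exp {f : ℂ → ℂ} (hf : Differentiable ℂ f)
    (h0 : f 0 = 1) (hc : ∀ z, f (starRingEnd ℂ z) = starRingEnd ℂ (f z)) {N : ℕ}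
    (hN : ∀ S : Finset ℂ, (∀ z ∈ S, f z = 0 ∧ z.im ≠ 0) → ∑ z ∈ S, analyticOrderNatAt f z ≤ N)
    {R M : ℝ} (hR : 0 < R) (hM : 0 < M) (hB : ∀ z, ‖z‖ = 2 * R → ‖f z‖ ≤ Real.exp M) :
    ∃ p : ℝ[X], nonrealCount p ≤ N ∧ ∀ z : ℂ, ‖z‖ < R → ∃ u : ℂ,
      ‖u‖ ≤ 2 * M * ‖z‖ / (R - ‖z‖) ∧
      f z = (p.map (algebraMap ℝ ℂ)).eval z * Complex.exp u := by
  have htop := analyticOrderAt_ne_top_of_differentiable hf (by simp [h0])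
  set Z := (finite_zeros_closedBall hf h0 hR hB).toFinset with hZ
  have hZmem : ∀ z, z ∈ Z ↔ f z = 0 ∧ ‖z‖ ≤ R := fun z => by simp [hZ]
  obtain ⟨h, hd, hZne, hfh⟩ := exists_eq_prod_sub_pow_mul hf htop Z
  set D : ℂ[X] := ∏ w ∈ Z, (X - C w) ^ analyticOrderNatAt f w with hD
  have hDeval : ∀ z, D.eval z = ∏ w ∈ Z, (z - w) ^ analyticOrderNatAt f w := fun z => by
    simp [hD, eval_prod]
  have hDconj : D.map (starRingEnd ℂ) = D := by
    rw [hD, Polynomial.map_prod]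
    refine Finset.prod_bij' (fun w _ => starRingEnd ℂ w) (fun w _ => starRingEnd ℂ w) ?_ ?_ ?_ ?_ ?_
    · intro w hw
      rw [hZmem] at hw ⊢
      rw [hc, hw.1, map_zero, RCLike.norm_conj]
      exact ⟨rfl, hw.2⟩
    · intro w hw
      rw [hZmem] at hw ⊢
      rw [hc, hw.1, map_zero, RCLike.norm_conj]
      exact ⟨rfl, hw.2⟩
    · simp
    · simp
    · intro w _
      rw [analyticOrderNatAt_conj hf hc htop]
      simp
  have hD0 : D.eval 0 * h 0 = 1 := by rw [hDeval, ← hfh, h0]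
  have hh0 : h 0 ≠ 0 := right_ne_zero_of_mul_eq_one hD0
  have hh0conj : starRingEnd ℂ (h 0) = h 0 := by
    have h1 : starRingEnd ℂ (D.eval 0) = D.eval 0 := by
      conv_rhs => rw [← hDconj, ← map_zero (starRingEnd ℂ), eval_map, eval₂_at_apply]
    have h2 := congrArg (starRingEnd ℂ) hD0
    rw [map_mul, h1, map_one, ← hD0] at h2
    exact mul_left_cancel₀ (left_ne_zero_of_mul_eq_one hD0) h2
  obtain ⟨p, hp⟩ : ∃ p : ℝ[X], p.map (algebraMap ℝ ℂ) = C (h 0) * D := by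
    rw [← mem_lifts, lifts_iff_coeff_lifts]
    intro n
    obtain ⟨r, hr⟩ := Complex.conj_eq_iff_real.1
      (show starRingEnd ℂ ((C (h 0) * D).coeff n) = (C (h 0) * D).coeff n by
        rw [← coeff_map, Polynomial.map_mul, hDconj, map_C, hh0conj])
    exact ⟨r, hr.symm⟩
  set k : ℂ → ℂ := fun z => h z / h 0 with hk
  have hkd : Differentiable ℂ k := hd.div_const _
  have hfk : ∀ z, f z = (p.map (algebraMap ℝ ℂ)).eval z * k z := by
    intro z
    rw [hp, hfh, eval_mul, eval_C, hDeval, hk]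
    field_simp
  have hk0 : k 0 = 1 := div_self hh0
  have hkne : ∀ z ∈ ball (0 : ℂ) R, k z ≠ 0 := by
    intro z hz e
    have hfz : f z = 0 := by rw [hfk, e, mul_zero]
    have := hZne z ((hZmem z).2 ⟨hfz, (mem_ball_zero_iff.1 hz).le⟩)
    exact div_ne_zero this hh0 e
  have hpge : ∀ z : ℂ, ‖z‖ = 2 * R → 1 ≤ ‖(p.map (algebraMap ℝ ℂ)).eval z‖ := by
    intro z hz
    have h1 : ‖D.eval 0‖ * ‖h 0‖ = 1 := by rw [← norm_mul, hD0, norm_one]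
    rw [hp, eval_mul, eval_C, norm_mul, mul_comm, ← h1, hDeval, hDeval, norm_prod, norm_prod]
    gcongr with w hw
    rw [norm_pow, norm_pow]
    gcongr
    have h2 := norm_sub_norm_le z w
    have h3 := ((hZmem w).1 hw).2
    rw [zero_sub, norm_neg]
    linarith
  have hkB : ∀ z ∈ ball (0 : ℂ) R, ‖k z‖ ≤ Real.exp M := by
    intro z hz
    refine Complex.norm_le_of_forall_mem_frontier_norm_le (U := ball (0 : ℂ) (2 * R))
      isBounded_ball hkd.diffContOnCl (fun w hw => ?_)
      (subset_closure (ball_subset_ball (by linarith) hz))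
    rw [frontier_ball _ (by positivity)] at hw
    have hw : ‖w‖ = 2 * R := by simpa using hw
    have h1 := hB w hw
    rw [hfk, norm_mul] at h1
    exact (le_mul_of_one_le_left (norm_nonneg _) (hpge w hw)).trans h1
  obtain ⟨u, hud, hu0, hku⟩ := exists_exp_eq_of_forall_ne_zero hR hkd.differentiableOn hk0 hkne
  refine ⟨p, ?_, fun z hz => ⟨u z, ?_, ?_⟩⟩
  · rw [nonrealCount, hp, hD, card_filter_roots_prod_X_sub_C_pow _ _ hh0]
    refine hN _ fun w hw => ?_
    rw [Finset.mem_filter, hZmem] at hw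
    exact ⟨hw.1.1, hw.2⟩
  · refine Complex.borelCaratheodory_zero hM hud (fun w hw => ?_) hR (mem_ball_zero_iff.2 hz) hu0
    have h1 := hkB w hw
    rw [hku w hw, Complex.norm_exp, Real.exp_le_exp] at h1
    exact h1
  · rw [hfk, hku z (mem_ball_zero_iff.2 hz)]

end PolynomialApproximation

section MultiplierLimit

open Metric Polynomial

theorem tendsto_pow_two_div_pow_sub {Q : ℝ} (hQ : 1 < Q) (c L ρ : ℝ) :
    Tendsto (fun n : ℕ => 2 * (c + n ^ 2 * L) * ρ / (Q ^ (2 * n) / 2 - ρ)) atTop (nhds 0) := by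
  have hQ2 : 1 < Q ^ 2 := one_lt_pow₀ hQ two_ne_zero
  have h0 : Tendsto (fun n : ℕ => 1 / (Q ^ 2) ^ n) atTop (nhds 0) := by
    simpa using tendsto_pow_const_div_const_pow_of_one_lt 0 hQ2
  have h2 := tendsto_pow_const_div_const_pow_of_one_lt 2 hQ2
  have hnum := ((h0.const_mul c).add (h2.mul_const L)).const_mul (2 * ρ)
  have hden := (h0.const_mul ρ).const_sub (1 / 2)
  have h := hnum.div hden (by norm_num)
  simp only [mul_zero, zero_mul, add_zero, zero_div] at h
  refine h.congr fun n => ?_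
  have hpos : 0 < (Q ^ 2) ^ n := by positivity
  rw [pow_mul]
  simp only [Pi.div_apply]
  rw [← mul_div_mul_right _ _ hpos.ne']
  congr 1 <;> field_simp

theorem exists_seq_real_polynomial_tendsto_gq {q : ℝ} (hq0 : 0 < q) (hq1 : q < 1) {N : ℕ}
    (hN : ∀ S : Finset ℂ, (∀ z ∈ S, gq q z = 0 ∧ z.im ≠ 0) →
      ∑ z ∈ S, analyticOrderNatAt (gq q) z ≤ N) :
    ∃ p : ℕ → ℝ[X], (∀ n, nonrealCount (p n) ≤ N) ∧ ∀ ρ : ℝ, TendstoUniformlyOn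
      (fun n z => ((p n).map (algebraMap ℝ ℂ)).eval z) (gq q) atTop (closedBall 0 ρ) := by
  have hQ : 1 < q⁻¹ := (one_lt_inv₀ hq0).2 hq1
  obtain ⟨C, hC1, hC⟩ := exists_norm_gq_le hq0 hq1
  set Q := q⁻¹
  have hQ0 : 0 < Q := by linarith
  set c := Real.log C + 1 with hc
  have hcpos : 0 < c := by linarith [Real.log_nonneg hC1]
  have hLpos : 0 < Real.log Q := Real.log_pos hQ
  have hbound : ∀ (n : ℕ) (z : ℂ), ‖z‖ = 2 * (Q ^ (2 * n) / 2) →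
      ‖gq q z‖ ≤ Real.exp (c + n ^ 2 * Real.log Q) := by
    intro n z hz
    refine (hC n z (by linarith)).trans ?_
    rw [hc, Real.exp_add, Real.exp_add, Real.exp_log (by linarith)]
    have e : Real.exp (n ^ 2 * Real.log Q) = Q ^ (n ^ 2) := by
      rw [← Nat.cast_pow, Real.exp_nat_mul, Real.exp_log hQ0]
    rw [e]
    gcongr
    exact le_mul_of_one_le_right (by linarith) (Real.one_le_exp zero_le_one)
  choose p hp hpu using fun n : ℕ => exists_real_polynomial_eval_eq_mul_exp
    (differentiable_gq hq0 hq1) (gq_zero q) (gq_conj q) hN (R := Q ^ (2 * n) / 2)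
    (M := c + n ^ 2 * Real.log Q) (by positivity) (by positivity) (hbound n)
  refine ⟨p, hp, fun ρ => ?_⟩
  obtain ⟨F, hF⟩ := (isCompact_closedBall (0 : ℂ) ρ).exists_bound_of_continuousOn
    (differentiable_gq hq0 hq1).continuous.continuousOn
  rw [Metric.tendstoUniformlyOn_iff]
  intro ε hε
  rcases lt_or_ge ρ 0 with hρ | hρ
  · exact Eventually.of_forall fun n z hz => by
      rw [closedBall_eq_empty.2 hρ] at hz
      exact hz.elim
  have hδ := tendsto_pow_two_div_pow_sub hQ c (Real.log Q) ρ
  have hFδ := (hδ.const_mul (2 * F))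
  rw [mul_zero] at hFδ
  have hbig : ∀ᶠ n : ℕ in atTop, ρ < Q ^ (2 * n) / 2 := by
    have h1 : Tendsto (fun n : ℕ => (Q ^ 2) ^ n / 2) atTop atTop :=
      (tendsto_pow_atTop_atTop_of_one_lt (one_lt_pow₀ hQ two_ne_zero)).atTop_div_const two_pos
    simpa only [pow_mul] using h1.eventually_gt_atTop ρ
  filter_upwards [hbig, hδ.eventually_le_const zero_lt_one, hFδ.eventually_lt_const hε]
    with n hn h1 h2 z hz
  have hzρ : ‖z‖ ≤ ρ := mem_closedBall_zero_iff.1 hz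
  obtain ⟨u, hu, hfu⟩ := hpu n z (hzρ.trans_lt hn)
  have hM : 0 < c + n ^ 2 * Real.log Q := by positivity
  have hu' : ‖u‖ ≤ 2 * (c + n ^ 2 * Real.log Q) * ρ / (Q ^ (2 * n) / 2 - ρ) := by
    refine hu.trans ?_
    have : 0 < Q ^ (2 * n) / 2 - ρ := by linarith
    gcongr
  have e : ((p n).map (algebraMap ℝ ℂ)).eval z = gq q z * Complex.exp (-u) := by
    rw [hfu, mul_assoc, ← Complex.exp_add, add_neg_cancel, Complex.exp_zero, mul_one]
  rw [dist_comm, dist_eq_norm, e, ← mul_sub_one, norm_mul]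
  have h3 := Complex.norm_exp_sub_one_le (x := -u) (by rw [norm_neg]; exact hu'.trans h1)
  rw [norm_neg] at h3
  calc ‖gq q z‖ * ‖Complex.exp (-u) - 1‖
      ≤ F * (2 * (2 * (c + n ^ 2 * Real.log Q) * ρ / (Q ^ (2 * n) / 2 - ρ))) := by
        have hFn : 0 ≤ F := (norm_nonneg _).trans (hF z hz)
        gcongr
        · exact hF z hz
        · linarith
    _ < ε := by linarith

theorem norm_coeff_mul_pow_le_of_hasSum {F : ℂ → ℂ} (hF : Differentiable ℂ F) {d : ℕ → ℂ}
    (hd : ∀ z, HasSum (fun k => d k * z ^ k) (F z)) {ρ ε : ℝ} (hρ : 0 < ρ)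
    (hε : ∀ z, ‖z‖ = ρ → ‖F z‖ ≤ ε) (k : ℕ) : ‖d k‖ * ρ ^ k ≤ ε := by
  have h1 : HasFPowerSeriesAt F (FormalMultilinearSeries.ofScalars ℂ d) 0 := by
    rw [hasFPowerSeriesAt_iff']
    refine Eventually.of_forall fun z => ?_
    simpa [FormalMultilinearSeries.coeff_ofScalars, mul_comm] using hd z
  have h2 := congrArg (fun s => s.coeff k)
    (h1.eq_formalMultilinearSeries (hF.analyticAt 0).hasFPowerSeriesAt)
  simp only [FormalMultilinearSeries.coeff_ofScalars] at h2
  have h3 := Complex.norm_iteratedDeriv_le_of_forall_mem_sphere_norm_le k hρ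
    (hF.diffContOnCl (s := ball (0 : ℂ) ρ)) (fun z hz => hε z (by simpa using hz))
  have hk : (0 : ℝ) < k.factorial := by exact_mod_cast k.factorial_pos
  rw [h2, norm_div, Complex.norm_natCast, div_mul_eq_mul_div, div_le_iff₀ hk, mul_comm ε]
  rwa [le_div_iff₀ (by positivity)] at h3

theorem exp_neg_pow_mul_one_add_mem_Icc {x : ℝ} (hx : 0 ≤ x) (m : ℕ) :
    (Real.exp (-x) * (1 + x)) ^ m ∈ Set.Icc (0 : ℝ) 1 := by
  refine ⟨by positivity, pow_le_one₀ (by positivity) ?_⟩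
  rw [Real.exp_neg, inv_mul_le_iff₀ (Real.exp_pos x), mul_one]
  linarith [Real.add_one_le_exp x]

theorem tendsto_exp_neg_mul_one_add_pow {a : ℝ} (ha : 0 < a) (k : ℕ) :
    Tendsto (fun n : ℕ => (Real.exp (-1 / (n + 1 : ℕ)) ^ k * (1 + k / (n + 1 : ℕ))) ^
      ⌊2 * a * ((n + 1 : ℕ) : ℝ) ^ 2⌋₊) atTop (nhds (Real.exp (-a * k ^ 2))) := by
  have hMtop : Tendsto (fun n : ℕ => ((n + 1 : ℕ) : ℝ)) atTop atTop :=
    tendsto_natCast_atTop_atTop.comp (tendsto_add_atTop_nat 1)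
  have hx : Tendsto (fun n : ℕ => (k : ℝ) / (n + 1 : ℕ)) atTop (nhds 0) :=
    hMtop.const_div_atTop _
  have hm : Tendsto (fun n : ℕ => (⌊2 * a * ((n + 1 : ℕ) : ℝ) ^ 2⌋₊ : ℝ) / ((n + 1 : ℕ) : ℝ) ^ 2)
      atTop (nhds (2 * a)) :=
    (tendsto_nat_floor_mul_div_atTop (by positivity)).comp
      ((tendsto_pow_atTop two_ne_zero).comp hMtop)
  have hlog : Tendsto (fun n : ℕ => ((n + 1 : ℕ) : ℝ) ^ 2 *
      (Real.log (1 + (k : ℝ) / (n + 1 : ℕ)) - (k : ℝ) / (n + 1 : ℕ))) atTop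
      (nhds (-((k : ℝ) ^ 2 / 2))) := by
    rw [tendsto_iff_norm_sub_tendsto_zero]
    have hb : Tendsto (fun n : ℕ => (k : ℝ) ^ 2 *
        ((k : ℝ) / (n + 1 : ℕ) / (1 - (k : ℝ) / (n + 1 : ℕ)))) atTop (nhds 0) := by
      simpa using (hx.div (hx.const_sub 1) (by norm_num)).const_mul ((k : ℝ) ^ 2)
    refine squeeze_zero' (Eventually.of_forall fun n => norm_nonneg _) ?_ hb
    filter_upwards [hx.eventually_lt_const zero_lt_one] with n hn
    set x : ℝ := (k : ℝ) / (n + 1 : ℕ) with hxdef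
    have hM : ((n + 1 : ℕ) : ℝ) ≠ 0 := by positivity
    have hx0 : 0 ≤ x := by positivity
    have hkx : (k : ℝ) = x * (n + 1 : ℕ) := by rw [hxdef, div_mul_cancel₀ _ hM]
    have h1 := Real.abs_log_sub_add_sum_range_le (x := -x) (by rwa [abs_neg, abs_of_nonneg hx0]) 2
    rw [abs_neg, abs_of_nonneg hx0] at h1
    simp only [Finset.sum_range_succ, Finset.sum_range_zero] at h1
    have e : ((n + 1 : ℕ) : ℝ) ^ 2 * (Real.log (1 + x) - x) - -((k : ℝ) ^ 2 / 2)
        = ((n + 1 : ℕ) : ℝ) ^ 2 * (Real.log (1 + x) - x + x ^ 2 / 2) := by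
      rw [hkx]
      ring
    have e2 : (k : ℝ) ^ 2 * (x / (1 - x)) = ((n + 1 : ℕ) : ℝ) ^ 2 * (x ^ 3 / (1 - x)) := by
      rw [hkx]
      ring
    rw [e, e2, norm_mul, Real.norm_of_nonneg (by positivity : (0 : ℝ) ≤ ((n + 1 : ℕ) : ℝ) ^ 2)]
    gcongr
    refine le_of_eq_of_le ?_ h1
    rw [Real.norm_eq_abs]
    congr 1
    norm_num
    ring
  have h := (Real.continuous_exp.tendsto _).comp (hm.mul hlog)
  rw [show 2 * a * -((k : ℝ) ^ 2 / 2) = -a * k ^ 2 by ring] at h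
  refine h.congr fun n => ?_
  have hM : ((n + 1 : ℕ) : ℝ) ≠ 0 := by positivity
  have hpos : 0 < 1 + (k : ℝ) / (n + 1 : ℕ) := by positivity
  simp only [Function.comp_apply]
  rw [← Real.exp_nat_mul, ← Real.exp_log hpos, ← Real.exp_add, ← Real.exp_nat_mul,
    Real.exp_log hpos]
  congr 1
  field_simp
  ring

end MultiplierLimit

section Monotonicity

open Metric Polynomial

theorem hasSum_coeff_mul_pow (p : ℝ[X]) (z : ℂ) :
    HasSum (fun k => (p.coeff k : ℂ) * z ^ k) ((p.map (algebraMap ℝ ℂ)).eval z) := by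
  have h : (p.map (algebraMap ℝ ℂ)).eval z
      = ∑ k ∈ Finset.range (p.natDegree + 1), (p.coeff k : ℂ) * z ^ k := by
    rw [eval_map, eval₂_eq_sum_range]
    rfl
  rw [h]
  refine hasSum_sum_of_ne_finset_zero fun k hk => ?_
  rw [Finset.mem_range, not_lt] at hk
  rw [coeff_eq_zero_of_natDegree_lt (by omega), Complex.ofReal_zero, zero_mul]

/-- Multiplying Taylor coefficients by bounded, pointwise convergent factors preserves locally
uniform convergence of polynomials to an entire function. -/
theorem tendstoLocallyUniformlyOn_of_coeff_eq_mul {p P : ℕ → ℝ[X]} {b s : ℕ → ℝ}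
    {a : ℕ → ℕ → ℝ} {f g : ℂ → ℂ} (hf : Differentiable ℂ f)
    (hfb : ∀ z, HasSum (fun k => (b k : ℂ) * z ^ k) (f z))
    (hgb : ∀ z, HasSum (fun k => ((s k * b k : ℝ) : ℂ) * z ^ k) (g z))
    (hp : ∀ ρ : ℝ, TendstoUniformlyOn (fun n z => ((p n).map (algebraMap ℝ ℂ)).eval z) f atTop
      (closedBall 0 ρ))
    (ha : ∀ n k, a n k ∈ Set.Icc (0 : ℝ) 1)
    (hs : ∀ k, Tendsto (fun n => a n k) atTop (nhds (s k)))
    (hP : ∀ n k, (P n).coeff k = a n k * (p n).coeff k) :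
    TendstoLocallyUniformlyOn (fun n z => ((P n).map (algebraMap ℝ ℂ)).eval z) g atTop
      Set.univ := by
  rw [tendstoLocallyUniformlyOn_iff_forall_isCompact isOpen_univ]
  intro K _ hK
  obtain ⟨ρ, hρ, hKρ⟩ := hK.isBounded.subset_closedBall_lt 0 0
  refine TendstoUniformlyOn.mono ?_ hKρ
  have hs01 : ∀ k, s k ∈ Set.Icc (0 : ℝ) 1 := fun k =>
    isClosed_Icc.mem_of_tendsto (hs k) (Eventually.of_forall fun n => ha n k)
  have hsumb : Summable fun k => |b k| * ρ ^ k := by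
    have h := (hfb (ρ : ℂ)).summable.norm
    refine h.congr fun k => ?_
    rw [norm_mul, norm_pow, Complex.norm_real, Complex.norm_real, Real.norm_eq_abs,
      Real.norm_of_nonneg hρ.le]
  have habs : ∀ n k, |a n k - s k| ≤ 1 := fun n k => by
    rw [abs_le]
    constructor <;> linarith [(ha n k).1, (ha n k).2, (hs01 k).1, (hs01 k).2]
  have hle : ∀ n k, |a n k - s k| * (|b k| * ρ ^ k) ≤ |b k| * ρ ^ k := fun n k =>
    mul_le_of_le_one_left (by positivity) (habs n k)
  have hsum2 : ∀ n, Summable fun k => |a n k - s k| * (|b k| * ρ ^ k) := fun n =>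
    Summable.of_nonneg_of_le (fun k => by positivity) (hle n) hsumb
  have htail : Tendsto (fun n => ∑' k, |a n k - s k| * (|b k| * ρ ^ k)) atTop (nhds 0) := by
    have h := tendsto_tsum_of_dominated_convergence (𝓕 := atTop)
      (f := fun n k => |a n k - s k| * (|b k| * ρ ^ k)) (g := fun _ => (0 : ℝ)) hsumb
      (fun k => by simpa using (((hs k).sub_const (s k)).abs.mul_const (|b k| * ρ ^ k)))
      (Eventually.of_forall fun n k => by
        rw [Real.norm_of_nonneg (by positivity)]
        exact hle n k)
    simpa using h
  rw [Metric.tendstoUniformlyOn_iff]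
  intro ε hε
  filter_upwards [Metric.tendstoUniformlyOn_iff.1 (hp (2 * ρ)) (ε / 4) (by positivity),
    htail.eventually_lt_const (half_pos hε)] with n hn htn z hz
  have hzρ : ‖z‖ ≤ ρ := mem_closedBall_zero_iff.1 hz
  have hcoeff : ∀ k, |(p n).coeff k - b k| * (2 * ρ) ^ k ≤ ε / 4 := by
    intro k
    have h := norm_coeff_mul_pow_le_of_hasSum
      (F := fun z => ((p n).map (algebraMap ℝ ℂ)).eval z - f z)
      (d := fun k => ((p n).coeff k : ℂ) - b k) (((p n).map _).differentiable.sub hf)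
      (fun z => by simpa only [sub_mul] using (hasSum_coeff_mul_pow (p n) z).sub (hfb z))
      (ρ := 2 * ρ) (ε := ε / 4) (by positivity)
      (fun z hz => by
        have := (hn z (mem_closedBall_zero_iff.2 hz.le)).le
        rwa [dist_comm, dist_eq_norm] at this) k
    rwa [← Complex.ofReal_sub, Complex.norm_real, Real.norm_eq_abs] at h
  have hdiff := (hasSum_coeff_mul_pow (P n) z).sub (hgb z)
  have hgeom : HasSum (fun k : ℕ => ε / 4 * (1 / 2 : ℝ) ^ k) (ε / 4 * 2) :=
    hasSum_geometric_two.mul_left _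
  have hbd := hdiff.norm_le_of_bounded (hgeom.add (hsum2 n).hasSum) (fun k => by
    rw [hP, ← sub_mul, ← Complex.ofReal_sub, norm_mul, norm_pow, Complex.norm_real,
      Real.norm_eq_abs]
    have e : a n k * (p n).coeff k - s k * b k
        = a n k * ((p n).coeff k - b k) + (a n k - s k) * b k := by ring
    have h1 : |(p n).coeff k - b k| * ρ ^ k ≤ ε / 4 * (1 / 2) ^ k := by
      have h2 := hcoeff k
      rw [mul_pow, mul_left_comm] at h2
      rw [one_div, inv_pow, ← div_eq_mul_inv, le_div_iff₀ (by positivity), mul_comm]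
      exact h2
    calc |a n k * (p n).coeff k - s k * b k| * ‖z‖ ^ k
        ≤ (|(p n).coeff k - b k| + |a n k - s k| * |b k|) * ρ ^ k := by
          gcongr
          rw [e]
          refine (abs_add_le _ _).trans ?_
          rw [abs_mul, abs_mul, abs_of_nonneg (ha n k).1]
          gcongr
          exact mul_le_of_le_one_left (abs_nonneg _) (ha n k).2
      _ = |(p n).coeff k - b k| * ρ ^ k + |a n k - s k| * (|b k| * ρ ^ k) := by ring
      _ ≤ _ := by gcongr)
  rw [dist_comm, dist_eq_norm]
  linarith

theorem sum_analyticOrderNatAt_gq_le {q₁ q₂ : ℝ} (h₁ : 0 < q₁) (h₁₂ : q₁ < q₂) (h₂ : q₂ < 1)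
    {N : ℕ} (hN : ∀ S : Finset ℂ, (∀ z ∈ S, gq q₂ z = 0 ∧ z.im ≠ 0) →
      ∑ z ∈ S, analyticOrderNatAt (gq q₂) z ≤ N)
    (S : Finset ℂ) (hS : ∀ z ∈ S, z.im ≠ 0) : ∑ z ∈ S, analyticOrderNatAt (gq q₁) z ≤ N := by
  have h2pos : 0 < q₂ := h₁.trans h₁₂
  have h1lt : q₁ < 1 := h₁₂.trans h₂
  obtain ⟨p, hpN, hp⟩ := exists_seq_real_polynomial_tendsto_gq h2pos h₂ hN
  set a : ℝ := -Real.log (q₁ / q₂) with ha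
  have hapos : 0 < a :=
    neg_pos.2 (Real.log_neg (by positivity) ((div_lt_one h2pos).2 h₁₂))
  choose P hPc hPN using fun n : ℕ => exists_coeff_eq_mul_nonrealCount_le (Nat.succ_pos n)
    (Real.exp_pos (-1 / (n + 1 : ℕ))).ne' ⌊2 * a * ((n + 1 : ℕ) : ℝ) ^ 2⌋₊ (p n)
  have hlim : TendstoLocallyUniformlyOn (fun n z => ((P n).map (algebraMap ℝ ℂ)).eval z)
      (gq q₁) atTop Set.univ := by
    refine tendstoLocallyUniformlyOn_of_coeff_eq_mul (b := fun k => q₂ ^ (k ^ 2))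
      (s := fun k => Real.exp (-a * k ^ 2)) (differentiable_gq h2pos h₂) (fun z => ?_)
      (fun z => ?_) hp (fun n k => ?_) (tendsto_exp_neg_mul_one_add_pow hapos) hPc
    · simpa using hasSum_gq h2pos h₂ z
    · have e : ∀ k : ℕ, Real.exp (-a * k ^ 2) * q₂ ^ (k ^ 2) = q₁ ^ (k ^ 2) := by
        intro k
        rw [ha, neg_neg, mul_comm _ ((k : ℝ) ^ 2), ← Nat.cast_pow, Real.exp_nat_mul,
          Real.exp_log (by positivity), ← mul_pow, div_mul_cancel₀ _ h2pos.ne']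
      simp only [e, Complex.ofReal_pow]
      exact hasSum_gq h₁ h1lt z
    · rw [← Real.exp_nat_mul, show (k : ℝ) * (-1 / (n + 1 : ℕ)) = -(k / (n + 1 : ℕ)) by ring]
      exact exp_neg_pow_mul_one_add_mem_Icc (by positivity) _
  exact sum_analyticOrderNatAt_le_of_nonrealCount_le hlim
    (Eventually.of_forall fun n => (hPN n).trans (hpN n)) S hS
    (fun z _ => analyticOrderAt_ne_top_of_differentiable (differentiable_gq h₁ h1lt)
      (by simp [gq_zero]) z)

end Monotonicity

/-- For every `q ∈ (0,1)` the function `g_q` has only finitely many non-real zeros, and the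
number of non-real zeros counted with multiplicity is a non-decreasing function of `q`. -/
theorem stmt17 :
    (∀ q ∈ Set.Ioo (0 : ℝ) 1, {z : ℂ | gq q z = 0 ∧ z.im ≠ 0}.Finite) ∧
    (∀ q₁ q₂ : ℝ, q₁ ∈ Set.Ioo (0 : ℝ) 1 → q₂ ∈ Set.Ioo (0 : ℝ) 1 → q₁ < q₂ →
      (∑' z : {z : ℂ // gq q₁ z = 0 ∧ z.im ≠ 0}, (zeroOrder (gq q₁) z.1 : ℝ≥0∞)) ≤
      (∑' z : {z : ℂ // gq q₂ z = 0 ∧ z.im ≠ 0}, (zeroOrder (gq q₂) z.1 : ℝ≥0∞))) := by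
  refine ⟨fun q hq => finite_nonreal_zeros_gq hq.1 hq.2, fun q₁ q₂ h₁ h₂ h₁₂ => ?_⟩
  have hsum : ∀ q ∈ Set.Ioo (0 : ℝ) 1, ∃ Z : Finset ℂ,
      (∀ z, z ∈ Z ↔ gq q z = 0 ∧ z.im ≠ 0) ∧
      (∑' z : {z : ℂ // gq q z = 0 ∧ z.im ≠ 0}, (zeroOrder (gq q) z.1 : ℝ≥0∞))
        = ((∑ z ∈ Z, analyticOrderNatAt (gq q) z : ℕ) : ℝ≥0∞) := by
    intro q hq
    have hfin := finite_nonreal_zeros_gq hq.1 hq.2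
    have hd := differentiable_gq hq.1 hq.2
    refine ⟨hfin.toFinset, fun z => hfin.mem_toFinset, ?_⟩
    have hord : ∀ z, zeroOrder (gq q) z = analyticOrderNatAt (gq q) z := fun z =>
      zeroOrder_eq_analyticOrderNatAt (hd.analyticAt z)
        (analyticOrderAt_ne_top_of_differentiable hd (by simp [gq_zero]) z)
    simp_rw [hord]
    have h := Finset.tsum_subtype' hfin.toFinset
      fun z => (analyticOrderNatAt (gq q) z : ℝ≥0∞)
    rw [hfin.coe_toFinset] at h
    push_cast
    exact h
  obtain ⟨Z₁, hZ₁, e₁⟩ := hsum q₁ h₁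
  obtain ⟨Z₂, hZ₂, e₂⟩ := hsum q₂ h₂
  rw [e₁, e₂, Nat.cast_le]
  refine sum_analyticOrderNatAt_gq_le h₁.1 h₁₂ h₂.2 (fun S hS => ?_) Z₁ fun z hz => ((hZ₁ z).1 hz).2
  exact Finset.sum_le_sum_of_subset fun z hz => (hZ₂ z).2 (hS z hz)
end
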